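/- (Comparison with the harmonic replacement.) Let n ≥ 2 and let (u,v) be a solution of Δu = u v², Δv = v u², u > 0, v > 0 on ℝⁿ which is a local minimizer and satisfies the linear growth condition u(x) + v(x) ≤ C₀(1 + |x|) for some constant C₀ > 0. Then there exists a constant C > 0 such that for every x₀ ∈ ℝⁿ and every R ≥ 1, if φ is the function which is harmonic in B_R(x₀), continuous on the closed ball, and equals u − v on ∂B_R(x₀), then ∫_{B_R(x₀)} |∇(u − v − φ)|² ≤ C R^{n − 1/2}. -/

import Mathlib

open MeasureTheory Metric
open scoped RealInnerProductSpace

noncomputable section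

/-- The Laplacian of a function on Euclidean space, as the trace of the second derivative. -/
def lap {n : ℕ} (u : EuclideanSpace ℝ (Fin n) → ℝ) (x : EuclideanSpace ℝ (Fin n)) : ℝ :=
  ∑ i : Fin n, iteratedFDeriv ℝ 2 u x (fun _ => EuclideanSpace.single i 1)

/-- A (positive classical) solution of the system Δu = u v², Δv = v u², u,v > 0 on ℝⁿ. -/
def IsSolution {n : ℕ} (u v : EuclideanSpace ℝ (Fin n) → ℝ) : Prop :=
  ContDiff ℝ (⊤ : ℕ∞) u ∧ ContDiff ℝ (⊤ : ℕ∞) v ∧ (∀ x, 0 < u x) ∧ (∀ x, 0 < v x) ∧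
    (∀ x, lap u x = u x * v x ^ 2) ∧ (∀ x, lap v x = v x * u x ^ 2)

/-- The energy of a pair of functions on the ball B_R(0). -/
def energy {n : ℕ} (u v : EuclideanSpace ℝ (Fin n) → ℝ) (R : ℝ) : ℝ :=
  ∫ y in ball (0 : EuclideanSpace ℝ (Fin n)) R,
    (‖gradient u y‖ ^ 2 + ‖gradient v y‖ ^ 2 + (u y) ^ 2 * (v y) ^ 2)

/-- A local minimizer: any smooth competitor coinciding with (u,v) outside a ball has no
smaller energy on that ball. -/
def IsLocalMinimizer {n : ℕ} (u v : EuclideanSpace ℝ (Fin n) → ℝ) : Prop :=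
  ∀ R > (0 : ℝ), ∀ ub vb : EuclideanSpace ℝ (Fin n) → ℝ,
    ContDiff ℝ (⊤ : ℕ∞) ub → ContDiff ℝ (⊤ : ℕ∞) vb →
    (∀ x ∉ ball (0 : EuclideanSpace ℝ (Fin n)) R, ub x = u x ∧ vb x = v x) →
    energy u v R ≤ energy ub vb R

/-- Euclidean `n`-space. -/
abbrev Eu (n : ℕ) := EuclideanSpace ℝ (Fin n)

section GradientCalculus

variable {F : Type*} [NormedAddCommGroup F] [InnerProductSpace ℝ F] [CompleteSpace F]
  {f g : F → ℝ} {f' g' x : F}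

theorem HasGradientAt.add_fun (hf : HasGradientAt f f' x) (hg : HasGradientAt g g' x) :
    HasGradientAt (fun z => f z + g z) (f' + g') x := by
  rw [hasGradientAt_iff_hasFDerivAt, map_add] at *
  exact hf.add hg

theorem HasGradientAt.sub_fun (hf : HasGradientAt f f' x) (hg : HasGradientAt g g' x) :
    HasGradientAt (fun z => f z - g z) (f' - g') x := by
  rw [hasGradientAt_iff_hasFDerivAt, map_sub] at *
  exact hf.sub hg

theorem HasGradientAt.mul_fun (hf : HasGradientAt f f' x) (hg : HasGradientAt g g' x) :
    HasGradientAt (fun z => f z * g z) (f x • g' + g x • f') x := by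
  rw [hasGradientAt_iff_hasFDerivAt] at *
  rw [map_add, map_smul, map_smul]
  exact hf.mul hg

theorem HasGradientAt.const_mul_fun (c : ℝ) (hf : HasGradientAt f f' x) :
    HasGradientAt (fun z => c * f z) (c • f') x := by
  rw [hasGradientAt_iff_hasFDerivAt] at *
  rw [map_smul]
  exact hf.const_mul c

theorem HasDerivAt.comp_hasGradientAt {q : ℝ → ℝ} {q' : ℝ} (hq : HasDerivAt q q' (f x))
    (hf : HasGradientAt f f' x) : HasGradientAt (fun z => q (f z)) (q' • f') x := by
  rw [hasGradientAt_iff_hasFDerivAt] at *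
  rw [map_smul]
  exact hq.comp_hasFDerivAt x hf

theorem ContDiff.hasGradientAt {k : WithTop ℕ∞} (hf : ContDiff ℝ k f) (hk : k ≠ 0) (x : F) :
    HasGradientAt f (gradient f x) x :=
  (hf.differentiable hk x).hasGradientAt

theorem ContDiff.contDiff_gradient {k l : WithTop ℕ∞} (hf : ContDiff ℝ k f) (hk : l + 1 ≤ k) :
    ContDiff ℝ l (gradient f) :=
  ((InnerProductSpace.toDual ℝ F).symm.toContinuousLinearEquiv.contDiff).comp
    (hf.fderiv_right hk)

theorem ContDiff.continuous_gradient {k : WithTop ℕ∞} (hf : ContDiff ℝ k f) (hk : 1 ≤ k) :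
    Continuous (gradient f) :=
  (hf.contDiff_gradient (l := 0) (by simpa using hk)).continuous

theorem norm_gradient_eq_norm_fderiv (f : F → ℝ) (x : F) :
    ‖gradient f x‖ = ‖fderiv ℝ f x‖ := by
  rw [gradient, LinearIsometryEquiv.norm_map]

theorem gradient_eq_zero_of_notMem_tsupport (hx : x ∉ tsupport f) : gradient f x = 0 := by
  have : f =ᶠ[nhds x] fun _ => 0 := notMem_tsupport_iff_eventuallyEq.1 hx
  rw [this.gradient_eq, gradient_fun_const]

theorem hasCompactSupport_gradient (hf : HasCompactSupport f) :
    HasCompactSupport (gradient f) :=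
  HasCompactSupport.intro hf fun _ hx => gradient_eq_zero_of_notMem_tsupport hx

end GradientCalculus

theorem lap_eq_sum_fderiv {n : ℕ} (f : Eu n → ℝ) (x : Eu n) :
    lap f x = ∑ i : Fin n, fderiv ℝ (fderiv ℝ f) x (EuclideanSpace.single i 1)
      (EuclideanSpace.single i 1) := by
  simp [lap, iteratedFDeriv_two_apply]

theorem inner_gradient_gradient {n : ℕ} (f g : Eu n → ℝ) (x : Eu n) :
    ⟪gradient f x, gradient g x⟫ = ∑ i : Fin n, fderiv ℝ f x (EuclideanSpace.single i 1) *
      fderiv ℝ g x (EuclideanSpace.single i 1) := by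
  rw [PiLp.inner_apply]
  refine Finset.sum_congr rfl fun i _ => ?_
  rw [← inner_gradient_left, ← inner_gradient_left, EuclideanSpace.inner_single_right,
    EuclideanSpace.inner_single_right]
  simp [mul_comm]

theorem continuousOn_lap {n : ℕ} {f : Eu n → ℝ} {U : Set (Eu n)} (hU : IsOpen U)
    (hf : ContDiffOn ℝ 2 f U) : ContinuousOn (lap f) U := by
  have h1 : ContDiffOn ℝ 1 (fderiv ℝ f) U := hf.fderiv_of_isOpen hU (by norm_num)
  have h2 : ContinuousOn (fderiv ℝ (fderiv ℝ f)) U :=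
    h1.continuousOn_fderiv_of_isOpen hU le_rfl
  have : lap f = fun x => ∑ i : Fin n, fderiv ℝ (fderiv ℝ f) x (EuclideanSpace.single i 1)
      (EuclideanSpace.single i 1) := funext (lap_eq_sum_fderiv f)
  rw [this]
  fun_prop

theorem continuous_lap {n : ℕ} {f : Eu n → ℝ} (hf : ContDiff ℝ 2 f) : Continuous (lap f) := by
  rw [← continuousOn_univ]
  exact continuousOn_lap isOpen_univ hf.contDiffOn

theorem ContinuousOn.continuous_mul_of_tsupport_subset {X : Type*} [TopologicalSpace X]
    {a b : X → ℝ} {U : Set X} (hU : IsOpen U) (ha : ContinuousOn a U) (hb : Continuous b)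
    (hs : tsupport b ⊆ U) : Continuous fun x => a x * b x := by
  refine continuous_of_tsupport fun x hx => ?_
  have hxU : x ∈ U := hs (closure_mono (Function.support_mul_subset_right _ _) hx)
  exact ((ha x hxU).continuousAt (hU.mem_nhds hxU)).mul hb.continuousAt

/-- Green's first identity for a compactly supported test function. -/
theorem integral_inner_gradient_eq_neg {n : ℕ} {f ξ : Eu n → ℝ} {U : Set (Eu n)} (hU : IsOpen U)
    (hf : ContDiffOn ℝ 2 f U) (hξ : ContDiff ℝ 1 ξ) (hc : HasCompactSupport ξ)
    (hs : tsupport ξ ⊆ U) :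
    ∫ x, ⟪gradient f x, gradient ξ x⟫ = -∫ x, lap f x * ξ x := by
  have h1 : ContDiffOn ℝ 1 (fderiv ℝ f) U := hf.fderiv_of_isOpen hU (by norm_num)
  have h0 : ContinuousOn (fderiv ℝ f) U := h1.continuousOn
  have h2 : ContinuousOn (fderiv ℝ (fderiv ℝ f)) U :=
    h1.continuousOn_fderiv_of_isOpen hU le_rfl
  have hξ1 : Continuous (fderiv ℝ ξ) := hξ.continuous_fderiv one_ne_zero
  have hcξ1 : ∀ e, HasCompactSupport fun x => fderiv ℝ ξ x e := fun e => hc.fderiv_apply ℝ e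
  have hD : ∀ x ∈ U, DifferentiableAt ℝ (fderiv ℝ f) x := fun x hx =>
    (h1.differentiableOn one_ne_zero).differentiableAt (hU.mem_nhds hx)
  have hDe : ∀ e, ∀ x ∈ U, fderiv ℝ (fun z => fderiv ℝ f z e) x e =
      fderiv ℝ (fderiv ℝ f) x e e := by
    intro e x hx
    rw [fderiv_clm_apply (hD x hx) (differentiableAt_const _)]
    simp
  have hI0 : ∀ e : Eu n, Integrable fun x => fderiv ℝ f x e * fderiv ℝ ξ x e := fun e =>
    (ContinuousOn.continuous_mul_of_tsupport_subset hU (h0.clm_apply continuousOn_const)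
      (hξ1.clm_apply continuous_const) ((tsupport_fderiv_apply_subset ℝ e).trans hs)
      ).integrable_of_hasCompactSupport ((hcξ1 e).mul_left)
  have hI1 : ∀ e : Eu n, Integrable fun x => fderiv ℝ (fderiv ℝ f) x e e * ξ x := fun e =>
    (ContinuousOn.continuous_mul_of_tsupport_subset hU
      ((h2.clm_apply continuousOn_const).clm_apply continuousOn_const)
      hξ.continuous hs).integrable_of_hasCompactSupport hc.mul_left
  have hI2 : ∀ e : Eu n, Integrable fun x => fderiv ℝ f x e * ξ x := fun e =>
    (ContinuousOn.continuous_mul_of_tsupport_subset hU (h0.clm_apply continuousOn_const)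
      hξ.continuous hs).integrable_of_hasCompactSupport hc.mul_left
  have hEq : ∀ e : Eu n, (fun x => fderiv ℝ (fun z => fderiv ℝ f z e) x e * ξ x) =
      fun x => fderiv ℝ (fderiv ℝ f) x e e * ξ x := by
    intro e
    ext x
    by_cases hx : x ∈ tsupport ξ
    · rw [hDe e x (hs hx)]
    · rw [image_eq_zero_of_notMem_tsupport hx, mul_zero, mul_zero]
  have key : ∀ e : Eu n, ∫ x, fderiv ℝ f x e * fderiv ℝ ξ x e =
      -∫ x, fderiv ℝ (fderiv ℝ f) x e e * ξ x := by
    intro e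
    have := integral_mul_fderiv_eq_neg_fderiv_mul_of_integrable (μ := volume)
      (f := fun x => fderiv ℝ f x e) (g := ξ) (v := e) (by rw [hEq]; exact hI1 e) (hI0 e) (hI2 e)
      (fun x hx => (hD x (hs hx)).clm_apply (differentiableAt_const _))
      (fun x _ => hξ.differentiable one_ne_zero x)
    rw [this, hEq]
  simp_rw [inner_gradient_gradient, lap_eq_sum_fderiv, Finset.sum_mul]
  rw [integral_finsetSum _ fun i _ => hI0 _, integral_finsetSum _ fun i _ => hI1 _,
    ← Finset.sum_neg_distrib]
  exact Finset.sum_congr rfl fun i _ => key _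

/-- A smooth radial averaging kernel `η` supported in the unit ball, together with a potential `H`
satisfying `∇H(y) = -η(y) y`. -/
structure RadialKernel (n : ℕ) where
  H : Eu n → ℝ
  η : Eu n → ℝ
  C : ℝ
  one_le_C : 1 ≤ C
  contDiff_H : ContDiff ℝ (⊤ : ℕ∞) H
  contDiff_η : ContDiff ℝ (⊤ : ℕ∞) η
  H_nonneg : ∀ y, 0 ≤ H y
  η_nonneg : ∀ y, 0 ≤ η y
  H_zero : ∀ y, 1 ≤ ‖y‖ → H y = 0
  η_zero : ∀ y, 1 ≤ ‖y‖ → η y = 0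
  gradient_H : ∀ y, gradient H y = -(η y) • y
  integral_η : ∫ y, η y = 1
  η_neg : ∀ y, η (-y) = η y
  le_H : ∀ y, ‖y‖ ≤ 1 / 2 → C⁻¹ ≤ H y
  η_le : ∀ y, η y ≤ C
  η_lip : ∀ y z, |η y - η z| ≤ C * ‖y - z‖
  η_taylor : ∀ a b, |η (a + b) - η a - ⟪gradient η a, b⟫| ≤ C * ‖b‖ ^ 2
  norm_gradient_η_le : ∀ y, ‖gradient η y‖ ≤ C

theorem HasCompactSupport.of_norm_ge {n : ℕ} {F : Type*} [Zero F] {f : Eu n → F}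
    (hf : ∀ y, 1 ≤ ‖y‖ → f y = 0) : HasCompactSupport f := by
  refine HasCompactSupport.intro (isCompact_closedBall 0 1) fun y hy => hf y ?_
  rw [mem_closedBall_zero_iff, not_le] at hy
  exact hy.le

theorem exists_taylor_bound {n : ℕ} {f : Eu n → ℝ} (hf : ContDiff ℝ (⊤ : ℕ∞) f)
    (hc : HasCompactSupport f) :
    ∃ C : ℝ, ∀ a b, |f (a + b) - f a - ⟪gradient f a, b⟫| ≤ C * ‖b‖ ^ 2 := by
  have h1 : ContDiff ℝ 1 (fderiv ℝ f) := hf.fderiv_right (by norm_cast)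
  obtain ⟨C, hC⟩ := h1.lipschitzWith_of_hasCompactSupport (hc.fderiv ℝ) one_ne_zero
  refine ⟨C, fun a b => ?_⟩
  have := (convex_closedBall a ‖b‖).norm_image_sub_le_of_norm_hasFDerivWithin_le'
    (f := f) (f' := fderiv ℝ f) (φ := fderiv ℝ f a) (C := C * ‖b‖) (x := a) (y := a + b)
    (fun z _ => ((hf.differentiable (by simp)) z).hasFDerivAt.hasFDerivWithinAt)
    (fun z hz => by
      have h2 := hC.dist_le_mul z a
      rw [dist_eq_norm] at h2
      refine h2.trans ?_
      rw [mem_closedBall] at hz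
      gcongr)
    (mem_closedBall_self (norm_nonneg _)) (by simp [mem_closedBall])
  rw [add_sub_cancel_left, Real.norm_eq_abs] at this
  rw [inner_gradient_left]
  calc _ ≤ _ := this
    _ = _ := by ring

theorem norm_sq_hasGradientAt {n : ℕ} (y : Eu n) :
    HasGradientAt (fun y : Eu n => ‖y‖ ^ 2) ((2 : ℝ) • y) y := by
  rw [hasGradientAt_iff_hasFDerivAt]
  have h : InnerProductSpace.toDual ℝ (Eu n) ((2 : ℝ) • y) = 2 • innerSL ℝ y := by
    ext z
    simp [two_smul]
  rw [h]
  exact (hasStrictFDerivAt_norm_sq y).hasFDerivAt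

theorem deriv_expNegInvGlue_one_pos : 0 < deriv expNegInvGlue 1 := by
  have h : HasDerivAt (fun x : ℝ => Real.exp (-x⁻¹)) (Real.exp (-(1 : ℝ)⁻¹) * -(-(1 ^ 2)⁻¹)) 1 :=
    ((hasDerivAt_inv one_ne_zero).neg).exp
  have he : expNegInvGlue =ᶠ[nhds 1] fun x : ℝ => Real.exp (-x⁻¹) := by
    filter_upwards [lt_mem_nhds (zero_lt_one (α := ℝ))] with x hx
    simp [expNegInvGlue, hx.not_ge]
  rw [he.deriv_eq, h.deriv]
  have := Real.exp_pos (-(1 : ℝ)⁻¹)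
  simpa using this

instance RadialKernel.instNonempty (n : ℕ) : Nonempty (RadialKernel n) := by
  have hsm : ContDiff ℝ (⊤ : ℕ∞) expNegInvGlue := expNegInvGlue.contDiff
  have hsd : ContDiff ℝ (⊤ : ℕ∞) (deriv expNegInvGlue) :=
    (contDiff_infty_iff_deriv.1 hsm).2
  have hin : ContDiff ℝ (⊤ : ℕ∞) fun y : Eu n => 1 - ‖y‖ ^ 2 :=
    contDiff_const.sub (contDiff_norm_sq ℝ)
  have hd0 : ∀ x, 0 ≤ deriv expNegInvGlue x := fun x => expNegInvGlue.monotone.deriv_nonneg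
  have hdz : ∀ x, x ≤ 0 → deriv expNegInvGlue x = 0 := by
    intro x hx
    rcases hx.lt_or_eq with h | h
    · have : expNegInvGlue =ᶠ[nhds x] fun _ => 0 := by
        filter_upwards [gt_mem_nhds h] with z hz using expNegInvGlue.zero_of_nonpos (le_of_lt hz)
      rw [this.deriv_eq, deriv_const]
    · refine IsLocalMin.deriv_eq_zero (Filter.Eventually.of_forall fun z => ?_)
      rw [expNegInvGlue.zero_of_nonpos hx]
      exact expNegInvGlue.nonneg z
  set η₀ : Eu n → ℝ := fun y => 2 * deriv expNegInvGlue (1 - ‖y‖ ^ 2) with hη₀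
  have hη₀s : ContDiff ℝ (⊤ : ℕ∞) η₀ := contDiff_const.mul (hsd.comp hin)
  have hη₀z : ∀ y, 1 ≤ ‖y‖ → η₀ y = 0 := fun y hy => by
    simp only [hη₀]
    rw [hdz _ (by nlinarith), mul_zero]
  have hη₀n : ∀ y, 0 ≤ η₀ y := fun y => mul_nonneg zero_le_two (hd0 _)
  have hη₀c : HasCompactSupport η₀ := .of_norm_ge hη₀z
  have hpos : 0 < ∫ y, η₀ y := by
    refine hη₀s.continuous.integral_pos_of_hasCompactSupport_nonneg_nonzero hη₀c hη₀n (x := 0) ?_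
    simp only [hη₀, norm_zero]
    norm_num
    exact deriv_expNegInvGlue_one_pos.ne'
  set m := (∫ y, η₀ y)⁻¹ with hm
  have hmp : 0 < m := inv_pos.2 hpos
  set H : Eu n → ℝ := fun y => m * expNegInvGlue (1 - ‖y‖ ^ 2) with hH
  set η : Eu n → ℝ := fun y => m * η₀ y with hη
  have hHs : ContDiff ℝ (⊤ : ℕ∞) H := contDiff_const.mul (hsm.comp hin)
  have hηs : ContDiff ℝ (⊤ : ℕ∞) η := contDiff_const.mul hη₀s
  have hHz : ∀ y, 1 ≤ ‖y‖ → H y = 0 := fun y hy => by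
    simp only [hH]
    rw [expNegInvGlue.zero_of_nonpos (by nlinarith), mul_zero]
  have hηz : ∀ y, 1 ≤ ‖y‖ → η y = 0 := fun y hy => by
    simp only [hη]
    rw [hη₀z y hy, mul_zero]
  have hηc : HasCompactSupport η := .of_norm_ge hηz
  obtain ⟨C2, hC2⟩ := hηc.exists_bound_of_continuous hηs.continuous
  obtain ⟨C3, hC3⟩ := hηs.lipschitzWith_of_hasCompactSupport hηc (by simp)
  obtain ⟨C4, hC4⟩ := exists_taylor_bound hηs hηc
  obtain ⟨C5, hC5⟩ := (hasCompactSupport_gradient hηc).exists_bound_of_continuous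
    (hηs.continuous_gradient (by norm_cast))
  set h0 := m * expNegInvGlue (1 / 2) with hh0
  have hh0p : 0 < h0 := mul_pos hmp (expNegInvGlue.pos_of_pos (by norm_num))
  have b2 : 0 ≤ C2 := (norm_nonneg _).trans (hC2 0)
  have b5 : 0 ≤ C5 := (norm_nonneg _).trans (hC5 0)
  have b6 : 0 ≤ h0⁻¹ := (inv_pos.2 hh0p).le
  have b3 : (0 : ℝ) ≤ C3 := C3.2
  have b4 : 0 ≤ |C4| := abs_nonneg _
  refine ⟨⟨H, η, 1 + C2 + C3 + |C4| + C5 + h0⁻¹, by linarith, hHs, hηs,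
    fun y => mul_nonneg hmp.le (expNegInvGlue.nonneg _), fun y => mul_nonneg hmp.le (hη₀n y),
    hHz, hηz, fun y => ?_, ?_, fun y => by simp [hη, hη₀], fun y hy => ?_, fun y => ?_,
    fun y z => ?_, fun a b => ?_, fun y => ?_⟩⟩
  · have hD : HasDerivAt expNegInvGlue (deriv expNegInvGlue (1 - ‖y‖ ^ 2)) (1 - ‖y‖ ^ 2) :=
      (hsm.differentiable (by simp) _).hasDerivAt
    have h1 := (hasGradientAt_const y (1 : ℝ)).sub_fun (norm_sq_hasGradientAt y)
    rw [((HasDerivAt.comp_hasGradientAt (f := fun y : Eu n => 1 - ‖y‖ ^ 2) hD h1).const_mul_fun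
      m).gradient]
    simp only [hη, hη₀, zero_sub, smul_neg, neg_smul, smul_smul]
    congr 2
    ring
  · simp only [hη]
    rw [integral_const_mul, hm, inv_mul_cancel₀ hpos.ne']
  · refine (inv_le_comm₀ (by linarith) (lt_of_lt_of_le hh0p ?_)).2 ?_
    · simp only [hH, hh0]
      gcongr
      refine expNegInvGlue.monotone ?_
      nlinarith [norm_nonneg y]
    · have : h0 ≤ H y := by
        simp only [hH, hh0]
        gcongr
        refine expNegInvGlue.monotone ?_
        nlinarith [norm_nonneg y]
      have := inv_anti₀ hh0p this
      linarith
  · have := (le_abs_self _).trans (hC2 y)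
    linarith
  · have := hC3.dist_le_mul y z
    rw [Real.dist_eq, dist_eq_norm] at this
    refine this.trans ?_
    gcongr
    linarith
  · refine (hC4 a b).trans ?_
    have := le_abs_self C4
    gcongr
    linarith
  · have := hC5 y
    linarith

theorem integral_comp_add_smul {n : ℕ} (F : Eu n → ℝ) (x : Eu n) {s : ℝ} (hs : 0 < s) :
    ∫ y, F (x + s • y) = (s ^ n)⁻¹ * ∫ z, F z := by
  rw [Measure.integral_comp_smul_of_nonneg volume (fun y => F (x + y)) s (hR := hs.le),
    integral_add_left_eq_self]
  simp

namespace RadialKernel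

variable {n : ℕ} (K : RadialKernel n)

theorem C_pos : 0 < K.C := zero_lt_one.trans_le K.one_le_C

theorem hasCompactSupport_η : HasCompactSupport K.η := .of_norm_ge K.η_zero

theorem continuous_η : Continuous K.η := K.contDiff_η.continuous

theorem integrable_mul_η {F : Eu n → ℝ} (hF : Continuous F) :
    Integrable fun y => F y * K.η y :=
  (hF.mul K.continuous_η).integrable_of_hasCompactSupport K.hasCompactSupport_η.mul_left

/-- Weighted average of `f` over the ball of radius `s` around `x`. -/
def avg (f : Eu n → ℝ) (x : Eu n) (s : ℝ) : ℝ := ∫ y, f (x + s • y) * K.η y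

/-- The test function attached to the kernel at centre `x` and scale `s`. -/
def test (x : Eu n) (s : ℝ) (z : Eu n) : ℝ := K.H (s⁻¹ • (z - x))

theorem avg_zero (f : Eu n → ℝ) (x : Eu n) : K.avg f x 0 = f x := by
  simp [avg, integral_const_mul, K.integral_η]

theorem integral_η_mono {F G : Eu n → ℝ} (hF : Continuous F) (hG : Continuous G)
    (h : ∀ y, ‖y‖ ≤ 1 → F y ≤ G y) : ∫ y, F y * K.η y ≤ ∫ y, G y * K.η y := by
  refine integral_mono (K.integrable_mul_η hF) (K.integrable_mul_η hG) fun y => ?_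
  rcases le_total ‖y‖ 1 with hy | hy
  · exact mul_le_mul_of_nonneg_right (h y hy) (K.η_nonneg y)
  · simp [K.η_zero y hy]

theorem sq_integral_η_le {F : Eu n → ℝ} (hF : Continuous F) :
    (∫ y, F y * K.η y) ^ 2 ≤ ∫ y, F y ^ 2 * K.η y := by
  set a := ∫ y, F y * K.η y with ha
  have h0 : 0 ≤ ∫ y, (F y - a) ^ 2 * K.η y :=
    integral_nonneg fun y => mul_nonneg (sq_nonneg _) (K.η_nonneg y)
  have h1 : ∫ y, (F y - a) ^ 2 * K.η y = (∫ y, F y ^ 2 * K.η y) - 2 * a * a + a ^ 2 := by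
    have e : (fun y => (F y - a) ^ 2 * K.η y) = fun y =>
        F y ^ 2 * K.η y - 2 * a * (F y * K.η y) + a ^ 2 * K.η y := by
      ext y
      ring
    have i1 : Integrable fun y => F y ^ 2 * K.η y := K.integrable_mul_η (hF.pow 2)
    have i2 := (K.integrable_mul_η hF).const_mul (2 * a)
    have i3 : Integrable fun y => a ^ 2 * K.η y := K.integrable_mul_η continuous_const
    rw [e, integral_add (f := fun y => F y ^ 2 * K.η y - 2 * a * (F y * K.η y)) (i1.sub i2) i3,
      integral_sub i1 i2, integral_const_mul,
      integral_const_mul, K.integral_η, ← ha, mul_one]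
  nlinarith

theorem continuous_comp {f : Eu n → ℝ} (hf : Continuous f) (x : Eu n) (s : ℝ) :
    Continuous fun y : Eu n => f (x + s • y) := by fun_prop

theorem add_smul_mem_closedBall (x : Eu n) {s : ℝ} (hs : 0 ≤ s) {y : Eu n} (hy : ‖y‖ ≤ 1) :
    x + s • y ∈ closedBall x s := by
  rw [mem_closedBall, dist_eq_norm, add_sub_cancel_left, norm_smul, Real.norm_of_nonneg hs]
  nlinarith

theorem avg_mono {f g : Eu n → ℝ} (hf : Continuous f) (hg : Continuous g) {x : Eu n} {s : ℝ}
    (hs : 0 ≤ s) (h : ∀ z ∈ closedBall x s, f z ≤ g z) : K.avg f x s ≤ K.avg g x s :=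
  K.integral_η_mono (continuous_comp hf x s) (continuous_comp hg x s) fun _ hy =>
    h _ (add_smul_mem_closedBall x hs hy)

theorem avg_const (a : ℝ) (x : Eu n) (s : ℝ) : K.avg (fun _ => a) x s = a := by
  simp [avg, integral_const_mul, K.integral_η]

theorem avg_sub {f g : Eu n → ℝ} (hf : Continuous f) (hg : Continuous g) (x : Eu n) (s : ℝ) :
    K.avg (fun z => f z - g z) x s = K.avg f x s - K.avg g x s := by
  simp only [avg, sub_mul]
  exact integral_sub (K.integrable_mul_η (continuous_comp hf x s))
    (K.integrable_mul_η (continuous_comp hg x s))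

theorem avg_add {f g : Eu n → ℝ} (hf : Continuous f) (hg : Continuous g) (x : Eu n) (s : ℝ) :
    K.avg (fun z => f z + g z) x s = K.avg f x s + K.avg g x s := by
  simp only [avg, add_mul]
  exact integral_add (K.integrable_mul_η (continuous_comp hf x s))
    (K.integrable_mul_η (continuous_comp hg x s))

theorem avg_const_mul (a : ℝ) (f : Eu n → ℝ) (x : Eu n) (s : ℝ) :
    K.avg (fun z => a * f z) x s = a * K.avg f x s := by
  simp only [avg, mul_assoc]
  exact integral_const_mul _ _

theorem avg_nonneg {f : Eu n → ℝ} (hf : ∀ z, 0 ≤ f z) (x : Eu n) (s : ℝ) : 0 ≤ K.avg f x s :=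
  integral_nonneg fun y => mul_nonneg (hf _) (K.η_nonneg y)

theorem sq_avg_le {f : Eu n → ℝ} (hf : Continuous f) (x : Eu n) (s : ℝ) :
    K.avg f x s ^ 2 ≤ K.avg (fun z => f z ^ 2) x s :=
  K.sq_integral_η_le (continuous_comp hf x s)

theorem avg_eq (f : Eu n → ℝ) (x : Eu n) {s : ℝ} (hs : 0 < s) :
    K.avg f x s = (s ^ n)⁻¹ * ∫ z, f z * K.η (s⁻¹ • (z - x)) := by
  rw [← integral_comp_add_smul _ x hs]
  simp [avg, smul_smul, inv_mul_cancel₀ hs.ne']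

theorem norm_inv_smul_ge {x z : Eu n} {s : ℝ} (hs : 0 < s) (hz : s ≤ ‖z - x‖) :
    1 ≤ ‖s⁻¹ • (z - x)‖ := by
  rwa [norm_smul, norm_inv, Real.norm_of_nonneg hs.le, ← div_eq_inv_mul, one_le_div hs]

theorem avg_le_integral {f : Eu n → ℝ} (hf : Continuous f) (h0 : ∀ z, 0 ≤ f z) (x : Eu n) {s : ℝ}
    (hs : 0 < s) : K.avg f x s ≤ (s ^ n)⁻¹ * (K.C * ∫ z in ball x s, f z) := by
  rw [K.avg_eq f x hs]
  refine mul_le_mul_of_nonneg_left ?_ (by positivity)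
  rw [← integral_const_mul, ← integral_indicator measurableSet_ball]
  refine integral_mono_of_nonneg (Filter.Eventually.of_forall fun z =>
    mul_nonneg (h0 z) (K.η_nonneg _)) ?_ (Filter.Eventually.of_forall fun z => ?_)
  · rw [integrable_indicator_iff measurableSet_ball]
    exact (continuous_const.mul hf).continuousOn.integrableOn_compact
      (isCompact_closedBall x s) |>.mono_set ball_subset_closedBall
  · by_cases hz : z ∈ ball x s
    · simp only [Set.indicator_of_mem hz]
      rw [mul_comm]
      exact mul_le_mul_of_nonneg_right (K.η_le _) (h0 z)
    · rw [mem_ball, dist_eq_norm, not_lt] at hz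
      simp only [K.η_zero _ (norm_inv_smul_ge hs hz), mul_zero]
      exact Set.indicator_nonneg (fun z _ => mul_nonneg K.C_pos.le (h0 z)) _

theorem contDiff_test (x : Eu n) (s : ℝ) : ContDiff ℝ (⊤ : ℕ∞) (K.test x s) :=
  K.contDiff_H.comp (by fun_prop)

theorem test_eq_zero {x : Eu n} {s : ℝ} (hs : 0 < s) {z : Eu n} (hz : s ≤ ‖z - x‖) :
    K.test x s z = 0 := K.H_zero _ (norm_inv_smul_ge hs hz)

theorem test_nonneg (x : Eu n) (s : ℝ) (z : Eu n) : 0 ≤ K.test x s z := K.H_nonneg _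

theorem tsupport_test_subset {x : Eu n} {s : ℝ} (hs : 0 < s) :
    tsupport (K.test x s) ⊆ closedBall x s := by
  refine closure_minimal (fun z hz => ?_) isClosed_closedBall
  by_contra h
  rw [mem_closedBall, dist_eq_norm, not_le] at h
  exact hz (K.test_eq_zero hs h.le)

theorem hasCompactSupport_test (x : Eu n) {s : ℝ} (hs : 0 < s) :
    HasCompactSupport (K.test x s) :=
  (isCompact_closedBall x s).of_isClosed_subset (isClosed_tsupport _) (K.tsupport_test_subset hs)

theorem gradient_test (x : Eu n) (s : ℝ) (z : Eu n) :
    gradient (K.test x s) z = s⁻¹ • (-(K.η (s⁻¹ • (z - x))) • (s⁻¹ • (z - x))) := by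
  have h1 : HasGradientAt K.H (-(K.η (s⁻¹ • (z - x))) • (s⁻¹ • (z - x))) (s⁻¹ • (z - x)) := by
    rw [← K.gradient_H]
    exact K.contDiff_H.hasGradientAt (by simp) _
  refine HasGradientAt.gradient ?_
  rw [hasGradientAt_iff_hasFDerivAt] at h1 ⊢
  have h2 : HasFDerivAt (fun z : Eu n => s⁻¹ • (z - x)) (s⁻¹ • ContinuousLinearMap.id ℝ (Eu n)) z :=
    ((hasFDerivAt_id z).sub_const x).const_smul s⁻¹
  have h3 := h1.comp z h2
  rw [map_smul]
  have e : ∀ L : Eu n →L[ℝ] ℝ, L.comp (s⁻¹ • ContinuousLinearMap.id ℝ (Eu n)) = s⁻¹ • L := by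
    intro L
    ext v
    simp
  rw [e] at h3
  exact h3

theorem hasDerivAt_avg {f : Eu n → ℝ} (hf : ContDiff ℝ 1 f) (x : Eu n) (s : ℝ) :
    HasDerivAt (K.avg f x) (∫ y, ⟪gradient f (x + s • y), y⟫ * K.η y) s := by
  have hg : Continuous (gradient f) := hf.continuous_gradient le_rfl
  obtain ⟨M, hM⟩ := (isCompact_closedBall x (|s| + 1)).exists_bound_of_continuousOn
    hg.continuousOn
  have hM0 : 0 ≤ M := (norm_nonneg _).trans (hM x (mem_closedBall_self (by positivity)))
  refine (hasDerivAt_integral_of_dominated_loc_of_deriv_le (μ := volume)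
    (F := fun t y => f (x + t • y) * K.η y)
    (F' := fun t y => ⟪gradient f (x + t • y), y⟫ * K.η y) (bound := fun y => M * K.η y)
    (ball_mem_nhds s one_pos) (Filter.Eventually.of_forall fun t => ?_)
    (K.integrable_mul_η (continuous_comp hf.continuous x s)) ?_ ?_
    (K.integrable_mul_η continuous_const) ?_).2
  · exact (K.integrable_mul_η (continuous_comp hf.continuous x t)).aestronglyMeasurable
  · have : Continuous fun y : Eu n => ⟪gradient f (x + s • y), y⟫ := by fun_prop
    exact (K.integrable_mul_η this).aestronglyMeasurable
  · refine Filter.Eventually.of_forall fun y t ht => ?_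
    rw [norm_mul, Real.norm_of_nonneg (K.η_nonneg y)]
    rcases le_total ‖y‖ 1 with hy | hy
    · refine mul_le_mul_of_nonneg_right ?_ (K.η_nonneg y)
      have hmem : x + t • y ∈ closedBall x (|s| + 1) := by
        rw [mem_closedBall, dist_eq_norm, add_sub_cancel_left, norm_smul, Real.norm_eq_abs]
        rw [mem_ball, Real.dist_eq] at ht
        have : |t| ≤ |s| + 1 := by
          have := abs_sub_abs_le_abs_sub t s
          linarith
        nlinarith [abs_nonneg t, norm_nonneg y]
      calc _ ≤ ‖gradient f (x + t • y)‖ * ‖y‖ := norm_inner_le_norm _ _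
        _ ≤ M * 1 := mul_le_mul (hM _ hmem) hy (norm_nonneg _) hM0
        _ = M := mul_one M
    · simp [K.η_zero y hy]
  · refine Filter.Eventually.of_forall fun y t _ => ?_
    refine HasDerivAt.mul_const ?_ _
    have h1 : HasDerivAt (fun t : ℝ => x + t • y) y t := by
      simpa using ((hasDerivAt_id t).smul_const y).const_add x
    have h2 := (hf.hasGradientAt one_ne_zero (x + t • y)).hasFDerivAt.comp_hasDerivAt t h1
    simp only [InnerProductSpace.toDual_apply_apply] at h2
    exact h2

theorem integral_inner_gradient_η {f : Eu n → ℝ} (x : Eu n) {s : ℝ} (hs : 0 < s) :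
    ∫ y, ⟪gradient f (x + s • y), y⟫ * K.η y =
      -(s * (s ^ n)⁻¹ * ∫ z, ⟪gradient f z, gradient (K.test x s) z⟫) := by
  rw [mul_assoc, ← integral_comp_add_smul _ x hs, ← integral_const_mul, ← integral_neg]
  congr 1
  ext y
  rw [K.gradient_test, add_sub_cancel_left, smul_smul s⁻¹ s, inv_mul_cancel₀ hs.ne', one_smul,
    inner_smul_right, inner_smul_right]
  field_simp

end RadialKernel

namespace RadialKernel

variable {n : ℕ} (K : RadialKernel n)

theorem integral_inner_gradient_η_eq_lap {f : Eu n → ℝ} (hf : ContDiff ℝ 2 f) (x : Eu n) {s : ℝ}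
    (hs : 0 < s) :
    ∫ y, ⟪gradient f (x + s • y), y⟫ * K.η y =
      s * (s ^ n)⁻¹ * ∫ z, lap f z * K.test x s z := by
  rw [K.integral_inner_gradient_η x hs,
    integral_inner_gradient_eq_neg isOpen_univ hf.contDiffOn
      ((K.contDiff_test x s).of_le (by norm_cast)) (K.hasCompactSupport_test x hs)
      (Set.subset_univ _)]
  ring

theorem continuous_test (x : Eu n) (s : ℝ) : Continuous (K.test x s) :=
  (K.contDiff_test x s).continuous

theorem continuous_avg {f : Eu n → ℝ} (hf : ContDiff ℝ 1 f) (x : Eu n) :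
    Continuous (K.avg f x) :=
  continuous_iff_continuousAt.2 fun s => (K.hasDerivAt_avg hf x s).continuousAt

theorem deriv_avg_nonneg {f : Eu n → ℝ} (hf : ContDiff ℝ 2 f) (hl : ∀ z, 0 ≤ lap f z) (x : Eu n)
    {s : ℝ} (hs : 0 < s) : 0 ≤ deriv (K.avg f x) s := by
  rw [(K.hasDerivAt_avg (hf.of_le (by norm_num)) x s).deriv,
    K.integral_inner_gradient_η_eq_lap hf x hs]
  have : 0 ≤ ∫ z, lap f z * K.test x s z :=
    integral_nonneg fun z => mul_nonneg (hl z) (K.test_nonneg x s z)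
  positivity

theorem monotoneOn_avg {f : Eu n → ℝ} (hf : ContDiff ℝ 2 f) (hl : ∀ z, 0 ≤ lap f z) (x : Eu n) :
    MonotoneOn (K.avg f x) (Set.Ici 0) := by
  have hf1 : ContDiff ℝ 1 f := hf.of_le (by norm_num)
  refine monotoneOn_of_deriv_nonneg (convex_Ici 0) (K.continuous_avg hf1 x).continuousOn
    (fun s _ => (K.hasDerivAt_avg hf1 x s).differentiableAt.differentiableWithinAt) fun s hs => ?_
  rw [interior_Ici] at hs
  exact K.deriv_avg_nonneg hf hl x hs

theorem le_avg {f : Eu n → ℝ} (hf : ContDiff ℝ 2 f) (hl : ∀ z, 0 ≤ lap f z) (x : Eu n)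
    {s : ℝ} (hs : 0 ≤ s) : f x ≤ K.avg f x s := by
  rw [← K.avg_zero f x]
  exact K.monotoneOn_avg hf hl x (Set.mem_Ici.2 le_rfl) hs hs

/-- The mass of the Laplacian of a bounded subharmonic function. -/
theorem integral_lap_le {f : Eu n → ℝ} (hf : ContDiff ℝ 2 f) (hl : ∀ z, 0 ≤ lap f z)
    (h0 : ∀ z, 0 ≤ f z) {x : Eu n} {ρ A : ℝ} (hρ : 0 < ρ)
    (hA : ∀ z ∈ closedBall x (4 * ρ), f z ≤ A) :
    ρ ^ 2 * ∫ z in ball x ρ, lap f z ≤ K.C * 4 ^ n * ρ ^ n * A := by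
  have hf1 : ContDiff ℝ 1 f := hf.of_le (by norm_num)
  obtain ⟨s, ⟨hs1, hs2⟩, hs⟩ := exists_deriv_eq_slope (K.avg f x)
    (show 2 * ρ < 4 * ρ by linarith) (K.continuous_avg hf1 x).continuousOn
    (fun s _ => (K.hasDerivAt_avg hf1 x s).differentiableAt.differentiableWithinAt)
  have hs0 : 0 < s := by linarith
  have hcl : Continuous (lap f) := continuous_lap hf
  have hup : K.avg f x (4 * ρ) - K.avg f x (2 * ρ) ≤ A := by
    have h1 := K.avg_nonneg h0 x (2 * ρ)
    have h2 := K.avg_mono hf.continuous continuous_const (by linarith) hA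
    rw [K.avg_const] at h2
    linarith
  have hI0 : 0 ≤ ∫ z in ball x ρ, lap f z := integral_nonneg hl
  have hlow : K.C⁻¹ * (∫ z in ball x ρ, lap f z) ≤ ∫ z, lap f z * K.test x s z := by
    rw [← integral_const_mul, ← integral_indicator measurableSet_ball]
    refine integral_mono_of_nonneg (Filter.Eventually.of_forall fun z =>
      Set.indicator_nonneg (fun z _ => mul_nonneg (inv_nonneg.2 K.C_pos.le) (hl z)) _) ?_
      (Filter.Eventually.of_forall fun z => ?_)
    · exact (hcl.mul (K.continuous_test x s)).integrable_of_hasCompactSupport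
        (K.hasCompactSupport_test x hs0).mul_left
    · by_cases hz : z ∈ ball x ρ
      · simp only [Set.indicator_of_mem hz]
        rw [mul_comm]
        refine mul_le_mul_of_nonneg_left (K.le_H _ ?_) (hl z)
        rw [mem_ball, dist_eq_norm] at hz
        rw [norm_smul, norm_inv, Real.norm_of_nonneg hs0.le, ← div_eq_inv_mul,
          div_le_iff₀ hs0]
        linarith
      · simp only [Set.indicator_of_notMem hz]
        exact mul_nonneg (hl z) (K.test_nonneg x s z)
  rw [(K.hasDerivAt_avg hf1 x s).deriv, K.integral_inner_gradient_η_eq_lap hf x hs0,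
    eq_div_iff (by linarith)] at hs
  set I := ∫ z in ball x ρ, lap f z
  have hsn : s ^ n ≤ (4 * ρ) ^ n := pow_le_pow_left₀ hs0.le hs2.le n
  have hsn0 : 0 < s ^ n := by positivity
  have h3 : s * (s ^ n)⁻¹ * (K.C⁻¹ * I) * (2 * ρ) ≤ A := by
    refine le_trans ?_ (hs.le.trans hup) |>.trans le_rfl
    have : s * (s ^ n)⁻¹ * (K.C⁻¹ * I) ≤ s * (s ^ n)⁻¹ * ∫ z, lap f z * K.test x s z := by
      gcongr
    calc _ ≤ (s * (s ^ n)⁻¹ * ∫ z, lap f z * K.test x s z) * (2 * ρ) := by gcongr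
      _ = (s * (s ^ n)⁻¹ * ∫ z, lap f z * K.test x s z) * (4 * ρ - 2 * ρ) := by ring
  have hC := K.C_pos
  have h4 : s * (2 * ρ) * I ≤ A * K.C * s ^ n := by
    have e : s * (s ^ n)⁻¹ * (K.C⁻¹ * I) * (2 * ρ) = s * (2 * ρ) * I / (K.C * s ^ n) := by
      field_simp
    rw [e, div_le_iff₀ (by positivity)] at h3
    linarith
  have hA0 : 0 ≤ A := (h0 x).trans (hA x (mem_closedBall_self (by linarith)))
  calc ρ ^ 2 * I ≤ s * (2 * ρ) * I := by
        refine mul_le_mul_of_nonneg_right ?_ hI0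
        nlinarith
    _ ≤ A * K.C * s ^ n := h4
    _ ≤ A * K.C * (4 * ρ) ^ n := by gcongr
    _ = _ := by rw [mul_pow]; ring

/-- Local `L²`-boundedness of nonnegative subharmonic functions. -/
theorem sq_le_of_subharmonic {f : Eu n → ℝ} (hf : ContDiff ℝ 2 f) (hl : ∀ z, 0 ≤ lap f z)
    (h0 : ∀ z, 0 ≤ f z) (x : Eu n) {s : ℝ} (hs : 0 < s) :
    f x ^ 2 ≤ (s ^ n)⁻¹ * (K.C * ∫ z in ball x s, f z ^ 2) :=
  (pow_le_pow_left₀ (h0 x) (K.le_avg hf hl x hs.le) 2).trans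
    ((K.sq_avg_le hf.continuous x s).trans
      (K.avg_le_integral (hf.continuous.pow 2) (fun _ => sq_nonneg _) x hs))

end RadialKernel

namespace RadialKernel

variable {n : ℕ} (K : RadialKernel n)

theorem avg_translate (f : Eu n → ℝ) (y h : Eu n) (s : ℝ) :
    K.avg f (y + s • h) s = ∫ ζ, f (y + s • ζ) * K.η (ζ - h) := by
  rw [← integral_add_right_eq_self _ h]
  simp only [avg, smul_add, add_sub_cancel_right]
  congr 1
  ext ζ
  congr 2
  abel

theorem integrable_mul_η_sub {F : Eu n → ℝ} (hF : Continuous F) (h : Eu n) :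
    Integrable fun ζ => F ζ * K.η (ζ - h) := by
  have := (K.integrable_mul_η (F := fun ζ => F (ζ + h)) (by fun_prop)).comp_sub_right h
  simpa using this

theorem η_sub_eq_zero {h ζ : Eu n} (hh : ‖h‖ ≤ 1) (hζ : ζ ∉ closedBall (0 : Eu n) 2) :
    K.η (ζ - h) = 0 := by
  refine K.η_zero _ ?_
  rw [mem_closedBall_zero_iff, not_le] at hζ
  have := norm_sub_norm_le ζ h
  linarith

theorem abs_avg_translate_sub_le {f : Eu n → ℝ} (hf : Continuous f) {y h : Eu n} {s A : ℝ}
    (hs : 0 ≤ s) (hA : ∀ z ∈ closedBall y (2 * s), |f z| ≤ A) (hh : ‖h‖ ≤ 1) :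
    |K.avg f (y + s • h) s - K.avg f y s| ≤
      A * K.C * volume.real (closedBall (0 : Eu n) 2) * ‖h‖ := by
  rw [avg_translate, avg, ← integral_sub (K.integrable_mul_η_sub (continuous_comp hf y s) h)
    (K.integrable_mul_η (continuous_comp hf y s))]
  have hA0 : 0 ≤ A := (abs_nonneg _).trans (hA y (mem_closedBall_self (by linarith)))
  have e : ∫ ζ, f (y + s • ζ) * K.η (ζ - h) - f (y + s • ζ) * K.η ζ =
      ∫ ζ in closedBall (0 : Eu n) 2, f (y + s • ζ) * K.η (ζ - h) - f (y + s • ζ) * K.η ζ := by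
    refine (setIntegral_eq_integral_of_forall_compl_eq_zero fun ζ hζ => ?_).symm
    rw [K.η_sub_eq_zero hh hζ]
    have := K.η_sub_eq_zero (h := 0) (by simp) hζ
    rw [sub_zero] at this
    simp [this]
  rw [e, ← Real.norm_eq_abs]
  refine (norm_setIntegral_le_of_norm_le_const (C := A * (K.C * ‖h‖))
    measure_closedBall_lt_top fun ζ hζ => ?_).trans_eq (by ring)
  rw [← mul_sub, norm_mul]
  refine mul_le_mul (hA _ ?_) ?_ (norm_nonneg _) hA0
  · rw [mem_closedBall, dist_eq_norm, add_sub_cancel_left, norm_smul, Real.norm_of_nonneg hs]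
    rw [mem_closedBall_zero_iff] at hζ
    nlinarith
  · have := K.η_lip (ζ - h) ζ
    rwa [sub_sub_cancel_left, norm_neg] at this

end RadialKernel

theorem ContDiff.two_of_top {n : ℕ} {f : Eu n → ℝ} (hf : ContDiff ℝ (⊤ : ℕ∞) f) :
    ContDiff ℝ 2 f := hf.of_le (by norm_cast)

theorem ContDiff.one_of_top {n : ℕ} {f : Eu n → ℝ} (hf : ContDiff ℝ (⊤ : ℕ∞) f) :
    ContDiff ℝ 1 f := hf.of_le (by norm_cast)

namespace IsSolution

variable {n : ℕ} {u v : Eu n → ℝ}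

theorem symm (h : IsSolution u v) : IsSolution v u :=
  ⟨h.2.1, h.1, h.2.2.2.1, h.2.2.1, h.2.2.2.2.2, h.2.2.2.2.1⟩

theorem smooth (h : IsSolution u v) : ContDiff ℝ (⊤ : ℕ∞) u := h.1

theorem smooth_right (h : IsSolution u v) : ContDiff ℝ (⊤ : ℕ∞) v := h.2.1

theorem pos (h : IsSolution u v) (x : Eu n) : 0 < u x := h.2.2.1 x

theorem pos_right (h : IsSolution u v) (x : Eu n) : 0 < v x := h.2.2.2.1 x

theorem lap_eq (h : IsSolution u v) (x : Eu n) : lap u x = u x * v x ^ 2 := h.2.2.2.2.1 x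

theorem lap_nonneg (h : IsSolution u v) (x : Eu n) : 0 ≤ lap u x := by
  rw [h.lap_eq]
  exact mul_nonneg (h.pos x).le (sq_nonneg _)

end IsSolution

/-- Where both components are not too small, one of them decays by a fixed factor. -/
theorem exists_decay_step (n : ℕ) : ∃ l D : ℝ, 0 < l ∧ l ≤ 1 / 8 ∧ 1 ≤ D ∧
    ∀ u v : Eu n → ℝ, IsSolution u v → ∀ (y : Eu n) (ρ A B : ℝ), 0 < ρ →
      (∀ z ∈ closedBall y ρ, u z ≤ A) → (∀ z ∈ closedBall y ρ, v z ≤ B) → D ≤ ρ * v y →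
      (∀ z ∈ closedBall y (l * ρ), u z ≤ 7 / 8 * A) ∨
        ∀ z ∈ closedBall y (l * ρ), v z ≤ 7 / 8 * B := by
  obtain ⟨K⟩ := RadialKernel.instNonempty n
  have hC := K.C_pos
  set V := volume.real (closedBall (0 : Eu n) 2) with hV
  have hV0 : 0 ≤ V := measureReal_nonneg
  set l : ℝ := (8 * (8 * (K.C * V) + 1))⁻¹ with hl
  have hlp : 0 < l := by positivity
  have hl8 : l ≤ 1 / 8 := by
    rw [hl, ← one_div]
    refine one_div_le_one_div_of_le (by norm_num) ?_
    nlinarith [mul_nonneg hC.le hV0]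
  have hlV : K.C * V * (8 * l) ≤ 1 / 8 := by
    rw [hl]
    rw [mul_comm 8 (_⁻¹), ← div_eq_inv_mul, mul_div_assoc', div_le_iff₀ (by positivity)]
    nlinarith [mul_nonneg hC.le hV0]
  refine ⟨l, 8 * (2 * K.C * 2 ^ n) , hlp, hl8, ?_, ?_⟩
  · have h1 := K.one_le_C
    have h2 : (1 : ℝ) ≤ 2 ^ n := one_le_pow₀ (by norm_num)
    nlinarith
  intro u v h y ρ A B hρ hA hB hD
  have hcu := h.smooth.continuous
  have hcv := h.smooth_right.continuous
  have hy : y ∈ closedBall y ρ := mem_closedBall_self hρ.le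
  have hA0 : 0 < A := (h.pos y).trans_le (hA y hy)
  have hB0 : 0 < B := (h.pos_right y).trans_le (hB y hy)
  set s := ρ / 8 with hs
  have hs0 : 0 < s := by positivity
  have hss : ∀ z ∈ closedBall y s, z ∈ closedBall y ρ := fun z hz =>
    closedBall_subset_closedBall (by rw [hs]; linarith) hz
  have key : K.avg (fun z => u z * v z ^ 2) y s ≤ A * B ^ 2 / 4 := by
    have h1 := K.avg_le_integral (f := fun z => u z * v z ^ 2) (by fun_prop)
      (fun z => mul_nonneg (h.pos z).le (sq_nonneg _)) y hs0
    have h2 := K.integral_lap_le h.smooth.two_of_top h.lap_nonneg (fun z => (h.pos z).le) hs0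
      (x := y) (A := A) fun z hz => hA z (closedBall_subset_closedBall (by rw [hs]; linarith) hz)
    simp only [h.lap_eq] at h2
    set I := ∫ z in ball y s, u z * v z ^ 2
    have h3 : 4 * K.C ^ 2 * 4 ^ n ≤ s ^ 2 * B ^ 2 := by
      have h4 : 2 * K.C * 2 ^ n ≤ s * B := by
        have : ρ * v y ≤ ρ * B := by
          gcongr
          exact hB y hy
        rw [hs]
        linarith
      have h5 := pow_le_pow_left₀ (by positivity) h4 2
      have h6 : ((2 : ℝ) ^ n) ^ 2 = 4 ^ n := by
        rw [← pow_mul, mul_comm, pow_mul]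
        norm_num
      rw [mul_pow, mul_pow, mul_pow, h6] at h5
      linarith
    refine h1.trans ?_
    rw [inv_mul_le_iff₀ (by positivity)]
    have h7 : s ^ 2 * (K.C * I) ≤ s ^ 2 * (s ^ n * (A * B ^ 2 / 4)) := by
      calc s ^ 2 * (K.C * I) = K.C * (s ^ 2 * I) := by ring
        _ ≤ K.C * (K.C * 4 ^ n * s ^ n * A) := by gcongr
        _ = (4 * K.C ^ 2 * 4 ^ n) * (s ^ n * A / 4) := by ring
        _ ≤ (s ^ 2 * B ^ 2) * (s ^ n * A / 4) := by gcongr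
        _ = _ := by ring
    exact le_of_mul_le_mul_left h7 (by positivity)
  have hsum : B * K.avg u y s + A * K.avg v y s ≤ 3 / 2 * (A * B) := by
    have h1 : K.avg (fun z => B * u z + A * v z) y s ≤
        K.avg (fun z => 5 / 4 * (A * B) + B⁻¹ * (u z * v z ^ 2)) y s := by
      refine K.avg_mono (by fun_prop) (by fun_prop) hs0.le fun z hz => ?_
      have hu := hA z (hss z hz)
      have hv := hB z (hss z hz)
      have hup := h.pos z
      have hvp := h.pos_right z
      have e1 : 0 ≤ (A - u z) * (B - v z) := mul_nonneg (by linarith) (by linarith)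
      have e2 : u z * v z ≤ A * B / 4 + B⁻¹ * (u z * v z ^ 2) := by
        have : A * B / 4 + B⁻¹ * (u z * v z ^ 2) - u z * v z =
            B⁻¹ * (u z * (v z - B / 2) ^ 2 + (A - u z) * B ^ 2 / 4) := by
          field_simp
          ring
        have h3 : 0 ≤ B⁻¹ * (u z * (v z - B / 2) ^ 2 + (A - u z) * B ^ 2 / 4) := by
          have : 0 ≤ A - u z := by linarith
          positivity
        linarith
      nlinarith
    rw [K.avg_add (by fun_prop) (by fun_prop), K.avg_add (by fun_prop) (by fun_prop),
      K.avg_const_mul, K.avg_const_mul, K.avg_const,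
      K.avg_const_mul B⁻¹ fun z => u z * v z ^ 2] at h1
    have h2 : B⁻¹ * K.avg (fun z => u z * v z ^ 2) y s ≤ B⁻¹ * (A * B ^ 2 / 4) := by gcongr
    have h3 : B⁻¹ * (A * B ^ 2 / 4) = A * B / 4 := by
      field_simp
    linarith
  have htr : ∀ f : Eu n → ℝ, Continuous f → (∀ z, lap f z ≥ 0) → ContDiff ℝ 2 f →
      (∀ z, 0 < f z) → ∀ a : ℝ, (∀ z ∈ closedBall y ρ, f z ≤ a) → K.avg f y s ≤ 3 / 4 * a →
      ∀ z ∈ closedBall y (l * ρ), f z ≤ 7 / 8 * a := by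
    intro f hf hlf hf2 hfp a ha hav z hz
    have ha0 : 0 < a := (hfp y).trans_le (ha y hy)
    set p : Eu n := s⁻¹ • (z - y) with hp
    have hzp : z = y + s • p := by
      rw [hp, smul_smul, mul_inv_cancel₀ hs0.ne', one_smul, add_sub_cancel]
    have hpn : ‖p‖ ≤ 8 * l := by
      rw [mem_closedBall, dist_eq_norm] at hz
      rw [hp, norm_smul, norm_inv, Real.norm_of_nonneg hs0.le, ← div_eq_inv_mul,
        div_le_iff₀ hs0, hs]
      linarith
    have h1 := K.abs_avg_translate_sub_le hf (y := y) (h := p) (A := a) hs0.le (fun z hz => by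
      rw [abs_of_pos (hfp z)]
      exact ha z (closedBall_subset_closedBall (by rw [hs]; linarith) hz)) (by linarith)
    have h2 := K.le_avg hf2 hlf z hs0.le
    rw [← hzp] at h1
    have h3 : a * K.C * V * ‖p‖ ≤ a * (1 / 8) := by
      calc a * K.C * V * ‖p‖ ≤ a * K.C * V * (8 * l) := by gcongr
        _ = a * (K.C * V * (8 * l)) := by ring
        _ ≤ _ := by gcongr
    have h4 := (le_abs_self _).trans h1
    linarith
  by_cases hc : K.avg u y s ≤ 3 / 4 * A
  · exact Or.inl (htr u hcu h.lap_nonneg h.smooth.two_of_top h.pos A hA hc)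
  · refine Or.inr (htr v hcv h.symm.lap_nonneg h.smooth_right.two_of_top h.pos_right B hB ?_)
    rw [not_le] at hc
    by_contra hc2
    rw [not_le] at hc2
    have e1 : B * (3 / 4 * A) < B * K.avg u y s := by gcongr
    have e2 : A * (3 / 4 * B) < A * K.avg v y s := by gcongr
    linarith

/-- Algebraic decay of the product `u v` at interior points. -/
theorem exists_product_decay (n : ℕ) : ∃ a D : ℝ, 0 < a ∧ a ≤ 1 ∧ 1 ≤ D ∧
    ∀ u v : Eu n → ℝ, IsSolution u v → ∀ (y : Eu n) (r A B : ℝ), 1 ≤ r →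
      (∀ z ∈ closedBall y r, u z ≤ A) → (∀ z ∈ closedBall y r, v z ≤ B) → D ≤ v y →
      u y * v y ≤ 2 * r ^ (-a) * (A * B) := by
  obtain ⟨l, D, hl, hl8, hD, hstep⟩ := exists_decay_step n
  have hll : Real.log l < 0 := Real.log_neg hl (by linarith)
  have hl7 : Real.log (7 / 8) < 0 := Real.log_neg (by norm_num) (by norm_num)
  set a₀ := Real.log (7 / 8) / Real.log l with ha₀
  have ha0 : 0 < a₀ := div_pos_of_neg_of_neg hl7 hll
  refine ⟨min a₀ 1, D, lt_min ha0 one_pos, min_le_right _ _, hD, ?_⟩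
  intro u v h y r A B hr hA hB hDv
  have iter : ∀ j : ℕ, ∀ r A B : ℝ, 1 ≤ l ^ j * r → (∀ z ∈ closedBall y r, u z ≤ A) →
      (∀ z ∈ closedBall y r, v z ≤ B) → u y * v y ≤ (7 / 8) ^ j * (A * B) := by
    intro j
    induction j with
    | zero =>
      intro r A B hr hA hB
      have hy : y ∈ closedBall y r := mem_closedBall_self (by linarith)
      rw [pow_zero, one_mul]
      exact mul_le_mul (hA y hy) (hB y hy) (h.pos_right y).le ((h.pos y).le.trans (hA y hy))
    | succ j ih =>
      intro r A B hr hA hB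
      have hlj : l ^ (j + 1) ≤ 1 := pow_le_one₀ hl.le (by linarith)
      have hr0 : 0 < r := by
        by_contra hc
        rw [not_lt] at hc
        nlinarith [pow_pos hl (j + 1)]
      have hr1 : 1 ≤ r := by nlinarith
      have hsub : ∀ z ∈ closedBall y (l * r), z ∈ closedBall y r := fun z hz =>
        closedBall_subset_closedBall (by nlinarith) hz
      have hr2 : 1 ≤ l ^ j * (l * r) := by
        rw [pow_succ] at hr
        linarith
      rcases hstep u v h y r A B hr0 hA hB (by nlinarith [h.pos_right y]) with h1 | h1
      · have := ih (l * r) (7 / 8 * A) B hr2 h1 fun z hz => hB z (hsub z hz)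
        calc _ ≤ _ := this
          _ = _ := by ring
      · have := ih (l * r) A (7 / 8 * B) hr2 (fun z hz => hA z (hsub z hz)) h1
        calc _ ≤ _ := this
          _ = _ := by ring
  obtain ⟨N, hN1, hN2⟩ := exists_nat_pow_near_of_lt_one (x := r⁻¹) (y := l) (by positivity)
    (inv_le_one_of_one_le₀ hr) hl (by linarith)
  have h1 := iter N r A B (by
    rw [← inv_mul_cancel₀ (show r ≠ 0 by linarith)]
    gcongr) hA hB
  have hy : y ∈ closedBall y r := mem_closedBall_self (by linarith)
  have hAB : 0 ≤ A * B := mul_nonneg ((h.pos y).le.trans (hA y hy))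
    ((h.pos_right y).le.trans (hB y hy))
  refine h1.trans (mul_le_mul_of_nonneg_right ?_ hAB)
  have h78 : (7 / 8 : ℝ) = l ^ a₀ := by
    rw [Real.rpow_def_of_pos hl, ha₀, mul_div_cancel₀ _ hll.ne, Real.exp_log (by norm_num)]
  have h2 : (7 / 8 : ℝ) ^ (N + 1) ≤ r ^ (-a₀) := by
    rw [h78, ← Real.rpow_natCast, ← Real.rpow_mul hl.le, mul_comm, Real.rpow_mul hl.le,
      Real.rpow_natCast, Real.rpow_neg (by linarith), ← Real.inv_rpow (by linarith)]
    exact Real.rpow_le_rpow (by positivity) hN1.le ha0.le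
  have h3 : r ^ (-a₀) ≤ r ^ (-min a₀ 1) :=
    Real.rpow_le_rpow_of_exponent_le hr (neg_le_neg (min_le_left _ _))
  rw [pow_succ] at h2
  have h4 : (0 : ℝ) ≤ (7 / 8) ^ N := by positivity
  linarith

section Integrals

variable {n : ℕ} {f g : Eu n → ℝ} {x : Eu n} {r : ℝ}

theorem Continuous.integrableOn_ball (hf : Continuous f) : IntegrableOn f (ball x r) :=
  (hf.continuousOn.integrableOn_compact (isCompact_closedBall x r)).mono_set ball_subset_closedBall

theorem setIntegral_ball_le_integral (hf : Continuous f) (hg : Continuous g)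
    (hc : HasCompactSupport g) (h0 : ∀ z, 0 ≤ g z) (h : ∀ z ∈ ball x r, f z ≤ g z) :
    ∫ z in ball x r, f z ≤ ∫ z, g z :=
  (setIntegral_mono_on hf.integrableOn_ball hg.integrableOn_ball measurableSet_ball h).trans
    (setIntegral_le_integral (hg.integrable_of_hasCompactSupport hc)
      (Filter.Eventually.of_forall h0))

theorem integral_le_setIntegral_ball (hf : Continuous f) (hg : Continuous g)
    (h0 : ∀ z, z ∉ ball x r → f z = 0) (h : ∀ z ∈ ball x r, f z ≤ g z) :
    ∫ z, f z ≤ ∫ z in ball x r, g z := by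
  rw [← setIntegral_eq_integral_of_forall_compl_eq_zero h0]
  exact setIntegral_mono_on hf.integrableOn_ball hg.integrableOn_ball measurableSet_ball h

theorem setIntegral_ball_mono (hf : Continuous f) (hg : Continuous g)
    (h : ∀ z ∈ ball x r, f z ≤ g z) : ∫ z in ball x r, f z ≤ ∫ z in ball x r, g z :=
  setIntegral_mono_on hf.integrableOn_ball hg.integrableOn_ball measurableSet_ball h

theorem setIntegral_ball_mono_set {x' : Eu n} {r' : ℝ} (hf : Continuous f) (h0 : ∀ z, 0 ≤ f z)
    (h : ball x r ⊆ ball x' r') : ∫ z in ball x r, f z ≤ ∫ z in ball x' r', f z :=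
  setIntegral_mono_set hf.integrableOn_ball (Filter.Eventually.of_forall h0) h.eventuallyLE

/-- The volume of the unit ball. -/
def ballVol (n : ℕ) : ℝ := volume.real (ball (0 : Eu n) 1)

theorem ballVol_pos (n : ℕ) : 0 < ballVol n :=
  ENNReal.toReal_pos (measure_ball_pos _ _ one_pos).ne' measure_ball_lt_top.ne

theorem volume_real_ball (x : Eu n) (hr : 0 < r) : volume.real (ball x r) = r ^ n * ballVol n := by
  rw [measureReal_def, Measure.addHaar_ball_of_pos _ _ hr, ENNReal.toReal_mul,
    ENNReal.toReal_ofReal (by positivity), ballVol, measureReal_def]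
  simp

theorem setIntegral_ball_const (c : ℝ) (hr : 0 < r) :
    ∫ _ in ball x r, c = c * (r ^ n * ballVol n) := by
  rw [setIntegral_const, volume_real_ball x hr, smul_eq_mul, mul_comm]

theorem setIntegral_ball_le_const (hf : Continuous f) (hr : 0 < r) {c : ℝ}
    (h : ∀ z ∈ ball x r, f z ≤ c) : ∫ z in ball x r, f z ≤ c * (r ^ n * ballVol n) := by
  rw [← setIntegral_ball_const (x := x) c hr]
  exact setIntegral_ball_mono hf continuous_const h

theorem sq_setIntegral_ball_le (hf : Continuous f) (hr : 0 < r) :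
    (∫ z in ball x r, f z) ^ 2 ≤ r ^ n * ballVol n * ∫ z in ball x r, f z ^ 2 := by
  set V := r ^ n * ballVol n with hV
  have hVp : 0 < V := mul_pos (pow_pos hr n) (ballVol_pos n)
  set I := ∫ z in ball x r, f z with hI
  have h0 : 0 ≤ ∫ z in ball x r, (V * f z - I) ^ 2 := integral_nonneg fun _ => sq_nonneg _
  have e : (fun z => (V * f z - I) ^ 2) = fun z => V ^ 2 * f z ^ 2 - 2 * V * I * f z + I ^ 2 := by
    ext z
    ring
  have i1 : IntegrableOn (fun z => V ^ 2 * f z ^ 2) (ball x r) :=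
    Continuous.integrableOn_ball (by fun_prop)
  have i2 : IntegrableOn (fun z => 2 * V * I * f z) (ball x r) :=
    Continuous.integrableOn_ball (by fun_prop)
  have i3 : IntegrableOn (fun _ : Eu n => I ^ 2) (ball x r) :=
    Continuous.integrableOn_ball (by fun_prop)
  have i12 : IntegrableOn (fun z => V ^ 2 * f z ^ 2 - 2 * V * I * f z) (ball x r) := i1.sub i2
  rw [e, integral_add i12 i3, integral_sub i1 i2, integral_const_mul, integral_const_mul,
    setIntegral_ball_const _ hr, ← hI, ← hV] at h0
  have h1 : 0 ≤ V * (V * (∫ z in ball x r, f z ^ 2) - I ^ 2) := by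
    nlinarith
  have := nonneg_of_mul_nonneg_right h1 hVp
  linarith

end Integrals

theorem exists_cutoff (n : ℕ) : ∃ C : ℝ, 1 ≤ C ∧ ∀ (x : Eu n) (R : ℝ), 0 < R →
    ∃ ζ : Eu n → ℝ, ContDiff ℝ (⊤ : ℕ∞) ζ ∧ HasCompactSupport ζ ∧ (∀ z, 0 ≤ ζ z) ∧
      (∀ z, ζ z ≤ 1) ∧ (∀ z ∈ ball x R, ζ z = 1) ∧ (∀ z, z ∉ ball x (2 * R) → ζ z = 0) ∧
      (∀ z, z ∉ ball x (2 * R) → gradient ζ z = 0) ∧ (∀ z, ‖gradient ζ z‖ ≤ C / R) ∧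
      ∀ z ∈ ball x R, gradient ζ z = 0 := by
  let χ : ContDiffBump (0 : Eu n) := ⟨1, 3 / 2, by norm_num, by norm_num⟩
  have hχ : ContDiff ℝ (⊤ : ℕ∞) χ := χ.contDiff
  obtain ⟨C, hC⟩ := (hasCompactSupport_gradient χ.hasCompactSupport).exists_bound_of_continuous
    (hχ.continuous_gradient (by norm_cast))
  have hC0 : 0 ≤ C := (norm_nonneg _).trans (hC 0)
  refine ⟨1 + C, by linarith, fun x R hR => ?_⟩
  set ζ : Eu n → ℝ := fun z => χ (R⁻¹ • (z - x)) with hζ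
  have hζs : ContDiff ℝ (⊤ : ℕ∞) ζ := hχ.comp (by fun_prop)
  have hn : ∀ z : Eu n, ‖R⁻¹ • (z - x)‖ = ‖z - x‖ / R := fun z => by
    rw [norm_smul, norm_inv, Real.norm_of_nonneg hR.le, ← div_eq_inv_mul]
  have hsupp : tsupport ζ ⊆ closedBall x (3 / 2 * R) := by
    refine closure_minimal (fun z hz => ?_) isClosed_closedBall
    by_contra h
    rw [mem_closedBall, dist_eq_norm, not_le] at h
    refine hz (χ.zero_of_le_dist ?_)
    rw [dist_zero_right, hn, le_div_iff₀ hR]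
    exact h.le
  have hts : ∀ z, z ∉ ball x (2 * R) → z ∉ tsupport ζ := fun z hz hz2 =>
    hz (closedBall_subset_ball (by linarith) (hsupp hz2))
  have hone : ∀ z ∈ ball x R, ζ z = 1 := fun z hz => by
    refine χ.one_of_mem_closedBall ?_
    rw [mem_closedBall_zero_iff, hn, div_le_one hR]
    rw [mem_ball, dist_eq_norm] at hz
    exact hz.le
  refine ⟨ζ, hζs, (isCompact_closedBall x _).of_isClosed_subset (isClosed_tsupport _) hsupp,
    fun z => χ.nonneg, fun z => χ.le_one, hone,
    fun z hz => image_eq_zero_of_notMem_tsupport (hts z hz),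
    fun z hz => gradient_eq_zero_of_notMem_tsupport (hts z hz), fun z => ?_, fun z hz => ?_⟩
  · have h2 : HasFDerivAt (fun z : Eu n => R⁻¹ • (z - x))
        (R⁻¹ • ContinuousLinearMap.id ℝ (Eu n)) z :=
      ((hasFDerivAt_id z).sub_const x).const_smul R⁻¹
    have h3 := ((hχ.differentiable (by simp)) (R⁻¹ • (z - x))).hasFDerivAt.comp z h2
    have h4 := hC (R⁻¹ • (z - x))
    rw [norm_gradient_eq_norm_fderiv] at h4 ⊢
    have h5 : fderiv ℝ ζ z = _ := h3.fderiv
    rw [h5, ContinuousLinearMap.comp_smul, ContinuousLinearMap.comp_id, norm_smul, norm_inv,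
      Real.norm_of_nonneg hR.le, ← div_eq_inv_mul]
    gcongr
    linarith
  · have : ζ =ᶠ[nhds z] fun _ => 1 := by
      filter_upwards [isOpen_ball.mem_nhds hz] with y hy using hone y hy
    rw [this.gradient_eq, gradient_fun_const]

/-- Truncated energy density of the first component. -/
def trunc {n : ℕ} (k : ℝ) (u v : Eu n → ℝ) (z : Eu n) : ℝ :=
  (k / (k + u z)) ^ 2 * ‖gradient u z‖ ^ 2 + k * u z / (k + u z) * (u z * v z ^ 2)

section Trunc

variable {n : ℕ} {u v : Eu n → ℝ} {k : ℝ}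

theorem IsSolution.continuous_trunc (h : IsSolution u v) (hk : 0 < k) :
    Continuous (trunc k u v) := by
  have h1 := h.smooth.continuous
  have h2 := h.smooth_right.continuous
  have h3 : Continuous (gradient u) := h.smooth.continuous_gradient (by norm_cast)
  have h4 : ∀ z, k + u z ≠ 0 := fun z => (add_pos hk (h.pos z)).ne'
  unfold trunc
  fun_prop (disch := assumption)

theorem IsSolution.trunc_nonneg (h : IsSolution u v) (hk : 0 < k) (z : Eu n) :
    0 ≤ trunc k u v z := by
  have := h.pos z
  have := h.pos_right z
  unfold trunc
  positivity

theorem IsSolution.norm_gradient_sq_le_trunc (h : IsSolution u v) {z : Eu n}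
    (hu : u z ≤ k) : ‖gradient u z‖ ^ 2 ≤ 4 * trunc k u v z := by
  have h1 := h.pos z
  have h2 := h.pos_right z
  have hk : 0 < k := h1.trans_le hu
  have h3 : 1 / 2 ≤ k / (k + u z) := by
    rw [div_le_div_iff₀ two_pos (by linarith)]
    linarith
  have h4 : (1 / 2 : ℝ) ^ 2 ≤ (k / (k + u z)) ^ 2 := pow_le_pow_left₀ (by norm_num) h3 2
  have h5 : 0 ≤ k * u z / (k + u z) * (u z * v z ^ 2) := by positivity
  unfold trunc
  nlinarith [sq_nonneg ‖gradient u z‖]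

theorem IsSolution.sq_mul_sq_le_trunc (h : IsSolution u v) {z : Eu n} (hu : u z ≤ k) :
    u z ^ 2 * v z ^ 2 ≤ 2 * trunc k u v z := by
  have h1 := h.pos z
  have h2 := h.pos_right z
  have hk : 0 < k := h1.trans_le hu
  have h3 : u z / 2 ≤ k * u z / (k + u z) := by
    rw [div_le_div_iff₀ two_pos (by linarith)]
    nlinarith
  have h5 : 0 ≤ (k / (k + u z)) ^ 2 * ‖gradient u z‖ ^ 2 := by positivity
  have h6 : u z / 2 * (u z * v z ^ 2) ≤ k * u z / (k + u z) * (u z * v z ^ 2) := by gcongr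
  unfold trunc
  linarith

end Trunc

/-- Testing the equation with a truncation of the solution. -/
theorem exists_trunc_bound (n : ℕ) : ∃ C : ℝ, 1 ≤ C ∧ ∀ u v : Eu n → ℝ, IsSolution u v →
    ∀ (x : Eu n) (R k : ℝ), 0 < R → 0 < k →
      ∫ z in ball x R, trunc k u v z ≤ k * (C / R) * ∫ z in ball x (2 * R), ‖gradient u z‖ := by
  obtain ⟨C, hC, hcut⟩ := exists_cutoff n
  refine ⟨C, hC, fun u v h x R k hR hk => ?_⟩
  obtain ⟨ζ, hζ, hζc, hζ0, hζ1, hζR, hζ2, hζg, hζC, -⟩ := hcut x R hR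
  have hcu := h.smooth.continuous
  have hcv := h.smooth_right.continuous
  have hgu : Continuous (gradient u) := h.smooth.continuous_gradient (by norm_cast)
  have hgζ : Continuous (gradient ζ) := hζ.continuous_gradient (by norm_cast)
  have hcζ := hζ.continuous
  have hne : ∀ z, k + u z ≠ 0 := fun z => (add_pos hk (h.pos z)).ne'
  set G : Eu n → ℝ := fun z => k * u z / (k + u z) with hG
  have hGs : ContDiff ℝ (⊤ : ℕ∞) G :=
    (contDiff_const.mul h.smooth).div (contDiff_const.add h.smooth) hne
  have hGg : ∀ z, HasGradientAt G ((k / (k + u z)) ^ 2 • gradient u z) z := by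
    intro z
    have hd : HasDerivAt (fun t => k * t / (k + t)) ((k / (k + u z)) ^ 2) (u z) := by
      have := ((hasDerivAt_id (u z)).const_mul k).div ((hasDerivAt_id (u z)).const_add k) (hne z)
      refine this.congr_deriv ?_
      have := hne z
      simp only [id, mul_one]
      field_simp
      ring
    exact hd.comp_hasGradientAt (h.smooth.hasGradientAt (by simp) z)
  have hG0 : ∀ z, 0 ≤ G z := fun z => by
    have := h.pos z
    positivity
  have hGk : ∀ z, G z ≤ k := fun z => by
    have := h.pos z
    rw [hG]
    simp only
    rw [div_le_iff₀ (by positivity)]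
    nlinarith
  have hcG := hGs.continuous
  have hξ : ContDiff ℝ 1 fun z => ζ z * G z := (hζ.mul hGs).one_of_top
  have hibp := integral_inner_gradient_eq_neg isOpen_univ h.smooth.two_of_top.contDiffOn hξ
    hζc.mul_right (Set.subset_univ _)
  have e1 : ∀ z, ⟪gradient u z, gradient (fun z => ζ z * G z) z⟫ =
      ζ z * ((k / (k + u z)) ^ 2 * ‖gradient u z‖ ^ 2) + G z * ⟪gradient u z, gradient ζ z⟫ := by
    intro z
    rw [((hζ.hasGradientAt (by simp) z).mul_fun (hGg z)).gradient, inner_add_right,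
      inner_smul_right, inner_smul_right, inner_smul_right, real_inner_self_eq_norm_sq]
  simp_rw [e1, h.lap_eq] at hibp
  have i1 : Integrable fun z => ζ z * ((k / (k + u z)) ^ 2 * ‖gradient u z‖ ^ 2) :=
    Continuous.integrable_of_hasCompactSupport (by fun_prop (disch := assumption)) hζc.mul_right
  have i2 : Integrable fun z => G z * ⟪gradient u z, gradient ζ z⟫ :=
    Continuous.integrable_of_hasCompactSupport (by fun_prop)
      (HasCompactSupport.intro hζc fun z hz => by
        rw [gradient_eq_zero_of_notMem_tsupport hz, inner_zero_right, mul_zero])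
  have i3 : Integrable fun z => u z * v z ^ 2 * (ζ z * G z) :=
    Continuous.integrable_of_hasCompactSupport (by fun_prop) (hζc.mul_right.mul_left)
  rw [integral_add i1 i2] at hibp
  have hle : ∫ z in ball x R, trunc k u v z ≤
      ∫ z, (ζ z * ((k / (k + u z)) ^ 2 * ‖gradient u z‖ ^ 2) + u z * v z ^ 2 * (ζ z * G z)) := by
    refine setIntegral_ball_le_integral (h.continuous_trunc hk)
      (by fun_prop (disch := assumption)) (hζc.mul_right.add hζc.mul_right.mul_left)
      (fun z => ?_) fun z hz => ?_
    · have h1 := h.pos z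
      have h2 := h.pos_right z
      have h3 := hζ0 z
      have h4 := hG0 z
      positivity
    · rw [hζR z hz]
      unfold trunc
      simp only [hG]
      exact le_of_eq (by ring)
  rw [integral_add i1 i3] at hle
  have hup : ∫ z, -(G z * ⟪gradient u z, gradient ζ z⟫) ≤
      ∫ z in ball x (2 * R), k * (C / R) * ‖gradient u z‖ := by
    refine integral_le_setIntegral_ball (by fun_prop) (by fun_prop) (fun z hz => ?_)
      fun z hz => ?_
    · rw [hζg z hz, inner_zero_right, mul_zero, neg_zero]
    · have h1 := neg_le_of_abs_le (abs_real_inner_le_norm (gradient u z) (gradient ζ z))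
      have h2 := hζC z
      have h3 := hG0 z
      have h4 := hGk z
      calc -(G z * ⟪gradient u z, gradient ζ z⟫) = G z * -⟪gradient u z, gradient ζ z⟫ := by ring
        _ ≤ G z * (‖gradient u z‖ * ‖gradient ζ z‖) := by
          gcongr
          linarith
        _ ≤ k * (‖gradient u z‖ * (C / R)) := by gcongr
        _ = _ := by ring
  rw [integral_neg, integral_const_mul] at hup
  linarith

/-- Caccioppoli inequality for bounded solutions. -/
theorem exists_caccioppoli_bound (n : ℕ) : ∃ C : ℝ, 1 ≤ C ∧ ∀ u v : Eu n → ℝ, IsSolution u v →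
    ∀ (x : Eu n) (R A : ℝ), 0 < R → (∀ z ∈ ball x (2 * R), u z ≤ A) →
      R ^ 2 * ∫ z in ball x R, (‖gradient u z‖ ^ 2 + u z ^ 2 * v z ^ 2) ≤ C * A ^ 2 * R ^ n := by
  obtain ⟨C, hC, hcut⟩ := exists_cutoff n
  refine ⟨1 + 4 * C ^ 2 * 2 ^ n * ballVol n, ?_, fun u v h x R A hR hA => ?_⟩
  · have := ballVol_pos n
    have : 0 ≤ 4 * C ^ 2 * 2 ^ n * ballVol n := by positivity
    linarith
  obtain ⟨ζ, hζ, hζc, hζ0, hζ1, hζR, hζ2, hζg, hζC, -⟩ := hcut x R hR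
  have hcu := h.smooth.continuous
  have hcv := h.smooth_right.continuous
  have hgu : Continuous (gradient u) := h.smooth.continuous_gradient (by norm_cast)
  have hgζ : Continuous (gradient ζ) := hζ.continuous_gradient (by norm_cast)
  have hcζ := hζ.continuous
  have hξ : ContDiff ℝ 1 fun z => ζ z * (ζ z * u z) := (hζ.mul (hζ.mul h.smooth)).one_of_top
  have hibp := integral_inner_gradient_eq_neg isOpen_univ h.smooth.two_of_top.contDiffOn hξ
    hζc.mul_right (Set.subset_univ _)
  have e1 : ∀ z, ⟪gradient u z, gradient (fun z => ζ z * (ζ z * u z)) z⟫ =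
      ζ z ^ 2 * ‖gradient u z‖ ^ 2 + 2 * ζ z * u z * ⟪gradient u z, gradient ζ z⟫ := by
    intro z
    have hz := hζ.hasGradientAt (by simp) z
    rw [(hz.mul_fun (hz.mul_fun (h.smooth.hasGradientAt (by simp) z))).gradient]
    simp only [inner_add_right, inner_smul_right, real_inner_self_eq_norm_sq, smul_add]
    ring
  simp_rw [e1, h.lap_eq] at hibp
  have i1 : Integrable fun z => ζ z ^ 2 * ‖gradient u z‖ ^ 2 :=
    Continuous.integrable_of_hasCompactSupport (by fun_prop) <| HasCompactSupport.intro hζc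
      fun z hz => by simp [image_eq_zero_of_notMem_tsupport hz]
  have i2 : Integrable fun z => 2 * ζ z * u z * ⟪gradient u z, gradient ζ z⟫ :=
    Continuous.integrable_of_hasCompactSupport (by fun_prop) <| HasCompactSupport.intro hζc
      fun z hz => by simp [image_eq_zero_of_notMem_tsupport hz]
  have i3 : Integrable fun z => u z * v z ^ 2 * (ζ z * (ζ z * u z)) :=
    Continuous.integrable_of_hasCompactSupport (by fun_prop) (hζc.mul_right.mul_left)
  rw [integral_add i1 i2] at hibp
  have hle : ∫ z in ball x R, (‖gradient u z‖ ^ 2 + u z ^ 2 * v z ^ 2) ≤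
      ∫ z, (2 * (ζ z ^ 2 * ‖gradient u z‖ ^ 2 + u z * v z ^ 2 * (ζ z * (ζ z * u z))) +
        (2 * (2 * ζ z * u z * ⟪gradient u z, gradient ζ z⟫) +
          4 * (u z ^ 2 * ‖gradient ζ z‖ ^ 2))) := by
    refine setIntegral_ball_le_integral (by fun_prop) (by fun_prop)
      (HasCompactSupport.intro hζc fun z hz => ?_) (fun z => ?_) fun z hz => ?_
    · simp [image_eq_zero_of_notMem_tsupport hz, gradient_eq_zero_of_notMem_tsupport hz]
    · have h1 := neg_le_of_abs_le (abs_real_inner_le_norm (gradient u z) (gradient ζ z))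
      have h3 := hζ0 z
      have h4 : 0 ≤ u z * v z ^ 2 * (ζ z * (ζ z * u z)) := by
        have := h.pos z
        positivity
      have h5 : 2 * (2 * ζ z * u z * -(‖gradient u z‖ * ‖gradient ζ z‖)) ≤
          2 * (2 * ζ z * u z * ⟪gradient u z, gradient ζ z⟫) := by
        have := h.pos z
        gcongr
      nlinarith [sq_nonneg (ζ z * ‖gradient u z‖ - u z * ‖gradient ζ z‖),
        sq_nonneg (u z * ‖gradient ζ z‖)]
    · have h1 := neg_le_of_abs_le (abs_real_inner_le_norm (gradient u z) (gradient ζ z))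
      have h5 : 2 * (2 * ζ z * u z * -(‖gradient u z‖ * ‖gradient ζ z‖)) ≤
          2 * (2 * ζ z * u z * ⟪gradient u z, gradient ζ z⟫) := by
        have := h.pos z
        have := hζ0 z
        gcongr
      rw [hζR z hz] at h5 ⊢
      nlinarith [sq_nonneg (‖gradient u z‖ - 2 * u z * ‖gradient ζ z‖),
        sq_nonneg (u z * v z)]
  have hup : ∫ z, 4 * (u z ^ 2 * ‖gradient ζ z‖ ^ 2) ≤
      ∫ z in ball x (2 * R), 4 * (A ^ 2 * (C / R) ^ 2) := by
    refine integral_le_setIntegral_ball (by fun_prop) (by fun_prop) (fun z hz => ?_)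
      fun z hz => ?_
    · simp [hζg z hz]
    · have h1 := pow_le_pow_left₀ (h.pos z).le (hA z hz) 2
      have h2 := pow_le_pow_left₀ (norm_nonneg _) (hζC z) 2
      gcongr
  have i4 : Integrable fun z => 4 * (u z ^ 2 * ‖gradient ζ z‖ ^ 2) :=
    Continuous.integrable_of_hasCompactSupport (by fun_prop) <| HasCompactSupport.intro hζc
      fun z hz => by simp [gradient_eq_zero_of_notMem_tsupport hz]
  have i13 : Integrable fun z => 2 * (ζ z ^ 2 * ‖gradient u z‖ ^ 2 +
      u z * v z ^ 2 * (ζ z * (ζ z * u z))) := (i1.add i3).const_mul 2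
  have i24 : Integrable fun z => 2 * (2 * ζ z * u z * ⟪gradient u z, gradient ζ z⟫) +
      4 * (u z ^ 2 * ‖gradient ζ z‖ ^ 2) := (i2.const_mul 2).add i4
  rw [integral_add i13 i24,
    integral_const_mul, integral_add i1 i3, integral_add (i2.const_mul 2) i4,
    integral_const_mul] at hle
  rw [setIntegral_ball_const _ (by positivity)] at hup
  have hfin : ∫ z in ball x R, (‖gradient u z‖ ^ 2 + u z ^ 2 * v z ^ 2) ≤
      4 * (A ^ 2 * (C / R) ^ 2) * ((2 * R) ^ n * ballVol n) := by
    linarith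
  have hA2 : 0 ≤ A ^ 2 * R ^ n := by positivity
  calc _ ≤ R ^ 2 * (4 * (A ^ 2 * (C / R) ^ 2) * ((2 * R) ^ n * ballVol n)) := by gcongr
    _ = 4 * C ^ 2 * 2 ^ n * ballVol n * (A ^ 2 * R ^ n) := by
      rw [mul_pow]
      field_simp
    _ ≤ (1 + 4 * C ^ 2 * 2 ^ n * ballVol n) * (A ^ 2 * R ^ n) := by
      gcongr
      linarith
    _ = _ := by ring

theorem norm_add_sq_le_two {E : Type*} [SeminormedAddCommGroup E] (a b : E) :
    ‖a + b‖ ^ 2 ≤ 2 * ‖a‖ ^ 2 + 2 * ‖b‖ ^ 2 := by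
  have h := pow_le_pow_left₀ (norm_nonneg _) (norm_add_le a b) 2
  nlinarith [sq_nonneg (‖a‖ - ‖b‖)]

section Pointwise

variable {E : Type*} [NormedAddCommGroup E] [InnerProductSpace ℝ E]

theorem one_sub_div_sqrt_le {w e : ℝ} (hw : 1 ≤ w) (he : 0 ≤ e) :
    0 ≤ 1 - w / √(w ^ 2 + e) ∧ 1 - w / √(w ^ 2 + e) ≤ e := by
  set q := √(w ^ 2 + e) with hq
  have hq2 : q ^ 2 = w ^ 2 + e := Real.sq_sqrt (by positivity)
  have hqw : w ≤ q := Real.le_sqrt_of_sq_le (by linarith)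
  have hq0 : 0 < q := by linarith
  rw [one_sub_div hq0.ne']
  refine ⟨div_nonneg (by linarith) hq0.le, ?_⟩
  rw [div_le_iff₀ hq0]
  nlinarith

theorem abs_div_sqrt_le (w : ℝ) {e : ℝ} (he : 0 < e) : |w / √(w ^ 2 + e)| ≤ 1 := by
  have h : |w| ≤ √(w ^ 2 + e) := Real.abs_le_sqrt (by linarith)
  rw [abs_div, abs_of_nonneg (Real.sqrt_nonneg _)]
  exact div_le_one_of_le₀ h (Real.sqrt_nonneg _)

theorem norm_sq_deficit_gradient_le {a b : E} {u v k e T : ℝ} (hk : 1 ≤ k)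
    (he : 0 < e) (hT : 0 ≤ T) (hm : u ≤ k ∨ v ≤ k) (hu : u ≤ 2 * k → ‖a‖ ^ 2 ≤ 4 * T)
    (hv : v ≤ 2 * k → ‖b‖ ^ 2 ≤ 4 * T) :
    ‖a + b - ((u - v) / √((u - v) ^ 2 + e)) • (a - b)‖ ^ 2 ≤
      64 * T + 2 * e ^ 2 * (‖a‖ ^ 2 + ‖b‖ ^ 2) := by
  set θ := (u - v) / √((u - v) ^ 2 + e) with hθ
  have e1 : a + b - θ • (a - b) = (1 - θ) • a + (1 + θ) • b := by module
  have h1 := norm_add_sq_le_two ((1 - θ) • a) ((1 + θ) • b)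
  rw [norm_smul, norm_smul, mul_pow, mul_pow, Real.norm_eq_abs, Real.norm_eq_abs, sq_abs,
    sq_abs] at h1
  have hθ1 := abs_le.1 (abs_div_sqrt_le (u - v) he)
  rw [← hθ] at hθ1
  have h2 : (1 - θ) ^ 2 ≤ 4 := by nlinarith
  have h3 : (1 + θ) ^ 2 ≤ 4 := by nlinarith
  have ha := sq_nonneg ‖a‖
  have hb := sq_nonneg ‖b‖
  have h2a := mul_le_mul_of_nonneg_right h2 ha
  have h3b := mul_le_mul_of_nonneg_right h3 hb
  have hea : 0 ≤ e ^ 2 * ‖a‖ ^ 2 := by positivity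
  have heb : 0 ≤ e ^ 2 * ‖b‖ ^ 2 := by positivity
  rw [e1]
  by_cases hu2 : u ≤ 2 * k
  · by_cases hv2 : v ≤ 2 * k
    · have := hu hu2
      have := hv hv2
      linarith
    · have h4 := one_sub_div_sqrt_le (w := v - u) (e := e)
        (by rcases hm with h | h <;> linarith) he.le
      have h5 : (v - u) / √((v - u) ^ 2 + e) = -θ := by
        rw [hθ, show (v - u) ^ 2 = (u - v) ^ 2 by ring, ← neg_div]
        congr 1
        ring
      rw [h5, sub_neg_eq_add] at h4
      have h6 := mul_le_mul_of_nonneg_right (pow_le_pow_left₀ h4.1 h4.2 2) hb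
      have := hu hu2
      linarith
  · have h4 := one_sub_div_sqrt_le (w := u - v) (e := e)
      (by rcases hm with h | h <;> linarith) he.le
    rw [← hθ] at h4
    have h6 := mul_le_mul_of_nonneg_right (pow_le_pow_left₀ h4.1 h4.2 2) ha
    have := hv (by rcases hm with h | h <;> linarith)
    linarith

theorem neg_two_inner_le {a b : E} {l T : ℝ} (hl : 0 < l)
    (h : ‖a‖ ^ 2 ≤ 4 * T ∨ ‖b‖ ^ 2 ≤ 4 * T) :
    -2 * ⟪a, b⟫ ≤ l * (‖a‖ ^ 2 + ‖b‖ ^ 2) + l⁻¹ * (4 * T) := by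
  have h1 := neg_le_of_abs_le (abs_real_inner_le_norm a b)
  have hli : 0 < l⁻¹ := inv_pos.2 hl
  have h2 : ∀ p q : ℝ, 2 * p * q ≤ l * p ^ 2 + l⁻¹ * q ^ 2 := by
    intro p q
    have : l * p ^ 2 + l⁻¹ * q ^ 2 - 2 * p * q = l⁻¹ * (l * p - q) ^ 2 := by
      field_simp
      ring
    have : 0 ≤ l⁻¹ * (l * p - q) ^ 2 := by positivity
    linarith
  have ha : 0 ≤ l * ‖a‖ ^ 2 := by positivity
  have hb : 0 ≤ l * ‖b‖ ^ 2 := by positivity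
  rcases h with h | h
  · have := mul_le_mul_of_nonneg_left h hli.le
    have := h2 ‖b‖ ‖a‖
    nlinarith
  · have := mul_le_mul_of_nonneg_left h hli.le
    have := h2 ‖a‖ ‖b‖
    nlinarith

theorem half_norm_sub_sq_le {s d : E} {l G P : ℝ} (hl : 0 < l) (hl1 : l ≤ 1)
    (hs : ‖s‖ ^ 2 ≤ 2 * G) (hd : ‖d‖ ^ 2 ≤ P) :
    1 / 2 * ‖s - d‖ ^ 2 ≤ 1 / 2 * ‖s‖ ^ 2 + l * G + l⁻¹ * P := by
  have hli : 1 ≤ l⁻¹ := (one_le_inv₀ hl).2 hl1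
  rw [@norm_sub_sq_real]
  have h1 := neg_le_of_abs_le (abs_real_inner_le_norm s d)
  have h2 : 2 * ‖s‖ * ‖d‖ ≤ l * ‖s‖ ^ 2 + l⁻¹ * ‖d‖ ^ 2 := by
    have : l * ‖s‖ ^ 2 + l⁻¹ * ‖d‖ ^ 2 - 2 * ‖s‖ * ‖d‖ = l⁻¹ * (l * ‖s‖ - ‖d‖) ^ 2 := by
      field_simp
      ring
    have : 0 ≤ l⁻¹ * (l * ‖s‖ - ‖d‖) ^ 2 := by positivity
    linarith
  have h3 := mul_le_mul_of_nonneg_left hs hl.le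
  have h4 := mul_le_mul_of_nonneg_left hd (by linarith : 0 ≤ l⁻¹)
  have h5 : ‖d‖ ^ 2 ≤ l⁻¹ * ‖d‖ ^ 2 := by nlinarith [sq_nonneg ‖d‖]
  linarith

theorem norm_sq_half_add_half_sub (a b : E) :
    ‖(1 / 2 : ℝ) • (a + b)‖ ^ 2 + ‖(1 / 2 : ℝ) • (a - b)‖ ^ 2 =
      1 / 2 * ‖a‖ ^ 2 + 1 / 2 * ‖b‖ ^ 2 := by
  rw [norm_smul, norm_smul, mul_pow, mul_pow, Real.norm_of_nonneg (by norm_num),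
    norm_add_sq_real, norm_sub_sq_real]
  ring

end Pointwise

theorem hasDerivAt_sqrt_sq_add {e : ℝ} (he : 0 < e) (t : ℝ) :
    HasDerivAt (fun t => √(t ^ 2 + e)) (t / √(t ^ 2 + e)) t := by
  have h := (((hasDerivAt_id t).pow 2).add_const e).sqrt
    (by have := sq_nonneg t; simp only [id, Pi.pow_apply]; positivity)
  refine h.congr_deriv ?_
  have : √(t ^ 2 + e) ≠ 0 := (Real.sqrt_pos.2 (by positivity)).ne'
  simp only [id, Nat.cast_ofNat]
  norm_num
  field_simp

/-- The quantity measuring how far `u - v` is from minimizing the Dirichlet energy. -/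
def deficitDensity {n : ℕ} (u v : Eu n → ℝ) (l e k d : ℝ) (z : Eu n) : ℝ :=
  l * (‖gradient u z‖ ^ 2 + ‖gradient v z‖ ^ 2) +
    l⁻¹ * (128 * (trunc (2 * k) u v z + trunc (2 * k) v u z) +
      4 * e ^ 2 * (‖gradient u z‖ ^ 2 + ‖gradient v z‖ ^ 2) + 8 * k ^ 2 * d ^ 2) + e ^ 2 / 16

set_option maxHeartbeats 1600000 in
theorem IsLocalMinimizer.neg_integral_le_deficit {n : ℕ} {u v : Eu n → ℝ} (h : IsSolution u v)
    (hmin : IsLocalMinimizer u v) {x : Eu n} {R k l e d : ℝ} (hR : 0 < R) (hk : 1 ≤ k)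
    (hl : 0 < l) (hl1 : l ≤ 1) (he : 0 < e) (he1 : e ≤ 1)
    (hm : ∀ z ∈ ball x (2 * R), u z ≤ k ∨ v z ≤ k)
    {ζ : Eu n → ℝ} (hζ : ContDiff ℝ (⊤ : ℕ∞) ζ) (hζ0 : ∀ z, 0 ≤ ζ z) (hζ1 : ∀ z, ζ z ≤ 1)
    (hζR : ∀ z ∈ ball x R, ζ z = 1) (hζ2 : ∀ z, z ∉ ball x (2 * R) → ζ z = 0)
    (hζg : ∀ z, z ∉ ball x (2 * R) → gradient ζ z = 0) (hζd : ∀ z, ‖gradient ζ z‖ ≤ d)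
    (hζR' : ∀ z ∈ ball x R, gradient ζ z = 0)
    {ψ : Eu n → ℝ} (hψ : ContDiff ℝ (⊤ : ℕ∞) ψ) (hψR : tsupport ψ ⊆ ball x R) :
    -∫ z, (2 * ⟪gradient (fun z => u z - v z) z, gradient ψ z⟫ + ‖gradient ψ z‖ ^ 2) ≤
      ∫ z in ball x (2 * R), deficitDensity u v l e k d z := by
  have hsu := h.smooth
  have hsv := h.smooth_right
  have hcu := hsu.continuous
  have hcv := hsv.continuous
  have hgu : Continuous (gradient u) := hsu.continuous_gradient (by norm_cast)
  have hgv : Continuous (gradient v) := hsv.continuous_gradient (by norm_cast)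
  have hgψ : Continuous (gradient ψ) := hψ.continuous_gradient (by norm_cast)
  have hgw : ∀ z, gradient (fun z => u z - v z) z = gradient u z - gradient v z := fun z =>
    ((hsu.hasGradientAt (by simp) z).sub_fun (hsv.hasGradientAt (by simp) z)).gradient
  have hψz : ∀ z, z ∉ ball x R → ψ z = 0 := fun z hz =>
    image_eq_zero_of_notMem_tsupport fun h => hz (hψR h)
  have hψg : ∀ z, z ∉ ball x R → gradient ψ z = 0 := fun z hz =>
    gradient_eq_zero_of_notMem_tsupport fun h => hz (hψR h)
  have hsub : ball x R ⊆ ball x (2 * R) := ball_subset_ball (by linarith)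
  set W : Eu n → ℝ := fun z => u z - v z + ψ z with hW
  set q : ℝ → ℝ := fun t => √(t ^ 2 + e) with hq
  have hqs : ∀ f : Eu n → ℝ, ContDiff ℝ (⊤ : ℕ∞) f → ContDiff ℝ (⊤ : ℕ∞) fun z => q (f z) := by
    intro f hf
    exact ((hf.pow 2).add contDiff_const).sqrt fun z => by positivity
  have hq2 : ∀ t, q t ^ 2 = t ^ 2 + e := fun t => Real.sq_sqrt (by positivity)
  set μ : Eu n → ℝ := fun z => u z + v z - q (u z - v z) with hμ
  set S : Eu n → ℝ := fun z => q (W z) + (1 - ζ z) * μ z with hS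
  have hWs : ContDiff ℝ (⊤ : ℕ∞) W := (hsu.sub hsv).add hψ
  have hμs : ContDiff ℝ (⊤ : ℕ∞) μ := (hsu.add hsv).sub (hqs _ (hsu.sub hsv))
  have hSs : ContDiff ℝ (⊤ : ℕ∞) S := (hqs _ hWs).add ((contDiff_const.sub hζ).mul hμs)
  set M : Eu n → Eu n := fun z => gradient u z + gradient v z -
    ((u z - v z) / q (u z - v z)) • (gradient u z - gradient v z) with hM
  have hgμ : ∀ z, HasGradientAt μ (M z) z := fun z =>
    ((hsu.hasGradientAt (by simp) z).add_fun (hsv.hasGradientAt (by simp) z)).sub_fun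
      ((hasDerivAt_sqrt_sq_add he _).comp_hasGradientAt
        ((hsu.hasGradientAt (by simp) z).sub_fun (hsv.hasGradientAt (by simp) z)))
  have hgW : ∀ z, HasGradientAt W (gradient u z - gradient v z + gradient ψ z) z := fun z =>
    ((hsu.hasGradientAt (by simp) z).sub_fun (hsv.hasGradientAt (by simp) z)).add_fun
      (hψ.hasGradientAt (by simp) z)
  have hgS : ∀ z, HasGradientAt S ((W z / q (W z)) • (gradient u z - gradient v z + gradient ψ z) +
      ((1 - ζ z) • M z + μ z • (0 - gradient ζ z))) z := fun z =>
    ((hasDerivAt_sqrt_sq_add he _).comp_hasGradientAt (hgW z)).add_fun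
      (((hasGradientAt_const z (1 : ℝ)).sub_fun (hζ.hasGradientAt (by simp) z)).mul_fun (hgμ z))
  set ub : Eu n → ℝ := fun z => 1 / 2 * (S z + W z) with hub
  set vb : Eu n → ℝ := fun z => 1 / 2 * (S z - W z) with hvb
  have hubs : ContDiff ℝ (⊤ : ℕ∞) ub := contDiff_const.mul (hSs.add hWs)
  have hvbs : ContDiff ℝ (⊤ : ℕ∞) vb := contDiff_const.mul (hSs.sub hWs)
  have hgub : Continuous (gradient ub) := hubs.continuous_gradient (by norm_cast)
  have hgvb : Continuous (gradient vb) := hvbs.continuous_gradient (by norm_cast)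
  have hcub := hubs.continuous
  have hcvb := hvbs.continuous
  have hgubz : ∀ z, gradient ub z = (1 / 2 : ℝ) • (gradient S z + gradient W z) := fun z =>
    (((hSs.hasGradientAt (by simp) z).add_fun (hWs.hasGradientAt (by simp) z)).const_mul_fun
      (1 / 2)).gradient
  have hgvbz : ∀ z, gradient vb z = (1 / 2 : ℝ) • (gradient S z - gradient W z) := fun z =>
    (((hSs.hasGradientAt (by simp) z).sub_fun (hWs.hasGradientAt (by simp) z)).const_mul_fun
      (1 / 2)).gradient
  -- outside the support of the perturbation
  have hSout : ∀ z, z ∉ ball x R → S z = u z + v z - ζ z * μ z := fun z hz => by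
    simp only [hS, hW, hμ, hψz z hz]
    ring_nf
  have hgSout : ∀ z, z ∉ ball x R →
      gradient S z = gradient u z + gradient v z - (ζ z • M z + μ z • gradient ζ z) :=
    fun z hz => by
      rw [(hgS z).gradient]
      simp only [hM, hW, hψz z hz, hψg z hz, add_zero]
      module
  have hgWout : ∀ z, z ∉ ball x R → gradient W z = gradient u z - gradient v z := fun z hz => by
    rw [(hgW z).gradient, hψg z hz, add_zero]
  have hfar : ∀ z, z ∉ ball x (2 * R) → ub z = u z ∧ vb z = v z := fun z hz => by
    have hz1 : z ∉ ball x R := fun h => hz (hsub h)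
    simp only [hub, hvb, hSout z hz1, hζ2 z hz, hW, hψz z hz1]
    constructor <;> ring
  set ρ := ‖x‖ + 2 * R with hρ
  have hρ0 : 0 < ρ := by positivity
  have hρs : ball x (2 * R) ⊆ ball 0 ρ := ball_subset_ball' (by rw [dist_zero_right]; linarith)
  have hE := hmin ρ hρ0 ub vb hubs hvbs fun z hz => hfar z fun h => hz (hρs h)
  set D : Eu n → ℝ := fun z => (‖gradient ub z‖ ^ 2 + ‖gradient vb z‖ ^ 2 + ub z ^ 2 * vb z ^ 2) -
    (‖gradient u z‖ ^ 2 + ‖gradient v z‖ ^ 2 + u z ^ 2 * v z ^ 2) with hD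
  have hcD : Continuous D := by fun_prop
  have hD0 : 0 ≤ ∫ z in ball 0 ρ, D z := by
    simp only [hD]
    rw [integral_sub (Continuous.integrableOn_ball (by fun_prop))
      (Continuous.integrableOn_ball (by fun_prop))]
    unfold energy at hE
    linarith
  have hDfar : ∀ z, z ∉ ball x (2 * R) → D z = 0 := fun z hz => by
    have hz1 : z ∉ ball x R := fun h => hz (hsub h)
    obtain ⟨e1, e2⟩ := hfar z hz
    have e3 : gradient ub z = gradient u z := by
      rw [hgubz, hgSout z hz1, hgWout z hz1, hζ2 z hz, hζg z hz]
      module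
    have e4 : gradient vb z = gradient v z := by
      rw [hgvbz, hgSout z hz1, hgWout z hz1, hζ2 z hz, hζg z hz]
      module
    simp only [hD, e1, e2, e3, e4, sub_self]
  have hDr : ∫ z in ball 0 ρ, D z = ∫ z in ball x (2 * R), D z := by
    rw [setIntegral_eq_integral_of_forall_compl_eq_zero hDfar,
      setIntegral_eq_integral_of_forall_compl_eq_zero fun z hz => hDfar z fun h => hz (hρs h)]
  have hgsum : ∀ z, ‖gradient ub z‖ ^ 2 + ‖gradient vb z‖ ^ 2 =
      1 / 2 * ‖gradient S z‖ ^ 2 + 1 / 2 * ‖gradient W z‖ ^ 2 := fun z => by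
    rw [hgubz, hgvbz, norm_sq_half_add_half_sub]
  have hprod : ∀ z, ub z ^ 2 * vb z ^ 2 = ((S z ^ 2 - W z ^ 2) / 4) ^ 2 := fun z => by
    simp only [hub, hvb]
    ring
  have hk0 : 0 < 2 * k := by linarith
  have hct1 := h.continuous_trunc hk0
  have hct2 := h.symm.continuous_trunc hk0
  have hDle : ∀ z ∈ ball x (2 * R),
      D z ≤ (2 * ⟪gradient (fun z => u z - v z) z, gradient ψ z⟫ + ‖gradient ψ z‖ ^ 2) +
        deficitDensity u v l e k d z := by
    intro z hz
    have hT1 := h.trunc_nonneg hk0 z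
    have hT2 := h.symm.trunc_nonneg hk0 z
    set T := trunc (2 * k) u v z + trunc (2 * k) v u z with hT
    have hT0 : 0 ≤ T := add_nonneg hT1 hT2
    have hua : u z ≤ 2 * k → ‖gradient u z‖ ^ 2 ≤ 4 * T := fun hu => by
      have := h.norm_gradient_sq_le_trunc (v := v) hu
      linarith
    have hva : v z ≤ 2 * k → ‖gradient v z‖ ^ 2 ≤ 4 * T := fun hv => by
      have := h.symm.norm_gradient_sq_le_trunc (v := u) hv
      linarith
    have hMz := norm_sq_deficit_gradient_le hk he hT0 (hm z hz) hua hva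
    set G := ‖gradient u z‖ ^ 2 + ‖gradient v z‖ ^ 2 with hG
    have hG0 : 0 ≤ G := by positivity
    have hli : 0 < l⁻¹ := inv_pos.2 hl
    have hrest : 0 ≤ l⁻¹ * (124 * T + 4 * e ^ 2 * G + 8 * k ^ 2 * d ^ 2) := by positivity
    have hup := h.pos z
    have hvp := h.pos_right z
    by_cases hzR : z ∈ ball x R
    · have hS1 : S z = q (W z) := by simp [hS, hζR z hzR]
      have hg1 : ‖gradient S z‖ ^ 2 ≤ ‖gradient W z‖ ^ 2 := by
        rw [(hgS z).gradient, (hgW z).gradient, hζR z hzR, hζR' z hzR]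
        simp only [sub_self, zero_smul, smul_zero, add_zero]
        rw [norm_smul, mul_pow]
        have h1 := pow_le_one₀ (n := 2) (abs_nonneg _) (abs_div_sqrt_le (W z) he)
        have h2 := sq_nonneg ‖gradient u z - gradient v z + gradient ψ z‖
        exact mul_le_of_le_one_left h2 h1
      have hg2 : ‖gradient W z‖ ^ 2 = ‖gradient u z‖ ^ 2 + ‖gradient v z‖ ^ 2 -
          2 * ⟪gradient u z, gradient v z⟫ +
          (2 * ⟪gradient u z - gradient v z, gradient ψ z⟫ + ‖gradient ψ z‖ ^ 2) := by
        rw [(hgW z).gradient, norm_add_sq_real, norm_sub_sq_real]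
        ring
      have h3 := neg_two_inner_le (a := gradient u z) (b := gradient v z) (T := T) hl <| by
        rcases hm z hz with h | h
        · exact Or.inl (hua (by linarith))
        · exact Or.inr (hva (by linarith))
      have h4 : 0 ≤ u z ^ 2 * v z ^ 2 := by positivity
      have h5 : ((S z ^ 2 - W z ^ 2) / 4) ^ 2 = e ^ 2 / 16 := by
        rw [hS1, hq2]
        ring
      have h6 : D z = 1 / 2 * ‖gradient S z‖ ^ 2 + 1 / 2 * ‖gradient W z‖ ^ 2 + e ^ 2 / 16 -
          (G + u z ^ 2 * v z ^ 2) := by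
        rw [← h5, ← hprod, ← hgsum]
      have h7 : deficitDensity u v l e k d z =
          l * G + l⁻¹ * (128 * T + 4 * e ^ 2 * G + 8 * k ^ 2 * d ^ 2) + e ^ 2 / 16 := rfl
      rw [h6, h7, hgw]
      rw [← hG] at hg2 h3
      clear_value G T
      clear * - hg1 hg2 h3 h4 hrest
      linarith
    · have hμle : |μ z| ≤ 2 * k := by
        have hqle : q (u z - v z) ≤ |u z - v z| + 1 := by
          refine Real.sqrt_le_iff.2 ⟨by positivity, ?_⟩
          have e3 : (|u z - v z| + 1) ^ 2 = (u z - v z) ^ 2 + 2 * |u z - v z| + 1 := by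
            rw [← sq_abs (u z - v z)]
            ring
          linarith [abs_nonneg (u z - v z)]
        have hqge : |u z - v z| ≤ q (u z - v z) := Real.abs_le_sqrt (by linarith)
        simp only [hμ]
        rw [abs_le]
        have h6 := le_abs_self (u z - v z)
        have h7 := neg_abs_le (u z - v z)
        constructor
        · rcases abs_cases (u z - v z) with h | h <;> linarith
        · rcases hm z hz with h | h <;> linarith
      have hd : ‖ζ z • M z + μ z • gradient ζ z‖ ^ 2 ≤
          2 * (64 * T + 2 * e ^ 2 * G) + 8 * k ^ 2 * d ^ 2 := by
        have h6 := norm_add_sq_le_two (ζ z • M z) (μ z • gradient ζ z)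
        rw [norm_smul, norm_smul, mul_pow, mul_pow, Real.norm_eq_abs, Real.norm_eq_abs] at h6
        have h7 : |ζ z| ^ 2 ≤ 1 := by
          rw [abs_of_nonneg (hζ0 z)]
          exact pow_le_one₀ (hζ0 z) (hζ1 z)
        have h8 : |μ z| ^ 2 * ‖gradient ζ z‖ ^ 2 ≤ (2 * k) ^ 2 * d ^ 2 := by
          have := hζd z
          gcongr
        have h9 : |ζ z| ^ 2 * ‖M z‖ ^ 2 ≤ ‖M z‖ ^ 2 := mul_le_of_le_one_left (sq_nonneg _) h7
        have h10 : ‖M z‖ ^ 2 ≤ 64 * T + 2 * e ^ 2 * G := hMz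
        linarith
      have hs : ‖gradient u z + gradient v z‖ ^ 2 ≤ 2 * G := by
        have := norm_add_sq_le_two (gradient u z) (gradient v z)
        linarith
      have h11 := half_norm_sub_sq_le hl hl1 hs hd
      have h12 : 1 / 2 * ‖gradient u z + gradient v z‖ ^ 2 +
          1 / 2 * ‖gradient u z - gradient v z‖ ^ 2 = G := by
        rw [norm_add_sq_real, norm_sub_sq_real]
        ring
      have h13 : ((S z ^ 2 - W z ^ 2) / 4) ^ 2 ≤ u z ^ 2 * v z ^ 2 + e ^ 2 / 16 := by
        have hWz : W z = u z - v z := by simp [hW, hψz z hzR]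
        have hqq := hq2 (u z - v z)
        have hq0 : 0 ≤ q (u z - v z) := Real.sqrt_nonneg _
        have e5 : u z ^ 2 * v z ^ 2 = (((u z + v z) ^ 2 - W z ^ 2) / 4) ^ 2 := by
          rw [hWz]
          ring
        rw [hSout z hzR, e5, hWz]
        have hz0 := hζ0 z
        have hz1 := hζ1 z
        rcases le_total 0 (μ z) with hμ0 | hμ0
        · have h14 : q (u z - v z) ≤ u z + v z - ζ z * μ z := by
            have : ζ z * μ z ≤ μ z := mul_le_of_le_one_left hμ0 hz1
            simp only [hμ] at this ⊢
            linarith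
          have h15 : u z + v z - ζ z * μ z ≤ u z + v z := by
            have := mul_nonneg hz0 hμ0
            linarith
          have h16 := pow_le_pow_left₀ hq0 h14 2
          have h17 := pow_le_pow_left₀ (hq0.trans h14) h15 2
          have h18 := pow_le_pow_left₀ (a := ((u z + v z - ζ z * μ z) ^ 2 - (u z - v z) ^ 2) / 4)
            (b := ((u z + v z) ^ 2 - (u z - v z) ^ 2) / 4) (by linarith) (by linarith) 2
          have := sq_nonneg e
          linarith
        · have h14 : u z + v z - ζ z * μ z ≤ q (u z - v z) := by
            have : μ z ≤ ζ z * μ z := by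
              have := mul_nonneg_of_nonpos_of_nonpos (sub_nonpos.2 hz1) hμ0
              linarith
            simp only [hμ] at this ⊢
            linarith
          have h15 : u z + v z ≤ u z + v z - ζ z * μ z := by
            have := mul_nonpos_of_nonneg_of_nonpos hz0 hμ0
            linarith
          have h16 := pow_le_pow_left₀ (by linarith) h14 2
          have h17 := pow_le_pow_left₀ (by linarith) h15 2
          have h19 : 0 ≤ (u z + v z) ^ 2 - (u z - v z) ^ 2 := by linarith [mul_pos hup hvp]
          have h18 := pow_le_pow_left₀ (a := ((u z + v z - ζ z * μ z) ^ 2 - (u z - v z) ^ 2) / 4)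
            (b := e / 4) (by linarith) (by linarith) 2
          have := sq_nonneg (((u z + v z) ^ 2 - (u z - v z) ^ 2) / 4)
          have e6 : (e / 4) ^ 2 = e ^ 2 / 16 := by ring
          rw [e6] at h18
          exact h18.trans (by linarith)
      have h14 : D z =
          1 / 2 * ‖gradient u z + gradient v z - (ζ z • M z + μ z • gradient ζ z)‖ ^ 2 +
          1 / 2 * ‖gradient u z - gradient v z‖ ^ 2 + ((S z ^ 2 - W z ^ 2) / 4) ^ 2 -
          (G + u z ^ 2 * v z ^ 2) := by
        rw [← hgSout z hzR, ← hgWout z hzR, ← hprod, ← hgsum]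
      have h15 : deficitDensity u v l e k d z =
          l * G + l⁻¹ * (128 * T + 4 * e ^ 2 * G + 8 * k ^ 2 * d ^ 2) + e ^ 2 / 16 := rfl
      rw [h14, h15, hψg z hzR, inner_zero_right, norm_zero]
      clear_value G T
      clear * - h11 h12 h13
      linarith
  have hcw : Continuous fun z => 2 * ⟪gradient (fun z => u z - v z) z, gradient ψ z⟫ +
      ‖gradient ψ z‖ ^ 2 := by
    simp only [hgw]
    fun_prop
  have hcQ : Continuous (deficitDensity u v l e k d) := by
    unfold deficitDensity
    fun_prop
  have hfin : ∫ z in ball x (2 * R), D z ≤ ∫ z in ball x (2 * R),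
      ((2 * ⟪gradient (fun z => u z - v z) z, gradient ψ z⟫ + ‖gradient ψ z‖ ^ 2) +
        deficitDensity u v l e k d z) := setIntegral_ball_mono hcD (hcw.add hcQ) hDle
  have hX : ∫ z in ball x (2 * R), (2 * ⟪gradient (fun z => u z - v z) z, gradient ψ z⟫ +
      ‖gradient ψ z‖ ^ 2) = ∫ z, (2 * ⟪gradient (fun z => u z - v z) z, gradient ψ z⟫ +
      ‖gradient ψ z‖ ^ 2) :=
    setIntegral_eq_integral_of_forall_compl_eq_zero fun z hz => by
      rw [hψg z fun h => hz (hsub h), inner_zero_right, norm_zero]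
      norm_num
  rw [integral_add hcw.integrableOn_ball hcQ.integrableOn_ball, hX] at hfin
  linarith

theorem integral_deficitDensity_le {n : ℕ} {u v : Eu n → ℝ} (h : IsSolution u v) {l e k d R : ℝ}
    {x : Eu n} (hk : 0 < k) (hR : 0 < R) {G T₁ T₂ : ℝ} (hl : 0 < l)
    (hG : ∫ z in ball x R, (‖gradient u z‖ ^ 2 + ‖gradient v z‖ ^ 2) ≤ G)
    (hT₁ : ∫ z in ball x R, trunc (2 * k) u v z ≤ T₁)
    (hT₂ : ∫ z in ball x R, trunc (2 * k) v u z ≤ T₂) :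
    ∫ z in ball x R, deficitDensity u v l e k d z ≤
      (l + l⁻¹ * (4 * e ^ 2)) * G + l⁻¹ * 128 * (T₁ + T₂) +
        (l⁻¹ * (8 * k ^ 2 * d ^ 2) + e ^ 2 / 16) * (R ^ n * ballVol n) := by
  have hgu : Continuous (gradient u) := h.smooth.continuous_gradient (by norm_cast)
  have hgv : Continuous (gradient v) := h.smooth_right.continuous_gradient (by norm_cast)
  have hct1 := h.continuous_trunc (k := 2 * k) (by linarith)
  have hct2 := h.symm.continuous_trunc (k := 2 * k) (by linarith)
  have e1 : ∀ z, deficitDensity u v l e k d z =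
      (l + l⁻¹ * (4 * e ^ 2)) * (‖gradient u z‖ ^ 2 + ‖gradient v z‖ ^ 2) +
      l⁻¹ * 128 * (trunc (2 * k) u v z + trunc (2 * k) v u z) +
      (l⁻¹ * (8 * k ^ 2 * d ^ 2) + e ^ 2 / 16) := by
    intro z
    unfold deficitDensity
    ring
  simp_rw [e1]
  rw [integral_add (Continuous.integrableOn_ball (by fun_prop))
    (Continuous.integrableOn_ball (by fun_prop)),
    integral_add (Continuous.integrableOn_ball (by fun_prop))
    (Continuous.integrableOn_ball (by fun_prop)), integral_const_mul, integral_const_mul,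
    integral_add hct1.integrableOn_ball hct2.integrableOn_ball, setIntegral_ball_const _ hR]
  have hli : 0 < l⁻¹ := inv_pos.2 hl
  gcongr

theorem exists_trunc_energy_bound (n : ℕ) : ∃ C : ℝ, 1 ≤ C ∧ ∀ u v : Eu n → ℝ, IsSolution u v →
    ∀ (x : Eu n) (R k K : ℝ), 0 < R → 0 < k → 1 ≤ K →
      ∫ z in ball x (2 * R), (‖gradient u z‖ ^ 2 + ‖gradient v z‖ ^ 2) ≤ K ^ 2 * R ^ n →
      ∫ z in ball x R, trunc k u v z ≤ C * K ^ 2 * R ^ n * (k / R) := by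
  obtain ⟨Ct, hCt, htr⟩ := exists_trunc_bound n
  have hV := ballVol_pos n
  set A := 1 + 2 ^ n * ballVol n with hA
  have hA1 : 1 ≤ A := by
    have : 0 ≤ 2 ^ n * ballVol n := by positivity
    linarith
  refine ⟨Ct * A, one_le_mul_of_one_le_of_one_le hCt hA1, ?_⟩
  intro u v h x R k K hR hk hK hE
  have hgu : Continuous (gradient u) := h.smooth.continuous_gradient (by norm_cast)
  have hgv : Continuous (gradient v) := h.smooth_right.continuous_gradient (by norm_cast)
  have hKn : 1 ≤ K ^ 2 := one_le_pow₀ hK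
  have hgrad : ∫ z in ball x (2 * R), ‖gradient u z‖ ≤ A * K ^ 2 * R ^ n := by
    have h1 := sq_setIntegral_ball_le (x := x) (r := 2 * R) hgu.norm (by positivity)
    have h2 : ∫ z in ball x (2 * R), ‖gradient u z‖ ^ 2 ≤ K ^ 2 * R ^ n :=
      (setIntegral_ball_mono (by fun_prop) (by fun_prop) fun z _ => by
        linarith [sq_nonneg ‖gradient v z‖]).trans hE
    refine abs_le_of_sq_le_sq' ?_ (by positivity) |>.2
    calc _ ≤ _ := h1
      _ ≤ (2 * R) ^ n * ballVol n * (K ^ 2 * R ^ n) := by gcongr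
      _ = (2 ^ n * ballVol n) * (K ^ 2 * R ^ n * R ^ n) := by ring
      _ ≤ A ^ 2 * (K ^ 2 * R ^ n * R ^ n * K ^ 2) := by
        have h3 : 2 ^ n * ballVol n ≤ A ^ 2 := by nlinarith
        have h4 : K ^ 2 * R ^ n * R ^ n ≤ K ^ 2 * R ^ n * R ^ n * K ^ 2 :=
          le_mul_of_one_le_right (by positivity) hKn
        gcongr
      _ = _ := by ring
  calc _ ≤ _ := htr u v h x R k hR hk
    _ ≤ k * (Ct / R) * (A * K ^ 2 * R ^ n) := by gcongr
    _ = _ := by ring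

/-- The almost minimality of `u - v` for the Dirichlet energy, in linearised form. -/
theorem exists_deficit_bound (n : ℕ) : ∃ C : ℝ, 1 ≤ C ∧ ∀ u v : Eu n → ℝ, IsSolution u v →
    IsLocalMinimizer u v → ∀ (x : Eu n) (R k K : ℝ), 1 ≤ k → k ≤ R → 1 ≤ K →
      (∀ z ∈ ball x (2 * R), u z ≤ k ∨ v z ≤ k) →
      ∫ z in ball x (4 * R), (‖gradient u z‖ ^ 2 + ‖gradient v z‖ ^ 2) ≤ K ^ 2 * R ^ n →
      ∀ ψ : Eu n → ℝ, ContDiff ℝ (⊤ : ℕ∞) ψ → HasCompactSupport ψ → tsupport ψ ⊆ ball x R →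
        (∫ z, ⟪gradient (fun z => u z - v z) z, gradient ψ z⟫) ^ 2 ≤
          C * K ^ 2 * R ^ n * √(k / R) * ∫ z, ‖gradient ψ z‖ ^ 2 := by
  obtain ⟨Cc, hCc, hcut⟩ := exists_cutoff n
  obtain ⟨Ct, hCt, htr⟩ := exists_trunc_energy_bound n
  have hV := ballVol_pos n
  set A := 2 ^ n + 2 ^ n * ballVol n with hA
  have hA1 : 1 ≤ A := by
    have : 0 ≤ 2 ^ n * ballVol n := by positivity
    have : (1 : ℝ) ≤ 2 ^ n := one_le_pow₀ (by norm_num)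
    linarith
  refine ⟨5 + 256 * Ct * A + 8 * Cc ^ 2 * A + A, ?_, ?_⟩
  · have : 0 ≤ 256 * Ct * A + 8 * Cc ^ 2 * A + A := by positivity
    linarith
  intro u v h hmin x R k K hk hkR hK hm hE ψ hψ hψc hψR
  have hR1 : 1 ≤ R := hk.trans hkR
  have hR : 0 < R := by linarith
  have hk0 : 0 < k := by linarith
  obtain ⟨ζ, hζ, hζc, hζ0, hζ1, hζR, hζ2, hζg, hζC, hζR'⟩ := hcut x R hR
  have hgu : Continuous (gradient u) := h.smooth.continuous_gradient (by norm_cast)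
  have hgv : Continuous (gradient v) := h.smooth_right.continuous_gradient (by norm_cast)
  have hgψ : Continuous (gradient ψ) := hψ.continuous_gradient (by norm_cast)
  have hgw : ∀ z, gradient (fun z => u z - v z) z = gradient u z - gradient v z := fun z =>
    ((h.smooth.hasGradientAt (by simp) z).sub_fun
      (h.smooth_right.hasGradientAt (by simp) z)).gradient
  set l := √(k / R) with hl
  have hl0 : 0 < l := Real.sqrt_pos.2 (by positivity)
  have hl2 : l ^ 2 = k / R := Real.sq_sqrt (by positivity)
  have hl1 : l ≤ 1 := Real.sqrt_le_one.2 (div_le_one_of_le₀ hkR hR.le)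
  have hli : 0 < l⁻¹ := inv_pos.2 hl0
  have hlil : l⁻¹ * l ^ 2 = l := by field_simp
  have he0 : 0 < 1 / R := by positivity
  have he1 : 1 / R ≤ 1 := div_le_one_of_le₀ hR1 hR.le
  have he2 : (1 / R) ^ 2 ≤ l ^ 2 := by
    rw [hl2]
    calc (1 / R) ^ 2 ≤ 1 / R := by rw [sq]; exact mul_le_of_le_one_left he0.le he1
      _ ≤ k / R := by gcongr
  have hKn : 1 ≤ K ^ 2 := one_le_pow₀ hK
  have hRn : 0 < R ^ n := by positivity
  have hE2 : ∫ z in ball x (2 * (2 * R)), (‖gradient u z‖ ^ 2 + ‖gradient v z‖ ^ 2) ≤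
      K ^ 2 * (2 * R) ^ n := by
    rw [← mul_assoc, show (2 : ℝ) * 2 = 4 by norm_num]
    refine hE.trans ?_
    gcongr
    linarith
  have hT₁ : ∫ z in ball x (2 * R), trunc (2 * k) u v z ≤ Ct * l ^ 2 * (2 ^ n * K ^ 2 * R ^ n) := by
    refine (htr u v h x (2 * R) (2 * k) K (by positivity) (by positivity) hK hE2).trans_eq ?_
    rw [hl2, mul_div_mul_left _ _ two_ne_zero]
    ring
  have hT₂ : ∫ z in ball x (2 * R), trunc (2 * k) v u z ≤ Ct * l ^ 2 * (2 ^ n * K ^ 2 * R ^ n) := by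
    refine (htr v u h.symm x (2 * R) (2 * k) K (by positivity) (by positivity) hK ?_).trans_eq ?_
    · simpa only [add_comm] using hE2
    · rw [hl2, mul_div_mul_left _ _ two_ne_zero]
      ring
  have hG : ∫ z in ball x (2 * R), (‖gradient u z‖ ^ 2 + ‖gradient v z‖ ^ 2) ≤ K ^ 2 * R ^ n :=
    (setIntegral_ball_mono_set (by fun_prop) (fun z => by positivity)
      (ball_subset_ball (by linarith))).trans hE
  have hdens := integral_deficitDensity_le h (e := 1 / R) (d := Cc / R) hk0
    (by positivity : 0 < 2 * R) hl0 hG hT₁ hT₂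
  set Δ := (5 + 256 * Ct * A + 8 * Cc ^ 2 * A + A) * K ^ 2 * R ^ n * l with hΔ
  have hdens' : ∫ z in ball x (2 * R), deficitDensity u v l (1 / R) k (Cc / R) z ≤ Δ := by
    refine hdens.trans ?_
    have p1 : l⁻¹ * (4 * (1 / R) ^ 2) ≤ 4 * l := by
      calc l⁻¹ * (4 * (1 / R) ^ 2) ≤ l⁻¹ * (4 * l ^ 2) := by gcongr
        _ = 4 * (l⁻¹ * l ^ 2) := by ring
        _ = _ := by rw [hlil]
    have p2 : l⁻¹ * 128 *
        (Ct * l ^ 2 * (2 ^ n * K ^ 2 * R ^ n) + Ct * l ^ 2 * (2 ^ n * K ^ 2 * R ^ n)) ≤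
        256 * Ct * A * K ^ 2 * R ^ n * l := by
      calc _ = 256 * Ct * 2 ^ n * K ^ 2 * R ^ n * (l⁻¹ * l ^ 2) := by ring
        _ ≤ 256 * Ct * A * K ^ 2 * R ^ n * (l⁻¹ * l ^ 2) := by
          have : 2 ^ n ≤ A := by
            have : 0 ≤ 2 ^ n * ballVol n := by positivity
            linarith
          gcongr
        _ = _ := by rw [hlil]
    have p3 : l⁻¹ * (8 * k ^ 2 * (Cc / R) ^ 2) ≤ 8 * Cc ^ 2 * l := by
      calc l⁻¹ * (8 * k ^ 2 * (Cc / R) ^ 2) = l⁻¹ * (8 * Cc ^ 2 * (k / R) ^ 2) := by ring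
        _ = 8 * Cc ^ 2 * (l⁻¹ * l ^ 2) * l ^ 2 := by rw [← hl2]; ring
        _ = 8 * Cc ^ 2 * l * l ^ 2 := by rw [hlil]
        _ ≤ 8 * Cc ^ 2 * l * 1 := by
          gcongr
          exact pow_le_one₀ hl0.le hl1
        _ = _ := by ring
    have p4 : (1 / R) ^ 2 / 16 ≤ l := by
      have : l ^ 2 ≤ l := by nlinarith
      have : 0 ≤ (1 / R) ^ 2 := by positivity
      linarith
    have p5 : (2 * R) ^ n * ballVol n ≤ A * (K ^ 2 * R ^ n) := by
      calc (2 * R) ^ n * ballVol n = 2 ^ n * ballVol n * R ^ n := by ring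
        _ ≤ A * (K ^ 2 * R ^ n) := by
          have : (0 : ℝ) < 2 ^ n := by positivity
          have : 2 ^ n * ballVol n ≤ A := by linarith
          have : R ^ n ≤ K ^ 2 * R ^ n := le_mul_of_one_le_left hRn.le hKn
          gcongr
    calc _ ≤ (l + 4 * l) * (K ^ 2 * R ^ n) + 256 * Ct * A * K ^ 2 * R ^ n * l +
        (8 * Cc ^ 2 * l + l) * (A * (K ^ 2 * R ^ n)) := by
          gcongr
      _ = Δ := by
        rw [hΔ]
        ring
  have hneg : ∀ φ : Eu n → ℝ, ContDiff ℝ (⊤ : ℕ∞) φ → tsupport φ ⊆ ball x R →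
      -∫ z, (2 * ⟪gradient (fun z => u z - v z) z, gradient φ z⟫ + ‖gradient φ z‖ ^ 2) ≤ Δ :=
    fun φ h1 h2 => (hmin.neg_integral_le_deficit h hR hk hl0 hl1 he0 he1 hm hζ hζ0 hζ1 hζR hζ2 hζg
      hζC hζR' h1 h2).trans hdens'
  set a := ∫ z, ⟪gradient (fun z => u z - v z) z, gradient ψ z⟫ with ha
  set b := ∫ z, ‖gradient ψ z‖ ^ 2 with hb
  have hquad : ∀ t : ℝ, 0 ≤ b * (t * t) + 2 * a * t + Δ := by
    intro t
    have h1 := hneg (fun z => t * ψ z) (contDiff_const.mul hψ) <|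
      (closure_mono fun z hz => right_ne_zero_of_mul hz).trans hψR
    have e1 : ∀ z, gradient (fun z => t * ψ z) z = t • gradient ψ z := fun z =>
      ((hψ.hasGradientAt (by simp) z).const_mul_fun t).gradient
    have e2 : ∀ z, 2 * ⟪gradient (fun z => u z - v z) z, gradient (fun z => t * ψ z) z⟫ +
        ‖gradient (fun z => t * ψ z) z‖ ^ 2 =
        2 * t * ⟪gradient (fun z => u z - v z) z, gradient ψ z⟫ + t ^ 2 * ‖gradient ψ z‖ ^ 2 := by
      intro z
      rw [e1, inner_smul_right, norm_smul, mul_pow, Real.norm_eq_abs, sq_abs]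
      ring
    simp_rw [e2] at h1
    have hgc := hasCompactSupport_gradient hψc
    rw [integral_add, integral_const_mul, integral_const_mul] at h1
    · linarith
    · refine Continuous.integrable_of_hasCompactSupport ?_ ?_
      · simp only [hgw]
        fun_prop
      · exact HasCompactSupport.intro hgc fun z hz => by
          rw [image_eq_zero_of_notMem_tsupport hz, inner_zero_right, mul_zero]
    · refine Continuous.integrable_of_hasCompactSupport (by fun_prop) ?_
      exact HasCompactSupport.intro hgc fun z hz => by
          rw [image_eq_zero_of_notMem_tsupport hz, norm_zero]
          ring
  have hdisc := discrim_le_zero hquad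
  unfold discrim at hdisc
  linarith

theorem exists_sup_bound (n : ℕ) : ∃ C : ℝ, 1 ≤ C ∧ ∀ f : Eu n → ℝ, ContDiff ℝ 2 f →
    (∀ z, 0 ≤ lap f z) → (∀ z, 0 ≤ f z) → ∀ (x : Eu n) (s : ℝ), 0 < s → ∀ y ∈ ball x s,
      f y ^ 2 * s ^ n ≤ C * ∫ z in ball x (2 * s), f z ^ 2 := by
  obtain ⟨K⟩ := RadialKernel.instNonempty n
  refine ⟨K.C, K.one_le_C, fun f hf hl h0 x s hs y hy => ?_⟩
  have h1 := K.sq_le_of_subharmonic hf hl h0 y hs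
  have hc := hf.continuous
  have h2 : ∫ z in ball y s, f z ^ 2 ≤ ∫ z in ball x (2 * s), f z ^ 2 :=
    setIntegral_ball_mono_set (by fun_prop) (fun z => sq_nonneg _)
      (ball_subset_ball' (by rw [mem_ball] at hy; linarith))
  have hC := K.C_pos
  rw [← div_eq_inv_mul, le_div_iff₀ (by positivity)] at h1
  exact h1.trans (by gcongr)

set_option maxHeartbeats 1600000 in
/-- Where `u - v` is close to an affine function, the product of the suprema of `u` and `v` on a
smaller ball is at most quadratic in the radius. -/
theorem exists_factor_bound (n : ℕ) : ∃ C : ℝ, 1 ≤ C ∧ ∀ u v : Eu n → ℝ, IsSolution u v →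
    ∀ (x : Eu n) (R K c : ℝ) (p : Eu n), 1 ≤ R → 1 ≤ K → 0 ≤ c → ‖p‖ ≤ K →
      ∫ z in ball x R, (u z - v z - (c + ⟪p, z - x⟫)) ^ 2 ≤ K ^ 2 * R ^ (n + 2) →
      ∫ z in ball x R, u z ^ 2 * v z ^ 2 ≤ K ^ 2 * R ^ n →
      ∃ A B : ℝ, 0 ≤ A ∧ 0 ≤ B ∧ (∀ z ∈ ball x (R / 4), u z ≤ A) ∧ (∀ z ∈ ball x (R / 4), v z ≤ B) ∧
        B ≤ C * K * R ∧ A * B ≤ C * K ^ 2 * R ^ 2 := by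
  obtain ⟨S, hS, hsup⟩ := exists_sup_bound n
  have hV := ballVol_pos n
  set V := ballVol n with hVdef
  set Q := S * 2 ^ n * (4 + 4 * V) with hQ
  have h2n : (1 : ℝ) ≤ 2 ^ n := one_le_pow₀ (by norm_num)
  have hQ1 : 1 ≤ Q := by
    have : 1 ≤ S * 2 ^ n := one_le_mul_of_one_le_of_one_le hS h2n
    nlinarith
  set Q' := S * 4 ^ n * (16 + 4 * Q ^ 2) with hQ'
  have hQ'1 : 1 ≤ Q' := by
    have : 1 ≤ S * 4 ^ n := one_le_mul_of_one_le_of_one_le hS (one_le_pow₀ (by norm_num))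
    nlinarith
  refine ⟨10 * Q ^ 2 + 3 * Q * Q' + Q', by nlinarith, ?_⟩
  intro u v h x R K c p hR1 hK hc hp hg huv
  have hR : 0 < R := by linarith
  have hK0 : 0 < K := by linarith
  have hsu := h.smooth
  have hsv := h.smooth_right
  have hcu := hsu.continuous
  have hcv := hsv.continuous
  set g : Eu n → ℝ := fun z => u z - v z - (c + ⟪p, z - x⟫) with hgdef
  have hcg : Continuous g := by fun_prop
  have hin : ∀ z ∈ ball x R, |⟪p, z - x⟫| ≤ K * R := fun z hz => by
    have h1 := abs_real_inner_le_norm p (z - x)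
    have h2 : ‖z - x‖ ≤ R := (mem_ball_iff_norm.1 hz).le
    exact h1.trans (by gcongr)
  have hKR : 1 ≤ K ^ 2 * R ^ 2 := one_le_mul_of_one_le_of_one_le (one_le_pow₀ hK) (one_le_pow₀ hR1)
  have hRn : 0 < R ^ n := by positivity
  have hKRn : K ^ 2 * R ^ n ≤ K ^ 2 * R ^ (n + 2) := by
    have : R ^ n ≤ R ^ (n + 2) := pow_le_pow_right₀ hR1 (by omega)
    gcongr
  have hRRn : R ^ n ≤ K ^ 2 * R ^ (n + 2) := by
    calc R ^ n ≤ K ^ 2 * R ^ 2 * R ^ n := le_mul_of_one_le_left hRn.le hKR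
      _ = _ := by ring
  -- `v` in mean square
  have hv2 : ∫ z in ball x R, v z ^ 2 ≤ (4 + 4 * V) * (K ^ 2 * R ^ (n + 2)) := by
    have h1 : ∫ z in ball x R, v z ^ 2 ≤
        ∫ z in ball x R, (2 * (u z ^ 2 * v z ^ 2) + 2 * g z ^ 2 + (2 + 2 * (K * R) ^ 2)) := by
      refine setIntegral_ball_mono (by fun_prop) (by fun_prop) fun z hz => ?_
      have h2 := abs_le.1 (hin z hz)
      have h3 := h.pos z
      have h4 := h.pos_right z
      have h5 : v z * v z ≤ u z * v z + v z * (K * R) - v z * g z := by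
        have : v z ≤ u z + K * R - g z := by
          simp only [hgdef]
          linarith
        nlinarith
      nlinarith [sq_nonneg (v z - 2 * (K * R)), sq_nonneg (v z + 2 * g z),
        sq_nonneg (u z * v z - 1)]
    rw [integral_add (Continuous.integrableOn_ball (by fun_prop))
      (Continuous.integrableOn_ball (by fun_prop)),
      integral_add (Continuous.integrableOn_ball (by fun_prop))
      (Continuous.integrableOn_ball (by fun_prop)), integral_const_mul, integral_const_mul,
      setIntegral_ball_const _ hR, ← hVdef] at h1
    have h6 : (K * R) ^ 2 * (R ^ n * V) = V * (K ^ 2 * R ^ (n + 2)) := by ring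
    have h7 : V * R ^ n ≤ V * (K ^ 2 * R ^ (n + 2)) := by gcongr
    linarith
  have hu2 : ∫ z in ball x R, u z ^ 2 ≤ (16 + 16 * V) * ((c + K * R) ^ 2 * R ^ n) := by
    have h1 : ∫ z in ball x R, u z ^ 2 ≤
        ∫ z in ball x R, (3 * v z ^ 2 + 3 * g z ^ 2 + 3 * (c + K * R) ^ 2) := by
      refine setIntegral_ball_mono (by fun_prop) (by fun_prop) fun z hz => ?_
      have h2 := abs_le.1 (hin z hz)
      have h3 : (c + ⟪p, z - x⟫) ^ 2 ≤ (c + K * R) ^ 2 := sq_le_sq' (by linarith) (by linarith)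
      have h4 : u z = v z + g z + (c + ⟪p, z - x⟫) := by
        simp only [hgdef]
        ring
      rw [h4]
      nlinarith [sq_nonneg (v z - g z), sq_nonneg (v z - (c + ⟪p, z - x⟫)),
        sq_nonneg (g z - (c + ⟪p, z - x⟫))]
    rw [integral_add (Continuous.integrableOn_ball (by fun_prop))
      (Continuous.integrableOn_ball (by fun_prop)),
      integral_add (Continuous.integrableOn_ball (by fun_prop))
      (Continuous.integrableOn_ball (by fun_prop)), integral_const_mul, integral_const_mul,
      setIntegral_ball_const _ hR, ← hVdef] at h1
    have h6 : K ^ 2 * R ^ (n + 2) ≤ (c + K * R) ^ 2 * R ^ n := by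
      calc K ^ 2 * R ^ (n + 2) = (0 + K * R) ^ 2 * R ^ n := by ring
        _ ≤ _ := by gcongr
    have h7 : V * (K ^ 2 * R ^ (n + 2)) ≤ V * ((c + K * R) ^ 2 * R ^ n) := by gcongr
    have h8 : 0 ≤ (c + K * R) ^ 2 * R ^ n := by positivity
    have h9 : 0 ≤ V * ((c + K * R) ^ 2 * R ^ n) := by positivity
    linarith
  have hvsup : ∀ z ∈ ball x (R / 2), v z ≤ Q * K * R := fun z hz => by
    have h1 := hsup v hsv.two_of_top h.symm.lap_nonneg (fun z => (h.pos_right z).le) x (R / 2)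
      (by positivity) z hz
    rw [mul_div_cancel₀ _ two_ne_zero, div_pow, ← mul_div_assoc, div_le_iff₀ (by positivity)] at h1
    have h2 : v z ^ 2 * R ^ n ≤ (Q * (K ^ 2 * R ^ 2)) * R ^ n := by
      calc _ ≤ _ := h1
        _ ≤ S * ((4 + 4 * V) * (K ^ 2 * R ^ (n + 2))) * 2 ^ n := by gcongr
        _ = _ := by
          rw [hQ]
          ring
    have h3 := le_of_mul_le_mul_right h2 hRn
    refine (abs_le_of_sq_le_sq' (h3.trans ?_) (by positivity)).2
    calc Q * (K ^ 2 * R ^ 2) ≤ Q * Q * (K ^ 2 * R ^ 2) := by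
          have : Q ≤ Q * Q := by nlinarith
          gcongr
      _ = _ := by ring
  have husup : ∀ z ∈ ball x (R / 2), u z ≤ 2 * Q * (c + K * R) := fun z hz => by
    have h1 := hsup u hsu.two_of_top h.lap_nonneg (fun z => (h.pos z).le) x (R / 2)
      (by positivity) z hz
    rw [mul_div_cancel₀ _ two_ne_zero, div_pow, ← mul_div_assoc, div_le_iff₀ (by positivity)] at h1
    have h2 : u z ^ 2 * R ^ n ≤ (4 * Q * (c + K * R) ^ 2) * R ^ n := by
      calc _ ≤ _ := h1
        _ ≤ S * ((16 + 16 * V) * ((c + K * R) ^ 2 * R ^ n)) * 2 ^ n := by gcongr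
        _ = _ := by
          rw [hQ]
          ring
    have h3 := le_of_mul_le_mul_right h2 hRn
    refine (abs_le_of_sq_le_sq' (h3.trans ?_) (by positivity)).2
    calc 4 * Q * (c + K * R) ^ 2 ≤ 4 * (Q * Q) * (c + K * R) ^ 2 := by
          have : Q ≤ Q * Q := by nlinarith
          gcongr
      _ = _ := by ring
  have hsub : ball x (R / 4) ⊆ ball x (R / 2) := ball_subset_ball (by linarith)
  have hQQ : 0 ≤ 3 * Q * Q' := by positivity
  have hQ2 : Q ≤ Q ^ 2 := by nlinarith
  rcases lt_or_ge c (4 * (K * R)) with hcs | hcl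
  · refine ⟨10 * Q * (K * R), Q * K * R, by positivity, by positivity, fun z hz => ?_,
      fun z hz => hvsup z (hsub hz), ?_, ?_⟩
    · refine (husup z (hsub hz)).trans ?_
      have : 2 * Q * (c + K * R) ≤ 2 * Q * (5 * (K * R)) := by
        gcongr
        linarith
      linarith
    · gcongr
      nlinarith
    · calc _ = 10 * Q ^ 2 * K ^ 2 * R ^ 2 := by ring
        _ ≤ _ := by
          gcongr
          linarith
  · have hc0 : 0 < c := lt_of_lt_of_le (by positivity) hcl
    refine ⟨3 * Q * c, Q' * (K ^ 2 * R ^ 2) / c, by positivity, by positivity, fun z hz => ?_,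
      fun z hz => ?_, ?_, ?_⟩
    · refine (husup z (hsub hz)).trans ?_
      have : 2 * Q * (c + K * R) ≤ 2 * Q * (3 / 2 * c) := by
        gcongr
        linarith
      linarith
    · have h1 : ∫ z in ball x (R / 2), c ^ 2 * v z ^ 2 ≤
          ∫ z in ball x (R / 2), (16 * (u z ^ 2 * v z ^ 2) + 4 * (Q * K * R) ^ 2 * g z ^ 2) := by
        refine setIntegral_ball_mono (by fun_prop) (by fun_prop) fun z hz => ?_
        have h2 := abs_le.1 (hin z (ball_subset_ball (by linarith) hz))
        have h3 := h.pos z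
        have h4 := h.pos_right z
        have h5 : c ≤ 4 / 3 * (u z - g z) := by
          have : 0 < v z := h4
          simp only [hgdef]
          linarith
        rcases le_total (g z ^ 2) (c ^ 2 / 4) with hg1 | hg1
        · have h6 : -(c / 2) ≤ g z :=
            (abs_le_of_sq_le_sq' (by linarith [div_pow c 2 2]) (by positivity)).1
          have h7 : c ^ 2 ≤ (4 * u z) ^ 2 := by
            gcongr
            have : 3 / 4 * c ≤ u z - g z := by linarith
            linarith
          have h8 : 0 ≤ 4 * (Q * K * R) ^ 2 * g z ^ 2 := by positivity
          have h9 := mul_le_mul_of_nonneg_right h7 (sq_nonneg (v z))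
          linarith
        · have h6 := pow_le_pow_left₀ h4.le (hvsup z hz) 2
          have h7 : c ^ 2 * v z ^ 2 ≤ 4 * g z ^ 2 * (Q * K * R) ^ 2 := by
            gcongr
            linarith
          have h8 : 0 ≤ 16 * (u z ^ 2 * v z ^ 2) := by positivity
          linarith
      rw [integral_add (Continuous.integrableOn_ball (by fun_prop))
        (Continuous.integrableOn_ball (by fun_prop)), integral_const_mul, integral_const_mul,
        integral_const_mul] at h1
      have hsub2 : ball x (R / 2) ⊆ ball x R := ball_subset_ball (by linarith)
      have h10 := (setIntegral_ball_mono_set (f := fun z => u z ^ 2 * v z ^ 2) (by fun_prop)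
        (fun z => by positivity) hsub2).trans huv
      have h11 := (setIntegral_ball_mono_set (f := fun z => g z ^ 2) (by fun_prop)
        (fun z => by positivity) hsub2).trans hg
      have h12 : c ^ 2 * ∫ z in ball x (R / 2), v z ^ 2 ≤
          (16 + 4 * Q ^ 2) * (K ^ 4 * R ^ 4 * R ^ n) := by
        have h13 : 4 * (Q * K * R) ^ 2 * ∫ z in ball x (R / 2), g z ^ 2 ≤
            4 * (Q * K * R) ^ 2 * (K ^ 2 * R ^ (n + 2)) := by gcongr
        have h14 : K ^ 2 * R ^ n ≤ K ^ 4 * R ^ 4 * R ^ n := by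
          have e1 : K ^ 2 ≤ K ^ 4 := pow_le_pow_right₀ hK (by norm_num)
          have e2 : K ^ 4 * R ^ n ≤ K ^ 4 * R ^ 4 * R ^ n := by
            have : 1 ≤ R ^ 4 := one_le_pow₀ hR1
            gcongr
            exact le_mul_of_one_le_right (by positivity) this
          exact le_trans (by gcongr) e2
        have h15 : 4 * (Q * K * R) ^ 2 * (K ^ 2 * R ^ (n + 2)) =
            4 * Q ^ 2 * (K ^ 4 * R ^ 4 * R ^ n) := by ring
        linarith
      have h16 := hsup v hsv.two_of_top h.symm.lap_nonneg (fun z => (h.pos_right z).le) x (R / 4)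
        (by positivity) z hz
      rw [show 2 * (R / 4) = R / 2 by ring, div_pow, ← mul_div_assoc,
        div_le_iff₀ (by positivity)] at h16
      have h17 : (c * v z) ^ 2 * R ^ n ≤ Q' * (K ^ 4 * R ^ 4) * R ^ n := by
        calc (c * v z) ^ 2 * R ^ n = c ^ 2 * (v z ^ 2 * R ^ n) := by ring
          _ ≤ c ^ 2 * (S * (∫ z in ball x (R / 2), v z ^ 2) * 4 ^ n) := by gcongr
          _ = S * 4 ^ n * (c ^ 2 * ∫ z in ball x (R / 2), v z ^ 2) := by ring
          _ ≤ S * 4 ^ n * ((16 + 4 * Q ^ 2) * (K ^ 4 * R ^ 4 * R ^ n)) := by gcongr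
          _ = _ := by
            rw [hQ']
            ring
      have h18 := le_of_mul_le_mul_right h17 hRn
      rw [le_div_iff₀ hc0, mul_comm]
      refine (abs_le_of_sq_le_sq' (h18.trans ?_) (by positivity)).2
      calc Q' * (K ^ 4 * R ^ 4) ≤ Q' * Q' * (K ^ 4 * R ^ 4) := by
            have : Q' ≤ Q' * Q' := by nlinarith
            gcongr
        _ = _ := by ring
    · rw [div_le_iff₀ hc0]
      calc Q' * (K ^ 2 * R ^ 2) = Q' * K * R * (K * R) := by ring
        _ ≤ (10 * Q ^ 2 + 3 * Q * Q' + Q') * K * R * c := by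
          have : 0 < K * R := by positivity
          gcongr
          · nlinarith
          · linarith
    · calc 3 * Q * c * (Q' * (K ^ 2 * R ^ 2) / c) = 3 * Q * Q' * K ^ 2 * R ^ 2 := by
            field_simp
        _ ≤ _ := by
          gcongr
          nlinarith

/-- At every point of a ball where `u - v` is close to an affine function, one of `u`, `v` is
of sublinear size. -/
theorem exists_min_bound (n : ℕ) : ∃ β C : ℝ, 0 < β ∧ β ≤ 1 / 2 ∧ 1 ≤ C ∧ ∀ u v : Eu n → ℝ,
    IsSolution u v →
    ∀ (x : Eu n) (R K c : ℝ) (p : Eu n), 1 ≤ R → 1 ≤ K → ‖p‖ ≤ K →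
      ∫ z in ball x R, (u z - v z - (c + ⟪p, z - x⟫)) ^ 2 ≤ K ^ 2 * R ^ (n + 2) →
      ∫ z in ball x R, u z ^ 2 * v z ^ 2 ≤ K ^ 2 * R ^ n →
      ∀ z ∈ ball x (R / 8), u z ≤ C * K * R ^ (1 - β) ∨ v z ≤ C * K * R ^ (1 - β) := by
  obtain ⟨a, D, ha, ha1, hD, hdec⟩ := exists_product_decay n
  obtain ⟨F, hF, hfac⟩ := exists_factor_bound n
  refine ⟨a / 2, 8 * F + D + 16 * F, by linarith, by linarith, by linarith, ?_⟩
  have main : ∀ u v : Eu n → ℝ, IsSolution u v →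
    ∀ (x : Eu n) (R K c : ℝ) (p : Eu n), 1 ≤ R → 1 ≤ K → 0 ≤ c → ‖p‖ ≤ K →
      ∫ z in ball x R, (u z - v z - (c + ⟪p, z - x⟫)) ^ 2 ≤ K ^ 2 * R ^ (n + 2) →
      ∫ z in ball x R, u z ^ 2 * v z ^ 2 ≤ K ^ 2 * R ^ n →
      ∀ z ∈ ball x (R / 8), u z ≤ (8 * F + D + 16 * F) * K * R ^ (1 - a / 2) ∨
        v z ≤ (8 * F + D + 16 * F) * K * R ^ (1 - a / 2) := by
    intro u v h x R K c p hR1 hK hc hp hg huv y hy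
    obtain ⟨A, B, hA, hB, hAu, hBv, hBC, hABC⟩ := hfac u v h x R K c p hR1 hK hc hp hg huv
    have hR : 0 < R := by linarith
    have hK0 : 0 < K := by linarith
    have hpow : 1 ≤ R ^ (1 - a / 2) := Real.one_le_rpow hR1 (by linarith)
    have hKp : 1 ≤ K * R ^ (1 - a / 2) := one_le_mul_of_one_le_of_one_le hK hpow
    have hy4 : y ∈ ball x (R / 4) := ball_subset_ball (by linarith) hy
    rcases lt_or_ge R 8 with hR8 | hR8
    · right
      calc v y ≤ F * K * R := (hBv y hy4).trans hBC
        _ ≤ F * K * 8 := by gcongr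
        _ = 8 * F * K * 1 := by ring
        _ ≤ (8 * F + D + 16 * F) * K * R ^ (1 - a / 2) := by
          gcongr
          linarith
    rcases lt_or_ge (v y) D with hvD | hvD
    · right
      calc v y ≤ D * 1 := by linarith
        _ ≤ (8 * F + D + 16 * F) * (K * R ^ (1 - a / 2)) := by
          gcongr
          linarith
        _ = _ := by ring
    have hsub : closedBall y (R / 8) ⊆ ball x (R / 4) := fun z hz => by
      rw [mem_ball] at hy ⊢
      rw [mem_closedBall] at hz
      linarith [dist_triangle z y x]
    have h1 := hdec u v h y (R / 8) A B (by linarith) (fun z hz => hAu z (hsub hz))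
      (fun z hz => hBv z (hsub hz)) hvD
    have h2 : (R / 8) ^ (-a) ≤ 8 * R ^ (-a) := by
      rw [Real.div_rpow hR.le (by norm_num), Real.rpow_neg (by norm_num : (0 : ℝ) ≤ 8),
        div_inv_eq_mul, mul_comm]
      have : (8 : ℝ) ^ a ≤ 8 ^ (1 : ℝ) := Real.rpow_le_rpow_of_exponent_le (by norm_num) ha1
      rw [Real.rpow_one] at this
      gcongr
    have h3 : u y * v y ≤ (16 * F * K * R ^ (1 - a / 2)) ^ 2 := by
      calc u y * v y ≤ 2 * (8 * R ^ (-a)) * (F * K ^ 2 * R ^ 2) := by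
            refine h1.trans ?_
            have : 0 ≤ A * B := mul_nonneg hA hB
            gcongr
        _ = 16 * F * K ^ 2 * (R ^ (-a) * R ^ (2 : ℝ)) := by
          rw [Real.rpow_two]
          ring
        _ = 16 * F * K ^ 2 * (R ^ (1 - a / 2) * R ^ (1 - a / 2)) := by
          rw [← Real.rpow_add hR, ← Real.rpow_add hR]
          ring_nf
        _ ≤ (16 * F) ^ 2 * K ^ 2 * (R ^ (1 - a / 2) * R ^ (1 - a / 2)) := by
          have : 16 * F ≤ (16 * F) ^ 2 := by nlinarith
          gcongr
        _ = _ := by ring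
    have h4 : 16 * F * K * R ^ (1 - a / 2) ≤ (8 * F + D + 16 * F) * K * R ^ (1 - a / 2) := by
      gcongr
      linarith
    by_contra hcon
    push Not at hcon
    have h5 : 0 < 16 * F * K * R ^ (1 - a / 2) := by positivity
    have h6 := mul_lt_mul'' (h4.trans_lt hcon.1) (h4.trans_lt hcon.2) h5.le h5.le
    rw [← sq] at h6
    linarith
  intro u v h x R K c p hR1 hK hp hg huv y hy
  rcases le_total 0 c with hc | hc
  · exact main u v h x R K c p hR1 hK hc hp hg huv y hy
  · refine (main v u h.symm x R K (-c) (-p) hR1 hK (by linarith)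
      (by rwa [norm_neg]) ?_ ?_ y hy).symm
    · have e : ∀ z, (v z - u z - (-c + ⟪-p, z - x⟫)) ^ 2 = (u z - v z - (c + ⟪p, z - x⟫)) ^ 2 := by
        intro z
        rw [inner_neg_left]
        ring
      simpa only [e] using hg
    · simpa only [mul_comm] using huv

/-- The weak Laplacian of `f` on `ball x r` has squared dual energy norm at most `Δ`. -/
def AlmostHarmonicOn {n : ℕ} (f : Eu n → ℝ) (x : Eu n) (r Δ : ℝ) : Prop :=
  ∀ ψ : Eu n → ℝ, ContDiff ℝ (⊤ : ℕ∞) ψ → HasCompactSupport ψ → tsupport ψ ⊆ ball x r →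
    (∫ z, ⟪gradient f z, gradient ψ z⟫) ^ 2 ≤ Δ * ∫ z, ‖gradient ψ z‖ ^ 2

theorem setIntegral_integral_swap {α β : Type*} [TopologicalSpace α] [TopologicalSpace β]
    [SecondCountableTopology α] [SecondCountableTopology β] [T2Space α] [T2Space β]
    [MeasurableSpace α] [MeasurableSpace β] [OpensMeasurableSpace α] [OpensMeasurableSpace β]
    (μ : Measure α) (ν : Measure β) [SFinite μ] [SFinite ν] [IsFiniteMeasureOnCompacts μ]
    [IsFiniteMeasureOnCompacts ν] {F : α → β → ℝ} (hF : Continuous (Function.uncurry F))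
    {s K : Set α} {t L : Set β} (hK : IsCompact K) (hL : IsCompact L) (hs : s ⊆ K) (ht : t ⊆ L) :
    Integrable (Function.uncurry F) ((μ.restrict s).prod (ν.restrict t)) ∧
    ∫ a in s, ∫ b in t, F a b ∂ν ∂μ = ∫ b in t, ∫ a in s, F a b ∂μ ∂ν := by
  have hi : Integrable (Function.uncurry F) ((μ.restrict s).prod (ν.restrict t)) := by
    rw [Measure.prod_restrict]
    exact (hF.continuousOn.integrableOn_compact (hK.prod hL)).mono_set (Set.prod_mono hs ht)
  exact ⟨hi, integral_integral_swap hi⟩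

namespace RadialKernel

variable {n : ℕ} (K : RadialKernel n)

theorem integral_norm_sq_gradient_test_le (z : Eu n) {s : ℝ} (hs : 0 < s) :
    ∫ y, ‖gradient (K.test z s) y‖ ^ 2 ≤ (s⁻¹ * K.C) ^ 2 * (s ^ n * ballVol n) := by
  have hg : Continuous (gradient (K.test z s)) :=
    (K.contDiff_test z s).continuous_gradient (by norm_cast)
  rw [← setIntegral_ball_const (x := z) _ hs]
  refine integral_le_setIntegral_ball (by fun_prop) (by fun_prop) (fun y hy => ?_) fun y hy => ?_
  · rw [mem_ball, dist_eq_norm, not_lt] at hy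
    rw [K.gradient_test, K.η_zero _ (norm_inv_smul_ge hs hy)]
    simp
  · rw [K.gradient_test, norm_smul, norm_smul, norm_neg, norm_inv, Real.norm_of_nonneg hs.le,
      Real.norm_of_nonneg (K.η_nonneg _)]
    rw [mem_ball, dist_eq_norm] at hy
    have h1 : ‖s⁻¹ • (y - z)‖ ≤ 1 := by
      rw [norm_smul, norm_inv, Real.norm_of_nonneg hs.le, inv_mul_le_iff₀ hs]
      linarith
    refine pow_le_pow_left₀ (by have := K.η_nonneg (s⁻¹ • (y - z)); positivity) ?_ 2
    refine mul_le_mul_of_nonneg_left ?_ (by positivity)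
    calc _ ≤ K.C * 1 := mul_le_mul (K.η_le _) h1 (norm_nonneg _) K.C_pos.le
      _ = K.C := mul_one _

theorem sq_avg_sub_avg_le {f : Eu n → ℝ} (hf : ContDiff ℝ 1 f) {x z : Eu n} {r Δ s t : ℝ}
    (hΔ : 0 ≤ Δ) (h : AlmostHarmonicOn f x r Δ) (hs : 0 < s) (hst : s ≤ t)
    (hz : closedBall z t ⊆ ball x r) :
    (K.avg f z t - K.avg f z s) ^ 2 ≤ K.C ^ 2 * ballVol n * Δ * t ^ 2 / s ^ n := by
  have hV := ballVol_pos n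
  set D := K.C ^ 2 * ballVol n * Δ / s ^ n with hD
  have hD0 : 0 ≤ D := by positivity
  have key : ∀ τ ∈ Set.Icc s t, ‖∫ y, ⟪gradient f (z + τ • y), y⟫ * K.η y‖ ≤ √D := by
    intro τ hτ
    have hτ0 : 0 < τ := hs.trans_le hτ.1
    rw [K.integral_inner_gradient_η z hτ0, norm_neg, Real.norm_eq_abs]
    refine Real.abs_le_sqrt ?_
    have h1 := h _ (K.contDiff_test z τ) (K.hasCompactSupport_test z hτ0)
      (((K.tsupport_test_subset hτ0).trans (closedBall_subset_closedBall hτ.2)).trans hz)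
    have h2 := h1.trans (mul_le_mul_of_nonneg_left (K.integral_norm_sq_gradient_test_le z hτ0) hΔ)
    rw [mul_pow]
    calc _ ≤ (τ * (τ ^ n)⁻¹) ^ 2 * (Δ * ((τ⁻¹ * K.C) ^ 2 * (τ ^ n * ballVol n))) := by gcongr
      _ = K.C ^ 2 * ballVol n * Δ / τ ^ n := by field_simp
      _ ≤ D := by
        rw [hD]
        gcongr
        exact hτ.1
  have hm := (convex_Icc s t).norm_image_sub_le_of_norm_hasDerivWithin_le
    (f := K.avg f z) (fun τ _ => (K.hasDerivAt_avg hf z τ).hasDerivWithinAt) key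
    (Set.left_mem_Icc.2 hst) (Set.right_mem_Icc.2 hst)
  have h3 := pow_le_pow_left₀ (norm_nonneg _) hm 2
  rw [Real.norm_eq_abs, sq_abs, mul_pow, Real.sq_sqrt hD0, Real.norm_of_nonneg (by linarith)] at h3
  refine h3.trans ?_
  have h4 : (t - s) ^ 2 ≤ t ^ 2 := pow_le_pow_left₀ (by linarith) (by linarith) 2
  calc D * (t - s) ^ 2 ≤ D * t ^ 2 := by gcongr
    _ = _ := by rw [hD]; ring

theorem avg_affine (c : ℝ) (p x z : Eu n) (s : ℝ) :
    K.avg (fun y => c + ⟪p, y - x⟫) z s = c + ⟪p, z - x⟫ := by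
  have e : ∀ y, (c + ⟪p, z + s • y - x⟫) * K.η y =
      (c + ⟪p, z - x⟫) * K.η y + s * (⟪p, y⟫ * K.η y) := by
    intro y
    rw [show z + s • y - x = (z - x) + s • y by abel, inner_add_right, inner_smul_right]
    ring
  have i1 : Integrable fun y => (c + ⟪p, z - x⟫) * K.η y := K.integrable_mul_η continuous_const
  have i2 : Integrable fun y => ⟪p, y⟫ * K.η y := K.integrable_mul_η (by fun_prop)
  have h0 : ∫ y, ⟪p, y⟫ * K.η y = 0 := by
    have h1 := integral_neg_eq_self (fun y => ⟪p, y⟫ * K.η y) volume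
    simp only [inner_neg_right, K.η_neg, neg_mul, integral_neg] at h1
    linarith
  simp only [avg]
  simp_rw [e]
  rw [integral_add i1 (i2.const_mul s), integral_const_mul, integral_const_mul, h0, K.integral_η]
  ring

end RadialKernel

theorem sq_integral_unitInterval_le {a : ℝ → ℝ} (ha : Continuous a) :
    (∫ τ in (0 : ℝ)..1, a τ) ^ 2 ≤ ∫ τ in (0 : ℝ)..1, a τ ^ 2 := by
  set I := ∫ τ in (0 : ℝ)..1, a τ with hI
  have h0 : 0 ≤ ∫ τ in (0 : ℝ)..1, (a τ - I) ^ 2 :=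
    intervalIntegral.integral_nonneg zero_le_one fun _ _ => sq_nonneg _
  have e : (fun τ => (a τ - I) ^ 2) = fun τ => a τ ^ 2 - 2 * I * a τ + I ^ 2 := by
    ext τ
    ring
  have i1 : IntervalIntegrable (fun τ => a τ ^ 2) volume 0 1 :=
    Continuous.intervalIntegrable (by fun_prop) _ _
  have i2 : IntervalIntegrable (fun τ => 2 * I * a τ) volume 0 1 :=
    Continuous.intervalIntegrable (by fun_prop) _ _
  have i12 : IntervalIntegrable (fun τ => a τ ^ 2 - 2 * I * a τ) volume 0 1 := i1.sub i2
  rw [e, intervalIntegral.integral_add i12 (by simp), intervalIntegral.integral_sub i1 i2,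
    intervalIntegral.integral_const_mul, ← hI] at h0
  simp only [intervalIntegral.integral_const, sub_zero, one_smul] at h0
  linarith

theorem setIntegral_ball_comp_add {n : ℕ} (g : Eu n → ℝ) (x h : Eu n) (ρ : ℝ) :
    ∫ z in ball x ρ, g (z + h) = ∫ z in ball (x + h) ρ, g z := by
  rw [← integral_indicator measurableSet_ball, ← integral_indicator measurableSet_ball,
    ← integral_add_right_eq_self ((ball (x + h) ρ).indicator g) h]
  congr 1
  ext z
  by_cases hz : z ∈ ball x ρ
  · rw [Set.indicator_of_mem hz, Set.indicator_of_mem (by simpa using hz)]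
  · rw [Set.indicator_of_notMem hz, Set.indicator_of_notMem (by simpa using hz)]

theorem integral_sq_translate_sub_le {n : ℕ} {f : Eu n → ℝ} (hf : ContDiff ℝ 1 f) (x h : Eu n)
    {ρ s : ℝ} (hs : ‖h‖ ≤ s) :
    ∫ z in ball x ρ, (f (z + h) - f z) ^ 2 ≤
      s ^ 2 * ∫ z in ball x (ρ + s), ‖gradient f z‖ ^ 2 := by
  have hg : Continuous (gradient f) := hf.continuous_gradient le_rfl
  have hcf := hf.continuous
  set E := ∫ z in ball x (ρ + s), ‖gradient f z‖ ^ 2 with hE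
  have pt : ∀ z, (f (z + h) - f z) ^ 2 ≤
      ∫ τ in Set.Ioc (0 : ℝ) 1, s ^ 2 * ‖gradient f (z + τ • h)‖ ^ 2 := by
    intro z
    have hd : ∀ τ ∈ Set.uIcc (0 : ℝ) 1, HasDerivAt (fun τ : ℝ => f (z + τ • h))
        ⟪gradient f (z + τ • h), h⟫ τ := by
      intro τ _
      have h1 : HasDerivAt (fun t : ℝ => z + t • h) h τ := by
        simpa using ((hasDerivAt_id τ).smul_const h).const_add z
      have h2 := (hf.hasGradientAt one_ne_zero (z + τ • h)).hasFDerivAt.comp_hasDerivAt τ h1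
      simp only [InnerProductSpace.toDual_apply_apply] at h2
      exact h2
    have hc : Continuous fun τ : ℝ => ⟪gradient f (z + τ • h), h⟫ := by fun_prop
    have := intervalIntegral.integral_eq_sub_of_hasDerivAt hd (hc.intervalIntegrable _ _)
    simp only [one_smul, zero_smul, add_zero] at this
    rw [← this, ← intervalIntegral.integral_of_le zero_le_one]
    refine (sq_integral_unitInterval_le hc).trans ?_
    refine intervalIntegral.integral_mono_on zero_le_one
      (Continuous.intervalIntegrable (by fun_prop) _ _)
      (Continuous.intervalIntegrable (by fun_prop) _ _) fun τ _ => ?_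
    rw [← sq_abs, ← mul_pow, mul_comm s]
    refine pow_le_pow_left₀ (abs_nonneg _) ((abs_real_inner_le_norm _ _).trans ?_) 2
    gcongr
  have hF : Continuous (Function.uncurry fun (z : Eu n) (τ : ℝ) =>
      s ^ 2 * ‖gradient f (z + τ • h)‖ ^ 2) := by
    simp only [Function.uncurry_def]
    fun_prop
  obtain ⟨hi, hsw⟩ := setIntegral_integral_swap volume volume hF (isCompact_closedBall x ρ)
    (isCompact_Icc (a := (0 : ℝ)) (b := 1)) ball_subset_closedBall Set.Ioc_subset_Icc_self
  calc ∫ z in ball x ρ, (f (z + h) - f z) ^ 2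
      ≤ ∫ z in ball x ρ, ∫ τ in Set.Ioc (0 : ℝ) 1, s ^ 2 * ‖gradient f (z + τ • h)‖ ^ 2 :=
        integral_mono_of_nonneg (Filter.Eventually.of_forall fun _ => sq_nonneg _)
          hi.integral_prod_left (Filter.Eventually.of_forall pt)
    _ = ∫ τ in Set.Ioc (0 : ℝ) 1, ∫ z in ball x ρ, s ^ 2 * ‖gradient f (z + τ • h)‖ ^ 2 := hsw
    _ ≤ ∫ τ in Set.Ioc (0 : ℝ) 1, s ^ 2 * E := by
        refine integral_mono_of_nonneg (Filter.Eventually.of_forall fun τ =>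
          integral_nonneg fun z => by positivity) continuous_const.integrableOn_Ioc ?_
        filter_upwards [ae_restrict_mem measurableSet_Ioc] with τ hτ
        rw [integral_const_mul, setIntegral_ball_comp_add (fun z => ‖gradient f z‖ ^ 2)]
        refine mul_le_mul_of_nonneg_left (setIntegral_ball_mono_set (by fun_prop)
          (fun _ => by positivity) (ball_subset_ball' ?_)) (by positivity)
        rw [dist_eq_norm, add_sub_cancel_left, norm_smul, Real.norm_of_nonneg hτ.1.le]
        nlinarith [hτ.2, norm_nonneg h]
    _ = s ^ 2 * E := by simp

namespace RadialKernel

variable {n : ℕ} (K : RadialKernel n)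

theorem integral_sq_sub_avg_le {f : Eu n → ℝ} (hf : ContDiff ℝ 1 f) (x : Eu n)
    {ρ s : ℝ} (hs : 0 ≤ s) :
    ∫ z in ball x ρ, (f z - K.avg f z s) ^ 2 ≤
      s ^ 2 * ∫ z in ball x (ρ + s), ‖gradient f z‖ ^ 2 := by
  have hcf := hf.continuous
  have hη := K.continuous_η
  set E := ∫ z in ball x (ρ + s), ‖gradient f z‖ ^ 2 with hE
  have hb : ∀ {G : Eu n → ℝ}, ∫ y, G y * K.η y = ∫ y in ball (0 : Eu n) 1, G y * K.η y := by
    intro G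
    refine (setIntegral_eq_integral_of_forall_compl_eq_zero fun y hy => ?_).symm
    rw [mem_ball_zero_iff, not_lt] at hy
    rw [K.η_zero y hy, mul_zero]
  have pt : ∀ z, (f z - K.avg f z s) ^ 2 ≤
      ∫ y in ball (0 : Eu n) 1, (f (z + s • y) - f z) ^ 2 * K.η y := by
    intro z
    rw [← hb]
    have h1 := K.sq_integral_η_le (F := fun y => f (z + s • y) - f z) (by fun_prop)
    have e : ∫ y, (f (z + s • y) - f z) * K.η y = K.avg f z s - f z := by
      simp only [sub_mul, avg]
      rw [integral_sub (K.integrable_mul_η (continuous_comp hcf z s))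
        (K.integrable_mul_η continuous_const), integral_const_mul, K.integral_η, mul_one]
    rw [e] at h1
    rwa [← neg_sub (K.avg f z s), neg_sq]
  have hF : Continuous (Function.uncurry fun (z y : Eu n) =>
      (f (z + s • y) - f z) ^ 2 * K.η y) := by
    simp only [Function.uncurry_def]
    fun_prop
  obtain ⟨hi, hsw⟩ := setIntegral_integral_swap volume volume hF (isCompact_closedBall x ρ)
    (isCompact_closedBall (0 : Eu n) 1) ball_subset_closedBall ball_subset_closedBall
  calc ∫ z in ball x ρ, (f z - K.avg f z s) ^ 2
      ≤ ∫ z in ball x ρ, ∫ y in ball (0 : Eu n) 1, (f (z + s • y) - f z) ^ 2 * K.η y :=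
        integral_mono_of_nonneg (Filter.Eventually.of_forall fun _ => sq_nonneg _)
          hi.integral_prod_left (Filter.Eventually.of_forall pt)
    _ = ∫ y in ball (0 : Eu n) 1, ∫ z in ball x ρ, (f (z + s • y) - f z) ^ 2 * K.η y := hsw
    _ ≤ ∫ y in ball (0 : Eu n) 1, s ^ 2 * E * K.η y := by
        refine integral_mono_of_nonneg (Filter.Eventually.of_forall fun y =>
          integral_nonneg fun z => mul_nonneg (sq_nonneg _) (K.η_nonneg y))
          (Continuous.integrableOn_ball (by fun_prop)) ?_
        filter_upwards [ae_restrict_mem measurableSet_ball] with y hy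
        rw [integral_mul_const]
        refine mul_le_mul_of_nonneg_right (integral_sq_translate_sub_le hf x (s • y) ?_)
          (K.η_nonneg y)
        rw [mem_ball_zero_iff] at hy
        rw [norm_smul, Real.norm_of_nonneg hs]
        nlinarith
    _ = s ^ 2 * E := by
        rw [← hb (G := fun _ => s ^ 2 * E), integral_const_mul, K.integral_η, mul_one]

theorem integral_abs_comp_le {g : Eu n → ℝ} (hg : Continuous g) (x : Eu n) {t A : ℝ} (ht0 : 0 < t)
    (hA : 0 ≤ A) (hgA : ∫ z in ball x (2 * t), g z ^ 2 ≤ A ^ 2 * t ^ n) :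
    ∫ ζ in ball (0 : Eu n) 2, |g (x + t • ζ)| ≤ √(2 ^ n * ballVol n) * A := by
  have hV := ballVol_pos n
  have h1 := sq_setIntegral_ball_le (f := fun ζ => |g (x + t • ζ)|) (x := (0 : Eu n)) (r := 2)
    (by fun_prop) two_pos
  have h2 : ∫ ζ in ball (0 : Eu n) 2, |g (x + t • ζ)| ^ 2 ≤ A ^ 2 := by
    have e := integral_comp_add_smul
      ((ball x (2 * t)).indicator fun z => g z ^ 2) x ht0
    have e2 : (fun ζ => (ball x (2 * t)).indicator (fun z => g z ^ 2) (x + t • ζ)) =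
        (ball (0 : Eu n) 2).indicator fun ζ => |g (x + t • ζ)| ^ 2 := by
      ext ζ
      have : x + t • ζ ∈ ball x (2 * t) ↔ ζ ∈ ball (0 : Eu n) 2 := by
        rw [mem_ball, dist_eq_norm, add_sub_cancel_left, norm_smul, Real.norm_of_nonneg ht0.le,
          mem_ball_zero_iff, mul_comm, mul_lt_mul_iff_left₀ ht0]
      by_cases hζ : ζ ∈ ball (0 : Eu n) 2
      · rw [Set.indicator_of_mem (this.2 hζ), Set.indicator_of_mem hζ, sq_abs]
      · rw [Set.indicator_of_notMem (mt this.1 hζ), Set.indicator_of_notMem hζ]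
    rw [e2, integral_indicator measurableSet_ball, integral_indicator measurableSet_ball] at e
    rw [e, inv_mul_le_iff₀ (by positivity), mul_comm (t ^ n)]
    exact hgA
  have h3 := h1.trans (mul_le_mul_of_nonneg_left h2 (by positivity))
  refine (abs_le_of_sq_le_sq' (h3.trans_eq ?_) (by positivity)).2
  rw [mul_pow, Real.sq_sqrt (by positivity)]

theorem gradient_η_eq_zero {ζ : Eu n} (hζ : ζ ∉ ball (0 : Eu n) 2) : gradient K.η ζ = 0 := by
  refine gradient_eq_zero_of_notMem_tsupport fun h => hζ ?_
  have hss : tsupport K.η ⊆ closedBall 0 1 := by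
    refine closure_minimal (fun z hz => ?_) isClosed_closedBall
    by_contra h'
    rw [mem_closedBall_zero_iff, not_le] at h'
    exact hz (K.η_zero z h'.le)
  exact closedBall_subset_ball (by norm_num) (hss h)

/-- The first order Taylor expansion of an average with respect to its centre. -/
theorem abs_avg_sub_affine_le {g : Eu n → ℝ} (hg : Continuous g) (x : Eu n) {t A : ℝ}
    (hA : ∫ ζ in ball (0 : Eu n) 2, |g (x + t • ζ)| ≤ A) :
    ∃ b : Eu n, ‖b‖ ≤ K.C * A ∧ ∀ h : Eu n, ‖h‖ ≤ 1 →
      |K.avg g (x + t • h) t - (K.avg g x t + ⟪b, h⟫)| ≤ K.C * ‖h‖ ^ 2 * A := by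
  have hC := K.C_pos
  have hη1 : Continuous (gradient K.η) := K.contDiff_η.continuous_gradient (by norm_cast)
  have hη := K.continuous_η
  have hcη : HasCompactSupport (gradient K.η) := hasCompactSupport_gradient K.hasCompactSupport_η
  have ib : Integrable fun ζ => g (x + t • ζ) • gradient K.η ζ :=
    Continuous.integrable_of_hasCompactSupport (by fun_prop) <| HasCompactSupport.intro hcη
      fun ζ hζ => by rw [image_eq_zero_of_notMem_tsupport hζ, smul_zero]
  refine ⟨-∫ ζ, g (x + t • ζ) • gradient K.η ζ, ?_, fun h hh1 => ?_⟩
  · rw [norm_neg, ← setIntegral_eq_integral_of_forall_compl_eq_zero (s := ball (0 : Eu n) 2)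
      (fun ζ hζ => by rw [K.gradient_η_eq_zero hζ, smul_zero])]
    refine (norm_integral_le_integral_norm _).trans ?_
    refine le_trans ?_ (mul_le_mul_of_nonneg_left hA hC.le)
    rw [← integral_const_mul]
    refine setIntegral_ball_mono (by fun_prop) (by fun_prop) fun ζ _ => ?_
    rw [norm_smul, Real.norm_eq_abs, mul_comm]
    exact mul_le_mul_of_nonneg_right (K.norm_gradient_η_le ζ) (abs_nonneg _)
  · have e1 : ⟪-∫ ζ, g (x + t • ζ) • gradient K.η ζ, h⟫ =
        -∫ ζ, g (x + t • ζ) * ⟪gradient K.η ζ, h⟫ := by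
      rw [inner_neg_left, real_inner_comm, ← integral_inner ib]
      simp only [inner_smul_right, real_inner_comm]
    have i1 : Integrable fun ζ => g (x + t • ζ) * K.η (ζ - h) :=
      K.integrable_mul_η_sub (continuous_comp hg x t) h
    have i2 : Integrable fun ζ => g (x + t • ζ) * K.η ζ :=
      K.integrable_mul_η (continuous_comp hg x t)
    have i3 : Integrable fun ζ => g (x + t • ζ) * ⟪gradient K.η ζ, h⟫ :=
      Continuous.integrable_of_hasCompactSupport (by fun_prop) <| HasCompactSupport.intro hcη
        fun ζ hζ => by rw [image_eq_zero_of_notMem_tsupport hζ, inner_zero_left, mul_zero]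
    have i12 : Integrable fun ζ => g (x + t • ζ) * K.η (ζ - h) - g (x + t • ζ) * K.η ζ :=
      i1.sub i2
    have e3 : K.avg g (x + t • h) t - (K.avg g x t + ⟪-∫ ζ, g (x + t • ζ) • gradient K.η ζ, h⟫) =
        ∫ ζ, g (x + t • ζ) * (K.η (ζ - h) - K.η ζ - ⟪gradient K.η ζ, -h⟫) := by
      have : (fun ζ => g (x + t • ζ) * (K.η (ζ - h) - K.η ζ - ⟪gradient K.η ζ, -h⟫)) =
          fun ζ => g (x + t • ζ) * K.η (ζ - h) - g (x + t • ζ) * K.η ζ +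
            g (x + t • ζ) * ⟪gradient K.η ζ, h⟫ := by
        ext ζ
        rw [inner_neg_right]
        ring
      rw [this, integral_add i12 i3, integral_sub i1 i2, e1, avg_translate]
      simp only [avg]
      ring
    rw [e3, ← setIntegral_eq_integral_of_forall_compl_eq_zero (s := ball (0 : Eu n) 2)
      (fun ζ hζ => ?_), ← Real.norm_eq_abs]
    · refine (norm_integral_le_integral_norm _).trans ?_
      have hB : ∫ ζ in ball (0 : Eu n) 2,
          ‖g (x + t • ζ) * (K.η (ζ - h) - K.η ζ - ⟪gradient K.η ζ, -h⟫)‖ ≤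
          ∫ ζ in ball (0 : Eu n) 2, K.C * ‖h‖ ^ 2 * |g (x + t • ζ)| := by
        refine setIntegral_ball_mono (by fun_prop) (by fun_prop) fun ζ _ => ?_
        rw [norm_mul, Real.norm_eq_abs, Real.norm_eq_abs, mul_comm]
        refine mul_le_mul_of_nonneg_right ?_ (abs_nonneg _)
        have := K.η_taylor ζ (-h)
        rwa [norm_neg, ← sub_eq_add_neg] at this
      rw [integral_const_mul] at hB
      exact hB.trans (mul_le_mul_of_nonneg_left hA (by positivity))
    · rw [K.gradient_η_eq_zero hζ]
      rw [mem_ball_zero_iff, not_lt] at hζ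
      have h5 := norm_sub_norm_le ζ h
      rw [K.η_zero _ (by linarith), K.η_zero _ (by linarith)]
      simp

/-- Averages of a function with small mean square are close to an affine function. -/
theorem exists_affine_approx : ∃ C : ℝ, 1 ≤ C ∧ ∀ g : Eu n → ℝ, Continuous g →
    ∀ (x : Eu n) (r G : ℝ), 0 < r → 0 ≤ G → ∫ z in ball x r, g z ^ 2 ≤ G ^ 2 * r ^ (n + 2) →
      ∃ (c : ℝ) (p : Eu n), ‖p‖ ≤ C * G ∧ ∀ z ∈ ball x (r / 4),
        |K.avg g z (r / 4) - (c + ⟪p, z - x⟫)| ≤ C * G * (‖z - x‖ ^ 2 / r) := by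
  have hC := K.C_pos
  obtain ⟨D, hD⟩ : ∃ D : ℝ, D = √(2 ^ n * ballVol n) := ⟨_, rfl⟩
  have hD0 : 0 ≤ D := hD ▸ Real.sqrt_nonneg _
  refine ⟨1 + 16 * K.C * D * 2 ^ n, ?_, fun g hg x r G hr hG hgG => ?_⟩
  · have : 0 ≤ 16 * K.C * D * 2 ^ n := by positivity
    linarith
  obtain ⟨t, ht⟩ : ∃ t : ℝ, t = r / 4 := ⟨_, rfl⟩
  have hrt : r = 4 * t := by linarith
  have ht0 : 0 < t := by linarith
  rw [← ht]
  have h4 : (4 : ℝ) ^ n = (2 ^ n) ^ 2 := by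
    rw [← pow_mul, mul_comm, pow_mul]
    norm_num
  have hA := integral_abs_comp_le hg x ht0 (A := 2 ^ n * (G * r)) (by positivity) <|
    (setIntegral_ball_mono_set (f := fun z => g z ^ 2) (x' := x) (r' := r) (by fun_prop)
      (fun _ => sq_nonneg _) (ball_subset_ball (by linarith))).trans (hgG.trans_eq (by
        rw [mul_pow, ← h4, hrt, pow_add, mul_pow 4 t n]
        ring))
  rw [← hD] at hA
  obtain ⟨b, hb, hbh⟩ := K.abs_avg_sub_affine_le hg x hA
  have hG0 : 0 ≤ G * t := by positivity
  refine ⟨K.avg g x t, t⁻¹ • b, ?_, fun z hz => ?_⟩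
  · rw [norm_smul, norm_inv, Real.norm_of_nonneg ht0.le, inv_mul_le_iff₀ ht0]
    refine hb.trans ?_
    rw [hrt]
    have h6 : 0 ≤ K.C * D * 2 ^ n * (G * t) := by positivity
    clear * - h6 hG0
    linarith
  · rw [mem_ball, dist_eq_norm] at hz
    have hzx : x + t • (t⁻¹ • (z - x)) = z := by
      rw [smul_smul, mul_inv_cancel₀ ht0.ne', one_smul, add_sub_cancel]
    have hhn : ‖t⁻¹ • (z - x)‖ = ‖z - x‖ / t := by
      rw [norm_smul, norm_inv, Real.norm_of_nonneg ht0.le, ← div_eq_inv_mul]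
    have h7 := hbh (t⁻¹ • (z - x)) (by
      rw [hhn, div_le_one ht0]
      exact hz.le)
    rw [hzx, hhn, inner_smul_right] at h7
    rw [inner_smul_left]
    refine h7.trans ?_
    have e4 : K.C * (‖z - x‖ / t) ^ 2 * (D * (2 ^ n * (G * r))) =
        16 * K.C * D * 2 ^ n * G * (‖z - x‖ ^ 2 / r) := by
      rw [hrt]
      field_simp
      norm_num
    rw [e4]
    refine mul_le_mul_of_nonneg_right ?_ (by positivity)
    linarith

end RadialKernel

theorem hasGradientAt_affine {n : ℕ} (c : ℝ) (p x z : Eu n) :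
    HasGradientAt (fun y => c + ⟪p, y - x⟫) p z := by
  rw [hasGradientAt_iff_hasFDerivAt]
  exact (((InnerProductSpace.toDual ℝ (Eu n) p).hasFDerivAt.comp z
    ((hasFDerivAt_id z).sub_const x)).const_add c)

theorem contDiff_affine {n : ℕ} {k : WithTop ℕ∞} (c : ℝ) (p x : Eu n) :
    ContDiff ℝ k fun y => c + ⟪p, y - x⟫ :=
  contDiff_const.add (contDiff_const.inner ℝ (contDiff_id.sub contDiff_const))

theorem lap_affine {n : ℕ} (c : ℝ) (p x z : Eu n) : lap (fun y => c + ⟪p, y - x⟫) z = 0 := by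
  rw [lap_eq_sum_fderiv]
  have : fderiv ℝ (fun y => c + ⟪p, y - x⟫) = fun _ => InnerProductSpace.toDual ℝ (Eu n) p := by
    ext1 y
    exact (hasGradientAt_iff_hasFDerivAt.1 (hasGradientAt_affine c p x y)).fderiv
  simp [this]

theorem integral_inner_const_gradient {n : ℕ} (p : Eu n) {ψ : Eu n → ℝ} (hψ : ContDiff ℝ 1 ψ)
    (hc : HasCompactSupport ψ) : ∫ z, ⟪p, gradient ψ z⟫ = 0 := by
  have h := integral_inner_gradient_eq_neg (f := fun y => 0 + ⟪p, y - 0⟫) isOpen_univ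
    (contDiff_affine 0 p 0).contDiffOn hψ hc (Set.subset_univ _)
  simp only [lap_affine, (hasGradientAt_affine 0 p 0 _).gradient, zero_mul, integral_zero,
    neg_zero] at h
  exact h

theorem caccioppoli_pointwise {E : Type*} [NormedAddCommGroup E] [InnerProductSpace ℝ E]
    (q w : E) (ζ g : ℝ) :
    ζ ^ 2 * ‖q‖ ^ 2 ≤ 2 * ⟪q, (ζ ^ 2) • q + (2 * ζ * g) • w⟫ + 4 * (g ^ 2 * ‖w‖ ^ 2) := by
  rw [inner_add_right, inner_smul_right, inner_smul_right, real_inner_self_eq_norm_sq]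
  have h := sq_nonneg ‖ζ • q + (2 * g) • w‖
  rw [norm_add_sq_real, norm_smul, norm_smul, inner_smul_left, inner_smul_right, mul_pow, mul_pow,
    Real.norm_eq_abs, Real.norm_eq_abs, sq_abs, sq_abs] at h
  simp only [conj_trivial] at h
  linarith

theorem norm_sq_cutoff_gradient_le {E : Type*} [NormedAddCommGroup E] [InnerProductSpace ℝ E]
    (q w : E) {ζ g : ℝ} (h0 : 0 ≤ ζ) (h1 : ζ ≤ 1) :
    ‖(ζ ^ 2) • q + (2 * ζ * g) • w‖ ^ 2 ≤ 2 * (ζ ^ 2 * ‖q‖ ^ 2) + 8 * (g ^ 2 * ‖w‖ ^ 2) := by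
  have h := norm_add_sq_le_two ((ζ ^ 2) • q) ((2 * ζ * g) • w)
  rw [norm_smul, norm_smul, mul_pow, mul_pow, Real.norm_eq_abs, Real.norm_eq_abs, sq_abs,
    sq_abs] at h
  have h2 : ζ ^ 2 ≤ 1 := pow_le_one₀ h0 h1
  have h3 : 0 ≤ ζ ^ 2 * ‖q‖ ^ 2 := by positivity
  have h4 : 0 ≤ g ^ 2 * ‖w‖ ^ 2 := by positivity
  have h5 := mul_le_mul_of_nonneg_right h2 h3
  have h6 := mul_le_mul_of_nonneg_right h2 h4
  calc _ ≤ _ := h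
    _ ≤ _ := by linarith

set_option maxHeartbeats 800000 in
/-- The Caccioppoli inequality for almost harmonic functions. -/
theorem exists_almostHarmonic_caccioppoli (n : ℕ) : ∃ C : ℝ, 1 ≤ C ∧ ∀ f : Eu n → ℝ,
    ContDiff ℝ (⊤ : ℕ∞) f → ∀ (x : Eu n) (r ρ Δ c : ℝ) (p : Eu n), 0 < ρ → 2 * ρ < r → 0 ≤ Δ →
      AlmostHarmonicOn f x r Δ → ∫ z in ball x ρ, ‖gradient f z - p‖ ^ 2 ≤
        C * (ρ⁻¹ ^ 2 * ∫ z in ball x (2 * ρ), (f z - (c + ⟪p, z - x⟫)) ^ 2) + 8 * Δ := by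
  obtain ⟨C, hC, hcut⟩ := exists_cutoff n
  refine ⟨12 * C ^ 2, by nlinarith, fun f hf x r ρ Δ c p hρ hr hΔ h => ?_⟩
  obtain ⟨ζ, hζ, hζc, hζ0, hζ1, hζR, hζ2, hζg, hζC, -⟩ := hcut x ρ hρ
  obtain ⟨g, hgdef⟩ : ∃ g : Eu n → ℝ, g = fun z => f z - (c + ⟪p, z - x⟫) := ⟨_, rfl⟩
  have hg : ContDiff ℝ (⊤ : ℕ∞) g := by
    rw [hgdef]
    exact hf.sub (contDiff_affine c p x)
  have hgg : ∀ z, HasGradientAt g (gradient f z - p) z := fun z => by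
    rw [hgdef]
    exact (hf.hasGradientAt (by simp) z).sub_fun (hasGradientAt_affine c p x z)
  have hcg := hg.continuous
  have hcζ := hζ.continuous
  have hgf : Continuous (gradient f) := hf.continuous_gradient (by norm_cast)
  have hgζ : Continuous (gradient ζ) := hζ.continuous_gradient (by norm_cast)
  have hψ : ContDiff ℝ (⊤ : ℕ∞) fun z => ζ z * (ζ z * g z) := hζ.mul (hζ.mul hg)
  have hψc : HasCompactSupport fun z => ζ z * (ζ z * g z) := hζc.mul_right
  have eψ : ∀ z, gradient (fun z => ζ z * (ζ z * g z)) z =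
      (ζ z ^ 2) • (gradient f z - p) + (2 * ζ z * g z) • gradient ζ z := by
    intro z
    have hz := hζ.hasGradientAt (by simp) z
    rw [(hz.mul_fun (hz.mul_fun (hgg z))).gradient]
    module
  have hts : tsupport (fun z => ζ z * (ζ z * g z)) ⊆ ball x r := by
    refine subset_trans (closure_minimal (t := closedBall x (2 * ρ)) (fun z hz => ?_)
      isClosed_closedBall) (closedBall_subset_ball hr)
    by_contra h'
    exact hz (by simp [hζ2 z (mt (fun h => ball_subset_closedBall h) h')])
  have hI := h _ hψ hψc hts
  have h0 := integral_inner_const_gradient p hψ.one_of_top hψc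
  simp only [eψ] at hI h0
  have cs : ∀ {G : Eu n → ℝ}, Continuous G → (∀ z, ζ z = 0 → gradient ζ z = 0 → G z = 0) →
      Integrable G := fun hG h0 => hG.integrable_of_hasCompactSupport <|
    HasCompactSupport.intro hζc fun z hz => h0 z (image_eq_zero_of_notMem_tsupport hz)
      (gradient_eq_zero_of_notMem_tsupport hz)
  have i1 : Integrable fun z => ⟪gradient f z,
      (ζ z ^ 2) • (gradient f z - p) + (2 * ζ z * g z) • gradient ζ z⟫ :=
    cs (by fun_prop) fun z h1 h2 => by simp [h1]
  have i2 : Integrable fun z => ⟪p,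
      (ζ z ^ 2) • (gradient f z - p) + (2 * ζ z * g z) • gradient ζ z⟫ :=
    cs (by fun_prop) fun z h1 h2 => by simp [h1]
  have iX : Integrable fun z => ζ z ^ 2 * ‖gradient f z - p‖ ^ 2 :=
    cs (by fun_prop) fun z h1 h2 => by simp [h1]
  have iY : Integrable fun z => g z ^ 2 * ‖gradient ζ z‖ ^ 2 :=
    cs (by fun_prop) fun z h1 h2 => by simp [h2]
  have iN : Integrable fun z =>
      ‖(ζ z ^ 2) • (gradient f z - p) + (2 * ζ z * g z) • gradient ζ z‖ ^ 2 :=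
    cs (by fun_prop) fun z h1 h2 => by simp [h1]
  have eI : ∫ z, ⟪gradient f z - p,
      (ζ z ^ 2) • (gradient f z - p) + (2 * ζ z * g z) • gradient ζ z⟫ =
      ∫ z, ⟪gradient f z,
        (ζ z ^ 2) • (gradient f z - p) + (2 * ζ z * g z) • gradient ζ z⟫ := by
    simp_rw [inner_sub_left (gradient f _) p]
    rw [integral_sub i1 i2, h0, sub_zero]
  have iI : Integrable fun z => ⟪gradient f z - p,
      (ζ z ^ 2) • (gradient f z - p) + (2 * ζ z * g z) • gradient ζ z⟫ :=
    cs (by fun_prop) fun z h1 h2 => by simp [h1]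
  rw [← eI] at hI
  have hX : ∫ z, ζ z ^ 2 * ‖gradient f z - p‖ ^ 2 ≤ 2 * (∫ z, ⟪gradient f z - p,
      (ζ z ^ 2) • (gradient f z - p) + (2 * ζ z * g z) • gradient ζ z⟫) +
      4 * ∫ z, g z ^ 2 * ‖gradient ζ z‖ ^ 2 := by
    rw [← integral_const_mul, ← integral_const_mul,
      ← integral_add (iI.const_mul 2) (iY.const_mul 4)]
    exact integral_mono iX ((iI.const_mul 2).add (iY.const_mul 4))
      fun z => caccioppoli_pointwise _ _ _ _
  have hN : ∫ z, ‖(ζ z ^ 2) • (gradient f z - p) + (2 * ζ z * g z) • gradient ζ z‖ ^ 2 ≤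
      2 * (∫ z, ζ z ^ 2 * ‖gradient f z - p‖ ^ 2) +
      8 * ∫ z, g z ^ 2 * ‖gradient ζ z‖ ^ 2 := by
    rw [← integral_const_mul, ← integral_const_mul,
      ← integral_add (iX.const_mul 2) (iY.const_mul 8)]
    exact integral_mono iN ((iX.const_mul 2).add (iY.const_mul 8))
      fun z => norm_sq_cutoff_gradient_le _ _ (hζ0 z) (hζ1 z)
  have hY : ∫ z, g z ^ 2 * ‖gradient ζ z‖ ^ 2 ≤
      ∫ z in ball x (2 * ρ), (C / ρ) ^ 2 * g z ^ 2 := by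
    refine integral_le_setIntegral_ball (by fun_prop) (by fun_prop) (fun z hz => ?_)
      fun z hz => ?_
    · simp [hζg z hz]
    · rw [mul_comm]
      exact mul_le_mul_of_nonneg_right (pow_le_pow_left₀ (norm_nonneg _) (hζC z) 2) (sq_nonneg _)
  rw [integral_const_mul] at hY
  have hL : ∫ z in ball x ρ, ‖gradient f z - p‖ ^ 2 ≤ ∫ z, ζ z ^ 2 * ‖gradient f z - p‖ ^ 2 := by
    refine setIntegral_ball_le_integral (by fun_prop) (by fun_prop) (HasCompactSupport.intro hζc
      fun z hz => by simp [image_eq_zero_of_notMem_tsupport hz]) (fun z => by positivity)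
      fun z hz => by simp [hζR z hz]
  have eg : ∫ z in ball x (2 * ρ), (f z - (c + ⟪p, z - x⟫)) ^ 2 =
      ∫ z in ball x (2 * ρ), g z ^ 2 := by rw [hgdef]
  rw [eg]
  generalize (∫ z, ζ z ^ 2 * ‖gradient f z - p‖ ^ 2) = X at *
  generalize (∫ z, g z ^ 2 * ‖gradient ζ z‖ ^ 2) = Y at *
  generalize (∫ z, ⟪gradient f z - p,
      (ζ z ^ 2) • (gradient f z - p) + (2 * ζ z * g z) • gradient ζ z⟫) = I at *
  have hI2 : I ^ 2 ≤ (2 * Δ + (2 * X + 8 * Y) / 8) ^ 2 := by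
    have h9 := mul_le_mul_of_nonneg_left hN hΔ
    have := sq_nonneg (2 * Δ - (2 * X + 8 * Y) / 8)
    clear * - h9 this hI
    nlinarith
  have hXY : 0 ≤ 2 * X + 8 * Y := le_trans (integral_nonneg fun _ => by positivity) hN
  have hI3 := (abs_le_of_sq_le_sq' hI2 (by positivity)).2
  have : ∫ z in ball x ρ, ‖gradient f z - p‖ ^ 2 ≤ 12 * Y + 8 * Δ := by linarith
  refine this.trans ?_
  have e5 : 12 * C ^ 2 * (ρ⁻¹ ^ 2 * ∫ z in ball x (2 * ρ), g z ^ 2) =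
      12 * ((C / ρ) ^ 2 * ∫ z in ball x (2 * ρ), g z ^ 2) := by
    rw [div_pow, inv_pow]
    ring
  rw [e5]
  linarith

theorem RadialKernel.continuous_avg_center {n : ℕ} (K : RadialKernel n) {f : Eu n → ℝ}
    (hf : Continuous f) (s : ℝ) : Continuous fun z => K.avg f z s := by
  have hη := K.continuous_η
  have hF : Continuous (Function.uncurry fun z y : Eu n => f (z + s • y) * K.η y) := by
    simp only [Function.uncurry_def]
    fun_prop
  have := continuous_parametric_integral_of_continuous (μ := volume) hF
    (isCompact_closedBall (0 : Eu n) 1)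
  refine this.congr fun z => setIntegral_eq_integral_of_forall_compl_eq_zero fun y hy => ?_
  rw [mem_closedBall_zero_iff, not_le] at hy
  rw [K.η_zero y hy.le, mul_zero]

set_option maxHeartbeats 800000 in
/-- Almost harmonic functions are approximated by affine functions at smaller scales. -/
theorem exists_almostHarmonic_affine (n : ℕ) : ∃ C : ℝ, 1 ≤ C ∧ ∀ f : Eu n → ℝ,
    ContDiff ℝ (⊤ : ℕ∞) f → ∀ (x : Eu n) (r Δ E G s θ c : ℝ) (p : Eu n), 0 < r → 0 ≤ Δ → 0 ≤ G →
      0 < s → s ≤ r / 4 → 0 < θ → θ ≤ 1 / 8 → AlmostHarmonicOn f x r Δ →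
      ∫ z in ball x r, (f z - (c + ⟪p, z - x⟫)) ^ 2 ≤ G ^ 2 * r ^ (n + 2) →
      ∫ z in ball x r, ‖gradient f z‖ ^ 2 ≤ E →
      ∃ (c' : ℝ) (p' : Eu n), ‖p' - p‖ ≤ C * G ∧
        ∫ z in ball x (θ * r), (f z - (c' + ⟪p', z - x⟫)) ^ 2 ≤
          C * (G ^ 2 * θ ^ 4 * r ^ 2 * (θ * r) ^ n + s ^ 2 * E + Δ * r ^ (n + 2) / s ^ n) := by
  obtain ⟨K⟩ := RadialKernel.instNonempty n
  obtain ⟨C, hC, happ⟩ := K.exists_affine_approx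
  have hV := ballVol_pos n
  have hK := K.C_pos
  obtain ⟨B, hB⟩ : ∃ B, B = 3 * C ^ 2 * ballVol n + 3 * (K.C ^ 2 * ballVol n) * ballVol n :=
    ⟨_, rfl⟩
  have hB1 : 3 * C ^ 2 * ballVol n ≤ B := by
    rw [hB]
    exact le_add_of_nonneg_right (by positivity)
  have hB2 : 3 * (K.C ^ 2 * ballVol n) * ballVol n ≤ B := by
    rw [hB]
    exact le_add_of_nonneg_left (by positivity)
  have hB0 : 0 ≤ B := le_trans (by positivity) hB1
  refine ⟨C + 3 + B, by linarith, fun f hf x r Δ E G s θ c p hr hΔ hG hs hsr hθ hθ8 h hg hE => ?_⟩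
  have hcf := hf.continuous
  have hl : ∀ (c : ℝ) (p : Eu n), Continuous fun z => c + ⟪p, z - x⟫ := fun c p => by fun_prop
  have hgf : Continuous (gradient f) := hf.continuous_gradient (by norm_cast)
  obtain ⟨c₁, p₁, hp₁, h₁⟩ := happ (fun z => f z - (c + ⟪p, z - x⟫)) (hcf.sub (hl c p)) x r G hr hG
    hg
  obtain ⟨t, ht⟩ : ∃ t, t = r / 4 := ⟨_, rfl⟩
  rw [← ht] at h₁ hsr
  have hav := K.continuous_avg_center hcf s
  have hθr : θ * r ≤ r / 8 := by
    calc θ * r ≤ 1 / 8 * r := by gcongr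
      _ = r / 8 := by ring
  have hθr0 : 0 < θ * r := by positivity
  refine ⟨c + c₁, p + p₁, ?_, ?_⟩
  · rw [add_sub_cancel_left]
    refine hp₁.trans (mul_le_mul_of_nonneg_right ?_ hG)
    linarith
  obtain ⟨a, ha⟩ : ∃ a, a = K.C ^ 2 * ballVol n * Δ * t ^ 2 / s ^ n := ⟨_, rfl⟩
  obtain ⟨b, hb⟩ : ∃ b, b = C * G * ((θ * r) ^ 2 / r) := ⟨_, rfl⟩
  have pt : ∀ z ∈ ball x (θ * r), (f z - (c + c₁ + ⟪p + p₁, z - x⟫)) ^ 2 ≤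
      3 * (f z - K.avg f z s) ^ 2 + (3 * a + 3 * b ^ 2) := by
    intro z hz
    rw [mem_ball, dist_eq_norm] at hz
    have h2 := K.sq_avg_sub_avg_le (z := z) hf.one_of_top hΔ h hs hsr (by
      intro y hy
      rw [mem_closedBall] at hy
      rw [mem_ball]
      have := dist_triangle y z x
      rw [dist_eq_norm z x] at this
      linarith)
    rw [← ha] at h2
    have h3 := h₁ z (by rw [mem_ball, dist_eq_norm]; linarith)
    rw [K.avg_sub hcf (hl c p), K.avg_affine] at h3
    have h4 : |K.avg f z t - (c + ⟪p, z - x⟫) - (c₁ + ⟪p₁, z - x⟫)| ≤ b := by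
      refine h3.trans ?_
      rw [hb]
      gcongr
    have h5 := sq_le_sq' (neg_le_of_abs_le h4) (le_of_abs_le h4)
    rw [inner_add_left]
    clear * - h2 h5
    generalize K.avg f z t = A₁ at *
    generalize K.avg f z s = A₂ at *
    generalize ⟪p, z - x⟫ = P at *
    generalize ⟪p₁, z - x⟫ = P₁ at *
    have e : ∀ α β γ : ℝ, (α + β + γ) ^ 2 ≤ 3 * α ^ 2 + 3 * β ^ 2 + 3 * γ ^ 2 := fun α β γ => by
      linarith [sq_nonneg (α - β), sq_nonneg (β - γ), sq_nonneg (α - γ)]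
    have := e (f z - A₂) (-(A₁ - A₂)) (A₁ - (c + P) - (c₁ + P₁))
    rw [show f z - A₂ + -(A₁ - A₂) + (A₁ - (c + P) - (c₁ + P₁)) = f z - (c + c₁ + (P + P₁)) by ring,
      neg_sq] at this
    linarith
  have hmean : ∫ z in ball x (θ * r), (f z - (c + c₁ + ⟪p + p₁, z - x⟫)) ^ 2 ≤
      ∫ z in ball x (θ * r), (3 * (f z - K.avg f z s) ^ 2 + (3 * a + 3 * b ^ 2)) :=
    setIntegral_ball_mono (by fun_prop) (by fun_prop) pt
  rw [integral_add (Continuous.integrableOn_ball (by fun_prop))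
    (Continuous.integrableOn_ball (by fun_prop)), integral_const_mul,
    setIntegral_ball_const _ hθr0] at hmean
  have h6 := (K.integral_sq_sub_avg_le hf.one_of_top x (ρ := θ * r) hs.le).trans
    (mul_le_mul_of_nonneg_left ((setIntegral_ball_mono_set (x' := x) (r' := r) (by fun_prop)
      (fun z => sq_nonneg ‖gradient f z‖) (ball_subset_ball (by linarith))).trans hE)
      (sq_nonneg s))
  refine hmean.trans ?_
  have hE0 : 0 ≤ E := le_trans (integral_nonneg fun _ => by positivity) hE
  have h7 : 3 * a * ((θ * r) ^ n * ballVol n) ≤ B * (Δ * r ^ (n + 2) / s ^ n) := by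
    rw [ha]
    calc _ = 3 * (K.C ^ 2 * ballVol n) * ballVol n * (Δ * ((θ * r) ^ n * t ^ 2) / s ^ n) := by ring
      _ ≤ B * (Δ * (r ^ n * r ^ 2) / s ^ n) := by
        gcongr
        all_goals linarith
      _ = _ := by rw [pow_add]
  have h8 : 3 * b ^ 2 * ((θ * r) ^ n * ballVol n) ≤ B * (G ^ 2 * θ ^ 4 * r ^ 2 * (θ * r) ^ n) := by
    rw [hb]
    calc _ = 3 * C ^ 2 * ballVol n * (G ^ 2 * θ ^ 4 * r ^ 2 * (θ * r) ^ n) := by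
          field_simp
      _ ≤ _ := by gcongr
  have h9 : 0 ≤ G ^ 2 * θ ^ 4 * r ^ 2 * (θ * r) ^ n := by positivity
  have h10 : 0 ≤ s ^ 2 * E := by positivity
  have h11 : 0 ≤ Δ * r ^ (n + 2) / s ^ n := by positivity
  generalize G ^ 2 * θ ^ 4 * r ^ 2 * (θ * r) ^ n = X₁ at *
  generalize s ^ 2 * E = X₂ at *
  generalize Δ * r ^ (n + 2) / s ^ n = X₃ at *
  have h12 : 0 ≤ C * X₁ := by positivity
  have h13 : 0 ≤ C * X₂ := by positivity
  have h14 : 0 ≤ C * X₃ := by positivity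
  have h15 : 0 ≤ B * X₂ := by positivity
  linarith

theorem IsSolution.contDiff_sub {n : ℕ} {u v : Eu n → ℝ} (h : IsSolution u v) :
    ContDiff ℝ (⊤ : ℕ∞) fun z => u z - v z := h.smooth.sub h.smooth_right

theorem IsSolution.gradient_sub {n : ℕ} {u v : Eu n → ℝ} (h : IsSolution u v) (z : Eu n) :
    gradient (fun z => u z - v z) z = gradient u z - gradient v z :=
  ((h.smooth.hasGradientAt (by simp) z).sub_fun
    (h.smooth_right.hasGradientAt (by simp) z)).gradient

theorem IsSolution.continuous_energyDensity {n : ℕ} {u v : Eu n → ℝ} (h : IsSolution u v) :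
    Continuous fun z => ‖gradient u z‖ ^ 2 + ‖gradient v z‖ ^ 2 + u z ^ 2 * v z ^ 2 := by
  have hcu := h.smooth.continuous
  have hcv := h.smooth_right.continuous
  have hgu : Continuous (gradient u) := h.smooth.continuous_gradient (by norm_cast)
  have hgv : Continuous (gradient v) := h.smooth_right.continuous_gradient (by norm_cast)
  fun_prop

set_option maxHeartbeats 800000 in
/-- At a scale where `u - v` is comparable to an affine function, it is almost harmonic with a
small error and the interaction of the two components is small. -/
theorem exists_smallness (n : ℕ) : ∃ γ : ℝ, 0 < γ ∧ ∀ K : ℝ, 1 ≤ K → ∃ M : ℝ, 64 ≤ M ∧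
    ∀ u v : Eu n → ℝ, IsSolution u v → IsLocalMinimizer u v →
    ∀ (x : Eu n) (R c : ℝ) (p : Eu n), 1 ≤ R → M * R ^ (-γ) ≤ 1 → ‖p‖ ≤ K →
      ∫ z in ball x R, (u z - v z - (c + ⟪p, z - x⟫)) ^ 2 ≤ K ^ 2 * R ^ (n + 2) →
      ∫ z in ball x R, (‖gradient u z‖ ^ 2 + ‖gradient v z‖ ^ 2 + u z ^ 2 * v z ^ 2) ≤
        K ^ 2 * R ^ n →
      ∃ k Δ : ℝ, 0 < k ∧ 0 ≤ Δ ∧ Δ ≤ M * R ^ n * (R ^ (-γ)) ^ (n + 2) ∧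
        (∀ z ∈ ball x (R / 16), u z ≤ k ∨ v z ≤ k) ∧
        AlmostHarmonicOn (fun z => u z - v z) x (R / 16) Δ ∧
        ∫ z in ball x (R / 16), trunc k u v z ≤ M * R ^ n * R ^ (-γ) ∧
        ∫ z in ball x (R / 16), trunc k v u z ≤ M * R ^ n * R ^ (-γ) := by
  obtain ⟨β, C, hβ, hβ2, hC, hmin⟩ := exists_min_bound n
  obtain ⟨Cd, hCd, hdef⟩ := exists_deficit_bound n
  obtain ⟨Ct, hCt, htr⟩ := exists_trunc_energy_bound n
  refine ⟨β / (8 * (n + 1)), by positivity, fun K hK => ⟨64 * C * K ^ 3 * (Cd + Ct), ?_, ?_⟩⟩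
  · have h1 : 1 ≤ C * K ^ 3 := one_le_mul_of_one_le_of_one_le hC (one_le_pow₀ hK)
    have h2 : 1 ≤ C * K ^ 3 * (Cd + Ct) := one_le_mul_of_one_le_of_one_le h1 (by linarith)
    linarith
  intro u v h hm x R c p hR hMR hp hw hE
  have hR0 : 0 < R := by linarith
  have hgu : Continuous (gradient u) := h.smooth.continuous_gradient (by norm_cast)
  have hgv : Continuous (gradient v) := h.smooth_right.continuous_gradient (by norm_cast)
  have hcu := h.smooth.continuous
  have hcv := h.smooth_right.continuous
  obtain ⟨q, hq⟩ : ∃ q, q = R ^ (-(β / (8 * ((n : ℝ) + 1)))) := ⟨_, rfl⟩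
  have hq0 : 0 < q := hq ▸ Real.rpow_pos_of_pos hR0 _
  have hRq : R ^ (1 - β) = R * q ^ (8 * (n + 1)) := by
    rw [hq, ← Real.rpow_natCast, ← Real.rpow_mul hR0.le, sub_eq_add_neg, Real.rpow_add hR0,
      Real.rpow_one]
    congr 2
    push_cast
    field_simp
  rw [← hq] at hMR ⊢
  obtain ⟨k, hk⟩ : ∃ k, k = C * K * R ^ (1 - β) := ⟨_, rfl⟩
  have hmb := hmin u v h x R K c p hR hK hp hw
    ((setIntegral_ball_mono (by fun_prop) h.continuous_energyDensity fun z _ =>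
      le_add_of_nonneg_left (by positivity)).trans hE)
  rw [← hk] at hmb
  have hCK : 1 ≤ C * K := one_le_mul_of_one_le_of_one_le hC hK
  have hk1 : 1 ≤ k := by
    rw [hk]
    exact one_le_mul_of_one_le_of_one_le hCK (Real.one_le_rpow hR (by linarith))
  obtain ⟨r, hr⟩ : ∃ r, r = R / 16 := ⟨_, rfl⟩
  have hRr : R = 16 * r := by linarith
  have hr0 : 0 < r := by linarith
  have hq1 : 16 * (C * K) * q ≤ 1 := by
    refine le_trans ?_ hMR
    refine mul_le_mul_of_nonneg_right ?_ hq0.le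
    have h3 : 1 ≤ K ^ 2 * (Cd + Ct) := one_le_mul_of_one_le_of_one_le (one_le_pow₀ hK) (by linarith)
    calc 16 * (C * K) ≤ 16 * (C * K) * (K ^ 2 * (Cd + Ct)) :=
          le_mul_of_one_le_right (by positivity) h3
      _ ≤ 64 * (C * K) * (K ^ 2 * (Cd + Ct)) := by gcongr; norm_num
      _ = _ := by ring
  have hq1' : q ≤ 1 := by
    refine le_trans ?_ hq1
    exact le_mul_of_one_le_left hq0.le (by linarith)
  have hkr : k / r = 16 * (C * K) * q ^ (8 * (n + 1)) := by
    rw [hk, hRq, hRr]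
    field_simp
  have hkr1 : k / r ≤ 16 * (C * K) * q := by
    rw [hkr]
    refine mul_le_mul_of_nonneg_left ?_ (by positivity)
    exact pow_le_of_le_one hq0.le hq1' (by omega)
  have hkler : k ≤ r := by
    have := hkr1.trans hq1
    rwa [div_le_one hr0] at this
  have hsqrt : √(k / r) ≤ 16 * (C * K) * q ^ (n + 2) := by
    refine Real.sqrt_le_iff.2 ⟨by positivity, ?_⟩
    rw [hkr, mul_pow, ← pow_mul]
    refine mul_le_mul (le_self_pow₀ (by linarith) two_ne_zero) ?_ (by positivity) (by positivity)
    exact pow_le_pow_of_le_one hq0.le hq1' (by omega)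
  have h16 : (16 : ℝ) ^ n = (4 ^ n) ^ 2 := by
    rw [← pow_mul, mul_comm, pow_mul]
    norm_num
  have hRn : K ^ 2 * R ^ n = (4 ^ n * K) ^ 2 * r ^ n := by
    rw [hRr, mul_pow, h16]
    ring
  have hK4 : 1 ≤ 4 ^ n * K := one_le_mul_of_one_le_of_one_le (one_le_pow₀ (by norm_num)) hK
  have hE' : ∀ ρ ≤ R, ∫ z in ball x ρ, (‖gradient u z‖ ^ 2 + ‖gradient v z‖ ^ 2) ≤
      (4 ^ n * K) ^ 2 * r ^ n := by
    intro ρ hρ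
    rw [← hRn]
    refine le_trans ?_ hE
    refine (setIntegral_ball_mono_set (by fun_prop) (fun z => by positivity)
      (ball_subset_ball hρ)).trans ?_
    refine setIntegral_ball_mono (by fun_prop) h.continuous_energyDensity fun z _ => ?_
    exact le_add_of_nonneg_right (by positivity)
  have hMK : ∀ D : ℝ, 0 ≤ D → D ≤ Cd + Ct → ∀ Q : ℝ, 0 ≤ Q →
      D * (4 ^ n * K) ^ 2 * r ^ n * (16 * (C * K) * Q) ≤
        64 * C * K ^ 3 * (Cd + Ct) * R ^ n * Q := by
    intro D hD0 hD Q hQ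
    calc _ = D * ((4 ^ n * K) ^ 2 * r ^ n) * (16 * (C * K) * Q) := by ring
      _ = 16 * C * K ^ 3 * D * R ^ n * Q := by rw [← hRn]; ring
      _ ≤ _ := by gcongr; norm_num
  have htt : ∀ u v : Eu n → ℝ, IsSolution u v →
      ∫ z in ball x (2 * r), (‖gradient u z‖ ^ 2 + ‖gradient v z‖ ^ 2) ≤ (4 ^ n * K) ^ 2 * r ^ n →
      ∫ z in ball x r, trunc k u v z ≤ 64 * C * K ^ 3 * (Cd + Ct) * R ^ n * q := by
    intro u v h h1
    refine (htr u v h x r k _ hr0 (by linarith) hK4 h1).trans ?_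
    refine le_trans ?_ (hMK Ct (by linarith) (by linarith) q hq0.le)
    gcongr
  refine ⟨k, Cd * (4 ^ n * K) ^ 2 * r ^ n * √(k / r), by linarith, by positivity, ?_, ?_, ?_, ?_,
    ?_⟩
  · refine le_trans ?_ (hMK Cd (by linarith) (by linarith) _ (by positivity))
    gcongr
  · exact fun z hz => hmb z (ball_subset_ball (by linarith) hz)
  · rw [← hr]
    exact hdef u v h hm x r k _ hk1 hkler hK4
      (fun z hz => hmb z (ball_subset_ball (by linarith) hz)) (hE' _ (by linarith))
  · rw [← hr]
    exact htt u v h (hE' _ (by linarith))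
  · rw [← hr]
    refine htt v u h.symm ?_
    simp_rw [add_comm (‖gradient v _‖ ^ 2)]
    exact hE' _ (by linarith)

theorem IsSolution.energyDensity_le {n : ℕ} {u v : Eu n → ℝ} (h : IsSolution u v) {k : ℝ}
    (hk : 0 < k) {z : Eu n} (hz : u z ≤ k ∨ v z ≤ k) :
    ‖gradient u z‖ ^ 2 + ‖gradient v z‖ ^ 2 + u z ^ 2 * v z ^ 2 ≤
      2 * ‖gradient (fun z => u z - v z) z‖ ^ 2 + 18 * (trunc k u v z + trunc k v u z) := by
  have h1 := h.trunc_nonneg hk z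
  have h2 := h.symm.trunc_nonneg hk z
  have h3 := neg_two_inner_le (a := gradient u z) (b := -gradient v z)
    (T := trunc k u v z + trunc k v u z) (l := 1 / 2) (by norm_num) (by
      rcases hz with hz | hz
      · left
        linarith [h.norm_gradient_sq_le_trunc hz]
      · right
        rw [norm_neg]
        linarith [h.symm.norm_gradient_sq_le_trunc hz])
  have h4 : u z ^ 2 * v z ^ 2 ≤ 2 * (trunc k u v z + trunc k v u z) := by
    rcases hz with hz | hz
    · linarith [h.sq_mul_sq_le_trunc hz]
    · linarith [h.symm.sq_mul_sq_le_trunc hz, mul_comm (u z ^ 2) (v z ^ 2)]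
  rw [norm_neg, inner_neg_right, show (1 / 2 : ℝ)⁻¹ = 2 by norm_num] at h3
  rw [h.gradient_sub, norm_sub_sq_real]
  linarith

theorem IsSolution.setIntegral_energyDensity_le {n : ℕ} {u v : Eu n → ℝ} (h : IsSolution u v)
    {k r ρ τ τ' S : ℝ} {x p : Eu n} (hk : 0 < k) (hρ : 0 < ρ) (hρr : ρ ≤ r)
    (hz : ∀ z ∈ ball x r, u z ≤ k ∨ v z ≤ k)
    (h1 : ∫ z in ball x r, trunc k u v z ≤ τ) (h2 : ∫ z in ball x r, trunc k v u z ≤ τ')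
    (h3 : ∫ z in ball x ρ, ‖gradient (fun z => u z - v z) z - p‖ ^ 2 ≤ S) :
    ∫ z in ball x ρ, (‖gradient u z‖ ^ 2 + ‖gradient v z‖ ^ 2 + u z ^ 2 * v z ^ 2) ≤
      4 * S + 4 * ‖p‖ ^ 2 * (ρ ^ n * ballVol n) + 18 * (τ + τ') := by
  have hg : Continuous (gradient fun z => u z - v z) :=
    h.contDiff_sub.continuous_gradient (by norm_cast)
  have c1 := h.continuous_trunc hk
  have c2 := h.symm.continuous_trunc hk
  have hsub : ball x ρ ⊆ ball x r := ball_subset_ball hρr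
  have t1 := (setIntegral_ball_mono_set (x' := x) (r' := r) c1 (h.trunc_nonneg hk) hsub).trans h1
  have t2 := (setIntegral_ball_mono_set (x' := x) (r' := r) c2 (h.symm.trunc_nonneg hk)
    hsub).trans h2
  have e1 : ∫ z in ball x ρ, (‖gradient u z‖ ^ 2 + ‖gradient v z‖ ^ 2 + u z ^ 2 * v z ^ 2) ≤
      ∫ z in ball x ρ, (4 * ‖gradient (fun z => u z - v z) z - p‖ ^ 2 + 4 * ‖p‖ ^ 2 +
        18 * (trunc k u v z + trunc k v u z)) := by
    refine setIntegral_ball_mono h.continuous_energyDensity (by fun_prop) fun z hzρ => ?_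
    have := norm_add_sq_le_two (gradient (fun z => u z - v z) z - p) p
    rw [sub_add_cancel] at this
    linarith [h.energyDensity_le hk (hz z (hsub hzρ))]
  refine e1.trans ?_
  rw [integral_add (Continuous.integrableOn_ball (by fun_prop))
    (Continuous.integrableOn_ball (by fun_prop)),
    integral_add (Continuous.integrableOn_ball (by fun_prop))
    (Continuous.integrableOn_ball (by fun_prop)), integral_const_mul, integral_const_mul,
    integral_const_mul, integral_add c1.integrableOn_ball c2.integrableOn_ball,
    setIntegral_ball_const _ hρ]
  linarith

set_option maxHeartbeats 1600000 in
/-- One step of the improvement of flatness: the affine approximation of `u - v` at scale `R`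
is improved at scale `θ * R`, up to an error which is summable along a geometric sequence of
scales, and the energy bound is propagated. -/
theorem exists_flatness_step (n : ℕ) : ∃ γ θ A B : ℝ, 0 < γ ∧ 0 < θ ∧ θ < 1 ∧ 1 ≤ A ∧ 1 ≤ B ∧
    ∀ K : ℝ, 1 ≤ K → ∃ M : ℝ, 1 ≤ M ∧
    ∀ u v : Eu n → ℝ, IsSolution u v → IsLocalMinimizer u v →
    ∀ (x : Eu n) (R Φ c f : ℝ) (p : Eu n), 1 ≤ R → M * R ^ (-γ) ≤ 1 → Φ ≤ K → 0 ≤ f →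
      ‖p‖ + A * f ≤ Φ →
      ∫ z in ball x R, (u z - v z - (c + ⟪p, z - x⟫)) ^ 2 ≤ f ^ 2 * R ^ (n + 2) →
      ∫ z in ball x R, (‖gradient u z‖ ^ 2 + ‖gradient v z‖ ^ 2 + u z ^ 2 * v z ^ 2) ≤
        K ^ 2 * R ^ n →
      ∃ (c' f' : ℝ) (p' : Eu n), 0 ≤ f' ∧ ‖p'‖ + A * f' ≤ Φ + M * R ^ (-γ) ∧
        ∫ z in ball x (θ * R), (u z - v z - (c' + ⟪p', z - x⟫)) ^ 2 ≤
          f' ^ 2 * (θ * R) ^ (n + 2) ∧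
        ∫ z in ball x (θ * R), (‖gradient u z‖ ^ 2 + ‖gradient v z‖ ^ 2 + u z ^ 2 * v z ^ 2) ≤
          B * ((Φ + M * R ^ (-γ)) ^ 2 + 1) * (θ * R) ^ n := by
  obtain ⟨γ, hγ, hsm⟩ := exists_smallness n
  obtain ⟨Cc, hCc, hcacc⟩ := exists_almostHarmonic_caccioppoli n
  obtain ⟨Ca, hCa, haff⟩ := exists_almostHarmonic_affine n
  have hV := ballVol_pos n
  obtain ⟨P, hP⟩ : ∃ P : ℝ, P = 4 ^ (n + 2) := ⟨_, rfl⟩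
  obtain ⟨D, hD⟩ : ∃ D : ℝ, D = 2 ^ (n + 2) := ⟨_, rfl⟩
  have hP1 : 1 ≤ P := hP ▸ one_le_pow₀ (by norm_num)
  have hD4 : 4 ≤ D := by
    rw [hD, pow_add]
    have : (1 : ℝ) ≤ 2 ^ n := one_le_pow₀ (by norm_num)
    linarith
  have hD1 : 1 ≤ D := by linarith
  obtain ⟨t, ht⟩ : ∃ t : ℝ, t = (2 * D * Ca * P)⁻¹ := ⟨_, rfl⟩
  have hprod : 1 ≤ Ca * P := one_le_mul_of_one_le_of_one_le hCa hP1
  have ht0 : 0 < t := by rw [ht]; positivity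
  have htD : 2 * D * Ca * P * t = 1 := by rw [ht]; exact mul_inv_cancel₀ (by positivity)
  have ht8 : t ≤ 1 / 8 := by
    rw [ht, one_div]
    refine inv_anti₀ (by norm_num) ?_
    calc (8 : ℝ) = 2 * 4 * 1 := by norm_num
      _ ≤ 2 * D * (Ca * P) := by gcongr
      _ = _ := by ring
  refine ⟨γ, t / 32, 2 * Ca * P, 68 + 4 * Cc + 4 * ballVol n, hγ, by positivity, by linarith,
    by linarith, by linarith, fun K hK => ?_⟩
  obtain ⟨M₀, hM₀, hsm⟩ := hsm K hK
  obtain ⟨N, hN⟩ : ∃ N : ℝ, N = (16 / t) ^ (n + 2) := ⟨_, rfl⟩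
  obtain ⟨N₂, hN₂⟩ : ∃ N₂ : ℝ, N₂ = (32 / t) ^ n := ⟨_, rfl⟩
  have hN1 : 1 ≤ N := hN ▸ one_le_pow₀ ((one_le_div ht0).2 (by linarith))
  have hN21 : 1 ≤ N₂ := hN₂ ▸ one_le_pow₀ ((one_le_div ht0).2 (by linarith))
  obtain ⟨M', hM'⟩ : ∃ M' : ℝ, M' = (2 * K ^ 2 + M₀) * N := ⟨_, rfl⟩
  have hM'1 : 1 ≤ M' := by
    rw [hM']
    exact one_le_mul_of_one_le_of_one_le (by linarith [sq_nonneg K]) hN1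
  have hMa : 0 ≤ 2 * Ca * P * (D * Ca * M') := by positivity
  have hMb : M₀ ≤ M₀ * N₂ := le_mul_of_one_le_right (by linarith) hN21
  refine ⟨2 * Ca * P * (D * Ca * M') + M₀ * N₂, by linarith, ?_⟩
  intro u v h hm x R Φ c f p hR hMR hΦ hf hpf hw hE
  obtain ⟨q, hq⟩ : ∃ q, q = R ^ (-γ) := ⟨_, rfl⟩
  have hR0 : 0 < R := by linarith
  have hq0 : 0 < q := hq ▸ Real.rpow_pos_of_pos hR0 _
  rw [← hq] at hMR ⊢
  have hMbq : M₀ * N₂ * q ≤ 1 :=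
    (mul_le_mul_of_nonneg_right (by linarith) hq0.le).trans hMR
  have hM₀q : M₀ * q ≤ 1 := (mul_le_mul_of_nonneg_right hMb hq0.le).trans hMbq
  have hq64 : q ≤ 1 / 64 := by
    have : 64 * q ≤ M₀ * q := by gcongr
    linarith
  have hA1 : 1 ≤ 2 * Ca * P := by linarith
  have hAf : f ≤ 2 * Ca * P * f := le_mul_of_one_le_left hf hA1
  have hpK : ‖p‖ ≤ K := by linarith
  have hfK : f ≤ K := by linarith [norm_nonneg p]
  obtain ⟨k, Δ, hk, hΔ0, hΔ, hmin, hah, ht1, ht2⟩ := hsm u v h hm x R c p hR (hq ▸ hM₀q) hpK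
    (hw.trans (by gcongr)) hE
  rw [← hq] at hΔ ht1 ht2
  have hcE := h.continuous_energyDensity
  have hcw : Continuous fun z => u z - v z := h.contDiff_sub.continuous
  have hgw : Continuous (gradient fun z => u z - v z) :=
    h.contDiff_sub.continuous_gradient (by norm_cast)
  obtain ⟨r, hr⟩ : ∃ r, r = R / 16 := ⟨_, rfl⟩
  have hRr : R = 16 * r := by linarith
  have hr0 : 0 < r := by linarith
  rw [← hr] at hmin hah ht1 ht2
  have hGw : ∫ z in ball x r, (u z - v z - (c + ⟪p, z - x⟫)) ^ 2 ≤ (P * f) ^ 2 * r ^ (n + 2) := by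
    refine (setIntegral_ball_mono_set (x' := x) (r' := R) (by fun_prop) (fun z => by positivity)
      (ball_subset_ball (by linarith))).trans (hw.trans (le_of_eq ?_))
    rw [hRr, hP, mul_pow, mul_pow, show (16 : ℝ) ^ (n + 2) = (4 ^ (n + 2)) ^ 2 by
      rw [← pow_mul, mul_comm, pow_mul]; norm_num]
    ring
  have hgE : ∫ z in ball x r, ‖gradient (fun z => u z - v z) z‖ ^ 2 ≤ 2 * K ^ 2 * R ^ n := by
    have e1 : ∫ z in ball x r, ‖gradient (fun z => u z - v z) z‖ ^ 2 ≤ ∫ z in ball x r,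
        2 * (‖gradient u z‖ ^ 2 + ‖gradient v z‖ ^ 2 + u z ^ 2 * v z ^ 2) := by
      refine setIntegral_ball_mono (by fun_prop) (by fun_prop) fun z _ => ?_
      have := norm_add_sq_le_two (gradient u z) (-gradient v z)
      rw [norm_neg, ← sub_eq_add_neg, ← h.gradient_sub] at this
      have : 0 ≤ u z ^ 2 * v z ^ 2 := by positivity
      linarith
    rw [integral_const_mul] at e1
    have e2 := setIntegral_ball_mono_set (x' := x) (r' := R) (x := x) (r := r) hcE
      (fun z => by positivity) (ball_subset_ball (by linarith))
    linarith
  obtain ⟨c', p', hp', hw'⟩ := haff (fun z => u z - v z) h.contDiff_sub x r Δ _ (P * f)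
    (R * q) t c p hr0 hΔ0 (by positivity) (by positivity)
    (by
      calc R * q ≤ R * (1 / 64) := by gcongr
        _ = r / 4 := by rw [hRr]; ring) ht0 ht8 hah hGw hgE
  obtain ⟨F, hF⟩ : ∃ F, F = Ca * (P * f * t + M' * q) := ⟨_, rfl⟩
  have hF0 : 0 ≤ F := by rw [hF]; positivity
  have hRN : R ^ (n + 2) = N * (t * r) ^ (n + 2) := by
    rw [hN, ← mul_pow, hRr]
    congr 1
    field_simp
  have hΔs : Δ * r ^ (n + 2) / (R * q) ^ n ≤ M₀ * q ^ 2 * R ^ (n + 2) := by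
    rw [div_le_iff₀ (by positivity)]
    calc Δ * r ^ (n + 2) ≤ M₀ * R ^ n * q ^ (n + 2) * R ^ (n + 2) := by
          gcongr
          linarith
      _ = _ := by rw [mul_pow, pow_add q]; ring
  have hw2 : ∫ z in ball x (t * r), (u z - v z - (c' + ⟪p', z - x⟫)) ^ 2 ≤
      F ^ 2 * (t * r) ^ (n + 2) := by
    refine hw'.trans ?_
    have e1 : (P * f) ^ 2 * t ^ 4 * r ^ 2 * (t * r) ^ n + (R * q) ^ 2 * (2 * K ^ 2 * R ^ n) +
        Δ * r ^ (n + 2) / (R * q) ^ n ≤ ((P * f * t) ^ 2 + M' * q ^ 2) * (t * r) ^ (n + 2) := by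
      have e2 : (R * q) ^ 2 * (2 * K ^ 2 * R ^ n) = 2 * K ^ 2 * q ^ 2 * R ^ (n + 2) := by
        rw [pow_add R]; ring
      have e3 : (P * f) ^ 2 * t ^ 4 * r ^ 2 * (t * r) ^ n =
          (P * f * t) ^ 2 * (t * r) ^ (n + 2) := by
        rw [pow_add (t * r)]; ring
      rw [e2, e3]
      calc _ ≤ (P * f * t) ^ 2 * (t * r) ^ (n + 2) + 2 * K ^ 2 * q ^ 2 * R ^ (n + 2) +
            M₀ * q ^ 2 * R ^ (n + 2) := by gcongr
        _ = _ := by rw [hRN, hM']; ring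
    have e4 : Ca * ((P * f * t) ^ 2 + M' * q ^ 2) ≤ F ^ 2 := by
      have a1 : Ca ≤ Ca ^ 2 := le_self_pow₀ hCa two_ne_zero
      have a2 : M' ≤ M' ^ 2 := le_self_pow₀ hM'1 two_ne_zero
      have a3 : 0 ≤ Ca ^ 2 * (2 * (P * f * t) * (M' * q)) := by positivity
      calc Ca * ((P * f * t) ^ 2 + M' * q ^ 2)
          ≤ Ca ^ 2 * ((P * f * t) ^ 2 + M' ^ 2 * q ^ 2) := by gcongr
        _ ≤ Ca ^ 2 * ((P * f * t) ^ 2 + M' ^ 2 * q ^ 2) +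
            Ca ^ 2 * (2 * (P * f * t) * (M' * q)) := by linarith
        _ = F ^ 2 := by rw [hF]; ring
    calc _ ≤ Ca * (((P * f * t) ^ 2 + M' * q ^ 2) * (t * r) ^ (n + 2)) := by gcongr
      _ = Ca * ((P * f * t) ^ 2 + M' * q ^ 2) * (t * r) ^ (n + 2) := by ring
      _ ≤ _ := by gcongr
  obtain ⟨ρ, hρ⟩ : ∃ ρ, ρ = t / 32 * R := ⟨_, rfl⟩
  have hρ0 : 0 < ρ := by rw [hρ]; positivity
  have htr : t * r = 2 * ρ := by rw [hρ, hRr]; ring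
  have hρr : 2 * ρ < r := by
    rw [← htr]
    calc t * r ≤ 1 / 8 * r := by gcongr
      _ < r := by linarith
  rw [htr] at hw2
  rw [← hρ]
  have hw3 : ∫ z in ball x (2 * ρ), (u z - v z - (c' + ⟪p', z - x⟫)) ^ 2 ≤
      (D * F) ^ 2 * ρ ^ (n + 2) := by
    refine hw2.trans ?_
    calc F ^ 2 * (2 * ρ) ^ (n + 2) = D * F ^ 2 * ρ ^ (n + 2) := by rw [mul_pow, hD]; ring
      _ ≤ D ^ 2 * F ^ 2 * ρ ^ (n + 2) := by
          gcongr
          exact le_self_pow₀ hD1 two_ne_zero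
      _ = _ := by ring
  have hDF : D * F = f / 2 + D * Ca * M' * q := by
    rw [hF]
    linear_combination f / 2 * htD
  have hΦ' : ‖p'‖ + 2 * Ca * P * (D * F) ≤
      Φ + (2 * Ca * P * (D * Ca * M') + M₀ * N₂) * q := by
    have := norm_sub_norm_le p' p
    have b1 : 0 ≤ M₀ * N₂ * q := by positivity
    have b2 : 2 * Ca * P * (D * F) = Ca * P * f + 2 * Ca * P * (D * Ca * M') * q := by
      rw [hDF]; ring
    rw [b2]
    linarith
  refine ⟨c', D * F, p', by positivity, hΦ', ?_, ?_⟩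
  · refine le_trans ?_ hw3
    exact setIntegral_ball_mono_set (by fun_prop) (fun z => by positivity)
      (ball_subset_ball (by linarith))
  · have hRρ : R ^ n = N₂ * ρ ^ n := by
      rw [hN₂, ← mul_pow, hρ]
      congr 1
      field_simp
    have hMρ : M₀ * R ^ n * q ≤ ρ ^ n := by
      calc M₀ * R ^ n * q = M₀ * N₂ * q * ρ ^ n := by rw [hRρ]; ring
        _ ≤ 1 * ρ ^ n := by gcongr
        _ = ρ ^ n := one_mul _
    have hΔρ : Δ ≤ ρ ^ n := by
      refine hΔ.trans (le_trans ?_ hMρ)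
      gcongr
      exact pow_le_of_le_one hq0.le (by linarith) (by omega)
    have hS := hcacc (fun z => u z - v z) h.contDiff_sub x r ρ Δ c' p' hρ0 hρr hΔ0 hah
    have hS' : ∫ z in ball x ρ, ‖gradient (fun z => u z - v z) z - p'‖ ^ 2 ≤
        Cc * ((D * F) ^ 2 * ρ ^ n) + 8 * ρ ^ n := by
      refine hS.trans ?_
      have : ρ⁻¹ ^ 2 * ∫ z in ball x (2 * ρ), (u z - v z - (c' + ⟪p', z - x⟫)) ^ 2 ≤
          (D * F) ^ 2 * ρ ^ n := by
        calc _ ≤ ρ⁻¹ ^ 2 * ((D * F) ^ 2 * ρ ^ (n + 2)) := by gcongr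
          _ = _ := by rw [pow_add]; field_simp
      gcongr
    refine (h.setIntegral_energyDensity_le hk hρ0 (by linarith) hmin (ht1.trans hMρ)
      (ht2.trans hMρ) hS').trans ?_
    obtain ⟨Ψ, hΨ⟩ : ∃ Ψ, Ψ = Φ + (2 * Ca * P * (D * Ca * M') + M₀ * N₂) * q := ⟨_, rfl⟩
    rw [← hΨ] at hΦ' ⊢
    have hDF0 : 0 ≤ D * F := by positivity
    have hADF : D * F ≤ 2 * Ca * P * (D * F) := le_mul_of_one_le_left hDF0 hA1
    have g1 : D * F ≤ Ψ := by linarith [norm_nonneg p']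
    have g2 : ‖p'‖ ≤ Ψ := by linarith
    have g3 : (D * F) ^ 2 ≤ Ψ ^ 2 := pow_le_pow_left₀ hDF0 g1 2
    have g4 : ‖p'‖ ^ 2 ≤ Ψ ^ 2 := pow_le_pow_left₀ (norm_nonneg _) g2 2
    have hCc0 : 0 ≤ Cc := by linarith
    have hρn : 0 ≤ ρ ^ n := by positivity
    calc _ ≤ 4 * (Cc * (Ψ ^ 2 * ρ ^ n) + 8 * ρ ^ n) + 4 * Ψ ^ 2 * (ρ ^ n * ballVol n) +
          18 * (ρ ^ n + ρ ^ n) := by gcongr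
      _ = (68 + (4 * Cc + 4 * ballVol n) * Ψ ^ 2) * ρ ^ n := by ring
      _ ≤ (68 + (4 * Cc + 4 * ballVol n) * Ψ ^ 2 + (68 * Ψ ^ 2 + (4 * Cc + 4 * ballVol n))) *
          ρ ^ n := by
        refine mul_le_mul_of_nonneg_right ?_ hρn
        have : 0 ≤ 68 * Ψ ^ 2 + (4 * Cc + 4 * ballVol n) := by positivity
        linarith
      _ = _ := by ring

theorem IsSolution.exists_growth_bound {n : ℕ} {u v : Eu n → ℝ} (h : IsSolution u v) {C₀ : ℝ}
    (hC₀ : 0 < C₀) (hg : ∀ x, u x + v x ≤ C₀ * (1 + ‖x‖)) :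
    ∃ K : ℝ, 1 ≤ K ∧ ∀ (x : Eu n) (R : ℝ), 1 + ‖x‖ ≤ R →
      ∫ z in ball x R, (‖gradient u z‖ ^ 2 + ‖gradient v z‖ ^ 2 + u z ^ 2 * v z ^ 2) ≤
        K ^ 2 * R ^ n ∧
      ∫ z in ball x R, (u z - v z) ^ 2 ≤ K ^ 2 * R ^ (n + 2) := by
  obtain ⟨C, hC, hcac⟩ := exists_caccioppoli_bound n
  have hV := ballVol_pos n
  have hcE := h.continuous_energyDensity
  have hcu := h.smooth.continuous
  have hcv := h.smooth_right.continuous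
  have hgu : Continuous (gradient u) := h.smooth.continuous_gradient (by norm_cast)
  have hgv : Continuous (gradient v) := h.smooth_right.continuous_gradient (by norm_cast)
  obtain ⟨K, hK⟩ : ∃ K, K = 1 + 18 * C * C₀ ^ 2 + 9 * C₀ ^ 2 * ballVol n := ⟨_, rfl⟩
  have p1 : 0 ≤ 18 * C * C₀ ^ 2 := by positivity
  have p2 : 0 ≤ 9 * C₀ ^ 2 * ballVol n := by positivity
  have hK1 : 1 ≤ K := by linarith
  have hKK : K ≤ K ^ 2 := le_self_pow₀ hK1 two_ne_zero
  refine ⟨K, hK1, fun x R hR => ?_⟩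
  have hR0 : 0 < R := by linarith [norm_nonneg x]
  have hb : ∀ z ∈ ball x (2 * R), u z + v z ≤ 3 * C₀ * R := by
    intro z hz
    have h1 : ‖z‖ ≤ ‖x‖ + 2 * R := by
      have := norm_le_norm_add_norm_sub' z x
      rw [mem_ball, dist_eq_norm] at hz
      linarith
    calc u z + v z ≤ C₀ * (1 + ‖z‖) := hg z
      _ ≤ C₀ * (3 * R) := by gcongr; linarith
      _ = _ := by ring
  constructor
  · have a1 := hcac u v h x R (3 * C₀ * R) hR0 fun z hz => by
      linarith [hb z hz, h.pos_right z]
    have a2 := hcac v u h.symm x R (3 * C₀ * R) hR0 fun z hz => by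
      linarith [hb z hz, h.pos z]
    have a3 : ∫ z in ball x R, (‖gradient u z‖ ^ 2 + ‖gradient v z‖ ^ 2 + u z ^ 2 * v z ^ 2) ≤
        ∫ z in ball x R, ((‖gradient u z‖ ^ 2 + u z ^ 2 * v z ^ 2) +
          (‖gradient v z‖ ^ 2 + v z ^ 2 * u z ^ 2)) := by
      refine setIntegral_ball_mono hcE (by fun_prop) fun z _ => ?_
      have : 0 ≤ v z ^ 2 * u z ^ 2 := by positivity
      linarith
    refine a3.trans ?_
    rw [integral_add (f := fun z => ‖gradient u z‖ ^ 2 + u z ^ 2 * v z ^ 2)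
      (g := fun z => ‖gradient v z‖ ^ 2 + v z ^ 2 * u z ^ 2)
      (Continuous.integrableOn_ball (by fun_prop)) (Continuous.integrableOn_ball (by fun_prop))]
    have a4 : ∀ I : ℝ, R ^ 2 * I ≤ C * (3 * C₀ * R) ^ 2 * R ^ n → I ≤ 9 * C * C₀ ^ 2 * R ^ n := by
      intro I hI
      refine le_of_mul_le_mul_left (hI.trans (le_of_eq ?_)) (pow_pos hR0 2)
      ring
    refine (add_le_add (a4 _ a1) (a4 _ a2)).trans ?_
    calc _ = (18 * C * C₀ ^ 2) * R ^ n := by ring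
      _ ≤ _ := by gcongr; linarith
  · calc _ ≤ (3 * C₀ * R) ^ 2 * (R ^ n * ballVol n) := by
          refine setIntegral_ball_le_const (by fun_prop) hR0 fun z hz => ?_
          have := hb z (ball_subset_ball (by linarith) hz)
          exact sq_le_sq' (by linarith [h.pos z, h.pos_right z])
            (by linarith [h.pos z, h.pos_right z])
      _ = (9 * C₀ ^ 2 * ballVol n) * R ^ (n + 2) := by ring
      _ ≤ _ := by gcongr; linarith

theorem IsSolution.exists_uniform_flatness {n : ℕ} {u v : Eu n → ℝ} (h : IsSolution u v)
    (hm : IsLocalMinimizer u v) {C₀ : ℝ} (hC₀ : 0 < C₀)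
    (hg : ∀ x, u x + v x ≤ C₀ * (1 + ‖x‖)) :
    ∃ K R₀ : ℝ, 1 ≤ K ∧ 1 ≤ R₀ ∧ ∀ (x : Eu n) (R : ℝ), R₀ ≤ R →
      ∫ z in ball x R, (‖gradient u z‖ ^ 2 + ‖gradient v z‖ ^ 2 + u z ^ 2 * v z ^ 2) ≤
        K ^ 2 * R ^ n ∧
      ∃ (c : ℝ) (p : Eu n), ‖p‖ ≤ K ∧
        ∫ z in ball x R, (u z - v z - (c + ⟪p, z - x⟫)) ^ 2 ≤ K ^ 2 * R ^ (n + 2) := by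
  obtain ⟨K₀, hK₀, hgrow⟩ := h.exists_growth_bound hC₀ hg
  obtain ⟨γ, θ, A, B, hγ, hθ, hθ1, hA, hB, hstep⟩ := exists_flatness_step n
  obtain ⟨Φ₀, hΦ₀⟩ : ∃ Φ₀, Φ₀ = A * K₀ := ⟨_, rfl⟩
  have hΦ1 : 1 ≤ Φ₀ := hΦ₀ ▸ one_le_mul_of_one_le_of_one_le hA hK₀
  obtain ⟨K, hK⟩ : ∃ K, K = K₀ + (Φ₀ + 1) + B * ((Φ₀ + 1) ^ 2 + 1) := ⟨_, rfl⟩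
  have hp1 : 0 ≤ B * ((Φ₀ + 1) ^ 2 + 1) := by positivity
  have hK1 : 1 ≤ K := by linarith
  have hKK : K ≤ K ^ 2 := le_self_pow₀ hK1 two_ne_zero
  obtain ⟨M, hM, hstep⟩ := hstep K hK1
  have hτ1 : θ ^ γ < 1 := Real.rpow_lt_one hθ.le hθ1 hγ
  have hτ0 : 0 < θ ^ γ := Real.rpow_pos_of_pos hθ _
  obtain ⟨S, hS⟩ : ∃ S, S = M / (1 - θ ^ γ) := ⟨_, rfl⟩
  have hSM : S * (1 - θ ^ γ) = M := by
    rw [hS]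
    exact div_mul_cancel₀ _ (by linarith)
  have hMS : M ≤ S := by
    rw [hS, le_div_iff₀ (by linarith)]
    exact mul_le_of_le_one_right (by linarith) (by linarith)
  have hS0 : 0 < S := by linarith
  have hsmall : ∀ R : ℝ, S ^ γ⁻¹ ≤ R → S * R ^ (-γ) ≤ 1 := by
    intro R hR
    have h1 : R ^ (-γ) ≤ (S ^ γ⁻¹) ^ (-γ) :=
      Real.rpow_le_rpow_of_nonpos (Real.rpow_pos_of_pos hS0 _) hR (by linarith)
    rw [← Real.rpow_mul hS0.le, mul_neg, inv_mul_cancel₀ hγ.ne', Real.rpow_neg_one] at h1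
    calc S * R ^ (-γ) ≤ S * S⁻¹ := by gcongr
      _ = 1 := mul_inv_cancel₀ hS0.ne'
  have hR₀1 : 1 ≤ S ^ γ⁻¹ := Real.one_le_rpow (by linarith) (by positivity)
  have key : ∀ (x : Eu n) (j : ℕ) (R : ℝ), S ^ γ⁻¹ ≤ R → θ ^ j * (1 + ‖x‖) ≤ R →
      ∃ (c f : ℝ) (p : Eu n), 0 ≤ f ∧ ‖p‖ + A * f ≤ Φ₀ + S * R ^ (-γ) ∧
        ∫ z in ball x R, (u z - v z - (c + ⟪p, z - x⟫)) ^ 2 ≤ f ^ 2 * R ^ (n + 2) ∧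
        ∫ z in ball x R, (‖gradient u z‖ ^ 2 + ‖gradient v z‖ ^ 2 + u z ^ 2 * v z ^ 2) ≤
          K ^ 2 * R ^ n := by
    intro x j
    induction j with
    | zero =>
      intro R hR hxR
      obtain ⟨h1, h2⟩ := hgrow x R (by simpa using hxR)
      have hR0 : 0 < R := by linarith
      refine ⟨0, K₀, 0, by linarith, ?_, ?_, h1.trans ?_⟩
      · have : 0 < S * R ^ (-γ) := mul_pos hS0 (Real.rpow_pos_of_pos hR0 _)
        rw [norm_zero, ← hΦ₀]
        linarith
      · simpa using h2
      · gcongr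
        linarith
    | succ j ih =>
      intro R hR hxR
      have hR0 : 0 < R := by linarith
      have hle : R ≤ R / θ := by
        rw [le_div_iff₀ hθ]
        exact mul_le_of_le_one_right hR0.le hθ1.le
      have hθR : θ * (R / θ) = R := by field_simp
      obtain ⟨c, f, p, hf, hpf, hw, hE⟩ := ih (R / θ) (by linarith) (by
        rw [le_div_iff₀ hθ]
        calc _ = θ ^ (j + 1) * (1 + ‖x‖) := by ring
          _ ≤ R := hxR)
      obtain ⟨q, hq⟩ : ∃ q, q = (R / θ) ^ (-γ) := ⟨_, rfl⟩
      have hRq : R ^ (-γ) * θ ^ γ = q := by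
        rw [hq, Real.div_rpow hR0.le hθ.le, Real.rpow_neg hθ.le, div_inv_eq_mul]
      have hs := hsmall R hR
      have hs' := hsmall (R / θ) (by linarith)
      have hq0 : 0 < q := hq ▸ Real.rpow_pos_of_pos (by positivity) _
      have hMq : M * q ≤ S * q := by gcongr
      rw [← hq] at hs' hpf
      have hsum : Φ₀ + S * q + M * q = Φ₀ + S * R ^ (-γ) - (1 - θ ^ γ) * M * R ^ (-γ) := by
        rw [← hRq, ← hSM]
        ring
      have hnn : 0 ≤ (1 - θ ^ γ) * M * R ^ (-γ) :=
        mul_nonneg (mul_nonneg (by linarith) (by linarith)) (Real.rpow_nonneg hR0.le _)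
      obtain ⟨c', f', p', hf', hpf', hw', hE'⟩ := hstep u v h hm x (R / θ) (Φ₀ + S * q) c f p
        (by linarith) (by rw [← hq]; linarith) (by linarith) hf hpf hw hE
      rw [← hq] at hpf' hE'
      rw [hθR] at hw' hE'
      refine ⟨c', f', p', hf', by linarith, hw', hE'.trans ?_⟩
      have hS0' : 0 ≤ Φ₀ + S * q + M * q := by positivity
      have hS1' : Φ₀ + S * q + M * q ≤ Φ₀ + 1 := by linarith
      calc _ ≤ B * ((Φ₀ + 1) ^ 2 + 1) * R ^ n := by gcongr
        _ ≤ K ^ 2 * R ^ n := by gcongr; linarith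
  refine ⟨K, S ^ γ⁻¹, hK1, hR₀1, fun x R hR => ?_⟩
  have hx : 0 < 1 + ‖x‖ := by positivity
  have hR0 : 0 < R := by linarith
  obtain ⟨j, hj⟩ := exists_pow_lt_of_lt_one (div_pos hR0 hx) hθ1
  rw [lt_div_iff₀ hx] at hj
  obtain ⟨c, f, p, hf, hpf, hw, hE⟩ := key x j R hR hj.le
  have hs := hsmall R hR
  have hAf : f ≤ A * f := le_mul_of_one_le_left hf hA
  have hfK : f ≤ K := by linarith [norm_nonneg p]
  exact ⟨hE, c, p, by linarith, hw.trans (by gcongr)⟩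

/-- `u - v` is almost harmonic at every scale, with the optimal error. -/
theorem IsSolution.exists_almostHarmonicOn {n : ℕ} (hn : 1 ≤ n) {u v : Eu n → ℝ}
    (h : IsSolution u v) (hm : IsLocalMinimizer u v) {C₀ : ℝ} (hC₀ : 0 < C₀)
    (hg : ∀ x, u x + v x ≤ C₀ * (1 + ‖x‖)) :
    ∃ C : ℝ, 0 < C ∧ ∀ (x : Eu n) (R : ℝ), 1 ≤ R →
      AlmostHarmonicOn (fun z => u z - v z) x R (C * R ^ ((n : ℝ) - 1 / 2)) := by
  obtain ⟨K, R₀, hK, hR₀, hflat⟩ := h.exists_uniform_flatness hm hC₀ hg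
  obtain ⟨β, Cm, hβ, hβ2, hCm, hmin⟩ := exists_min_bound n
  obtain ⟨Cd, hCd, hdef⟩ := exists_deficit_bound n
  have hgu : Continuous (gradient u) := h.smooth.continuous_gradient (by norm_cast)
  have hgv : Continuous (gradient v) := h.smooth_right.continuous_gradient (by norm_cast)
  have hcu := h.smooth.continuous
  have hcv := h.smooth_right.continuous
  have hn1 : (1 : ℝ) ≤ n := by exact_mod_cast hn
  obtain ⟨k, hk⟩ : ∃ k, k = R₀ + Cm * K * R₀ ^ (1 - β) := ⟨_, rfl⟩
  have hkp : 0 ≤ Cm * K * R₀ ^ (1 - β) := by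
    have := Real.rpow_nonneg (by linarith : (0 : ℝ) ≤ R₀) (1 - β)
    positivity
  have hk1 : 1 ≤ k := by linarith
  have hmink : ∀ x, u x ≤ k ∨ v x ≤ k := by
    intro x
    obtain ⟨hE, c, p, hp, hw⟩ := hflat x R₀ le_rfl
    have := hmin u v h x R₀ K c p hR₀ hK hp hw
      ((setIntegral_ball_mono (by fun_prop) h.continuous_energyDensity fun z _ =>
        le_add_of_nonneg_left (by positivity)).trans hE) x (mem_ball_self (by linarith))
    exact this.imp (fun _ => by linarith) (fun _ => by linarith)
  have hlarge : ∀ (x : Eu n) (R : ℝ), k ≤ R → AlmostHarmonicOn (fun z => u z - v z) x R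
      (Cd * (2 ^ n * K) ^ 2 * R ^ n * √(k / R)) := by
    intro x R hR
    refine hdef u v h hm x R k (2 ^ n * K) hk1 hR
      (one_le_mul_of_one_le_of_one_le (one_le_pow₀ (by norm_num)) hK) (fun z _ => hmink z) ?_
    refine (setIntegral_ball_mono (by fun_prop) h.continuous_energyDensity fun z _ =>
      le_add_of_nonneg_right (by positivity)).trans ((hflat x (4 * R) (by linarith)).1.trans
        (le_of_eq ?_))
    rw [mul_pow, mul_pow, show (4 : ℝ) ^ n = (2 ^ n) ^ 2 by
      rw [← pow_mul, mul_comm, pow_mul]; norm_num]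
    ring
  have hmono : ∀ (x : Eu n) (R R' Δ Δ' : ℝ), R ≤ R' → Δ ≤ Δ' →
      AlmostHarmonicOn (fun z => u z - v z) x R' Δ →
      AlmostHarmonicOn (fun z => u z - v z) x R Δ' := by
    intro x R R' Δ Δ' hR hΔ hA ψ hψ hc hs
    refine (hA ψ hψ hc (hs.trans (ball_subset_ball hR))).trans ?_
    exact mul_le_mul_of_nonneg_right hΔ (integral_nonneg fun _ => by positivity)
  have hk0 : 0 < k := by linarith
  refine ⟨Cd * (2 ^ n * K) ^ 2 * k ^ n * √k, by positivity, fun x R hR => ?_⟩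
  have hR0 : 0 < R := by linarith
  have hkn : 1 ≤ k ^ n := one_le_pow₀ hk1
  rcases le_total k R with hkR | hkR
  · refine hmono x R R _ _ le_rfl ?_ (hlarge x R hkR)
    have e1 : R ^ ((n : ℝ) - 1 / 2) = R ^ n / √R := by
      rw [Real.rpow_sub hR0, Real.rpow_natCast, Real.sqrt_eq_rpow]
    rw [e1, Real.sqrt_div hk0.le]
    calc _ = Cd * (2 ^ n * K) ^ 2 * 1 * √k * (R ^ n / √R) := by ring
      _ ≤ _ := by gcongr
  · refine hmono x R k _ _ hkR ?_ (hlarge x k le_rfl)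
    rw [div_self hk0.ne', Real.sqrt_one]
    have e1 : 1 ≤ R ^ ((n : ℝ) - 1 / 2) := Real.one_le_rpow hR (by linarith)
    have e2 : 1 ≤ √k := Real.one_le_sqrt.2 hk1
    have e3 : 1 ≤ √k * R ^ ((n : ℝ) - 1 / 2) := one_le_mul_of_one_le_of_one_le e2 e1
    calc _ ≤ Cd * (2 ^ n * K) ^ 2 * k ^ n * (√k * R ^ ((n : ℝ) - 1 / 2)) := by gcongr
      _ = _ := by ring

theorem exists_smooth_gradient_approx {n : ℕ} {ψ : Eu n → ℝ} {U : Set (Eu n)}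
    (hψ : ContDiff ℝ 1 ψ) (hc : HasCompactSupport ψ) (hU : IsOpen U) (hs : tsupport ψ ⊆ U)
    {ε : ℝ} (hε : 0 < ε) :
    ∃ ψ' : Eu n → ℝ, ContDiff ℝ (⊤ : ℕ∞) ψ' ∧ HasCompactSupport ψ' ∧ tsupport ψ' ⊆ U ∧
      ∀ z, ‖gradient ψ' z - gradient ψ z‖ ≤ ε := by
  have hfc : Continuous (fderiv ℝ ψ) := hψ.continuous_fderiv (by norm_num)
  have huc := (hc.fderiv ℝ).uniformContinuous_of_continuous hfc
  obtain ⟨δ, hδ, hδε⟩ := Metric.uniformContinuous_iff.1 huc ε hε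
  obtain ⟨δ', hδ', hthick⟩ := hc.isCompact.exists_cthickening_subset_open hU hs
  obtain ⟨m, hm⟩ : ∃ m, m = min δ δ' := ⟨_, rfl⟩
  have hm0 : 0 < m := hm ▸ lt_min hδ hδ'
  let b : ContDiffBump (0 : Eu n) := ⟨m / 2, m, by linarith, by linarith⟩
  let L := ContinuousLinearMap.lsmul ℝ ℝ (E := ℝ)
  have hcl : IsClosed (cthickening δ' (tsupport ψ)) := isClosed_cthickening
  have hsupp : tsupport (convolution (b.normed volume) ψ L volume) ⊆
      cthickening δ' (tsupport ψ) := by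
    refine closure_minimal ((support_convolution_subset L).trans ?_) hcl
    rintro _ ⟨y, hy, z, hz, rfl⟩
    rw [b.support_normed_eq, mem_ball, dist_zero_right] at hy
    refine mem_cthickening_of_dist_le _ z _ _ (subset_tsupport _ hz) ?_
    have h1 : b.rOut = m := rfl
    have h2 : m ≤ δ' := hm ▸ min_le_right _ _
    change dist (y + z) z ≤ δ'
    rw [dist_eq_norm, add_sub_cancel_right]
    linarith
  refine ⟨convolution (b.normed volume) ψ L volume, ?_, ?_, hsupp.trans hthick, fun z => ?_⟩
  · exact b.hasCompactSupport_normed.contDiff_convolution_left L b.contDiff_normed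
      hψ.continuous.locallyIntegrable
  · exact hc.isCompact.cthickening.of_isClosed_subset (isClosed_tsupport _) hsupp
  · have hli : LocallyIntegrable (b.normed volume) volume :=
      b.continuous_normed.locallyIntegrable
    have h1 := hc.hasFDerivAt_convolution_right L hli hψ z
    have h2 : convolution (b.normed volume) (fderiv ℝ ψ) (L.precompR (Eu n)) volume z =
        convolution (b.normed volume) (fderiv ℝ ψ) (ContinuousLinearMap.lsmul ℝ ℝ) volume z := by
      unfold convolution
      congr 1
    rw [h2] at h1
    rw [gradient, gradient, ← map_sub, LinearIsometryEquiv.norm_map, h1.fderiv, ← dist_eq_norm]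
    refine b.dist_normed_convolution_le hfc.aestronglyMeasurable fun y hy => (hδε ?_).le
    have h3 : b.rOut = m := rfl
    have h4 : m ≤ δ := hm ▸ min_le_left _ _
    rw [mem_ball] at hy
    linarith

/-- Almost harmonicity may be tested with functions of class `C¹`. -/
theorem AlmostHarmonicOn.sq_integral_inner_le {n : ℕ} {f ψ : Eu n → ℝ} {x : Eu n} {r Δ : ℝ}
    (h : AlmostHarmonicOn f x r Δ) (hf : ContDiff ℝ (⊤ : ℕ∞) f) (hψ : ContDiff ℝ 1 ψ)
    (hc : HasCompactSupport ψ) (hs : tsupport ψ ⊆ ball x r) :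
    (∫ z, ⟪gradient f z, gradient ψ z⟫) ^ 2 ≤ Δ * ∫ z, ‖gradient ψ z‖ ^ 2 := by
  have hgf : Continuous (gradient f) := hf.continuous_gradient (by norm_cast)
  have hgψ : Continuous (gradient ψ) := hψ.continuous_gradient le_rfl
  have hpos : ∀ m : ℕ, (0 : ℝ) < 1 / ((m : ℝ) + 1) := fun m => Nat.one_div_pos_of_nat
  choose ξ hξ hξc hξs hξg using fun m : ℕ =>
    exists_smooth_gradient_approx hψ hc isOpen_ball hs (hpos m)
  have hgξ : ∀ m, Continuous (gradient (ξ m)) := fun m => (hξ m).continuous_gradient (by norm_cast)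
  have h0 : ∀ η : Eu n → ℝ, tsupport η ⊆ ball x r → ∀ z, z ∉ ball x r → gradient η z = 0 :=
    fun η hη z hz => gradient_eq_zero_of_notMem_tsupport fun hz' => hz (hη hz')
  have hlim : ∀ z, Filter.Tendsto (fun m => gradient (ξ m) z) Filter.atTop
      (nhds (gradient ψ z)) := by
    intro z
    rw [tendsto_iff_norm_sub_tendsto_zero]
    exact squeeze_zero (fun _ => norm_nonneg _) (fun m => hξg m z)
      tendsto_one_div_add_atTop_nhds_zero_nat
  have hbd : ∀ m z, ‖gradient (ξ m) z‖ ≤ ‖gradient ψ z‖ + 1 := by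
    intro m z
    have h1 := hξg m z
    have h2 : 1 / ((m : ℝ) + 1) ≤ 1 := by
      rw [div_le_one (by positivity)]
      linarith [(Nat.cast_nonneg m : (0 : ℝ) ≤ m)]
    have h3 := norm_le_norm_add_norm_sub' (gradient (ξ m) z) (gradient ψ z)
    linarith
  have hl1 : Filter.Tendsto (fun m => ∫ z, ⟪gradient f z, gradient (ξ m) z⟫) Filter.atTop
      (nhds (∫ z, ⟪gradient f z, gradient ψ z⟫)) := by
    have e : ∀ η : Eu n → ℝ, tsupport η ⊆ ball x r →
        ∫ z, ⟪gradient f z, gradient η z⟫ = ∫ z in ball x r, ⟪gradient f z, gradient η z⟫ :=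
      fun η hη => (setIntegral_eq_integral_of_forall_compl_eq_zero fun z hz => by
        rw [h0 η hη z hz, inner_zero_right]).symm
    rw [e ψ hs]
    simp_rw [e _ (hξs _)]
    refine tendsto_integral_of_dominated_convergence
      (fun z => ‖gradient f z‖ * (‖gradient ψ z‖ + 1))
      (fun m => (hgf.inner (hgξ m)).aestronglyMeasurable)
      (Continuous.integrableOn_ball (by fun_prop))
      (fun m => Filter.Eventually.of_forall fun z => ?_)
      (Filter.Eventually.of_forall fun z => tendsto_const_nhds.inner (hlim z))
    exact (norm_inner_le_norm _ _).trans (by gcongr; exact hbd m z)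
  have hl2 : Filter.Tendsto (fun m => ∫ z, ‖gradient (ξ m) z‖ ^ 2) Filter.atTop
      (nhds (∫ z, ‖gradient ψ z‖ ^ 2)) := by
    have e : ∀ η : Eu n → ℝ, tsupport η ⊆ ball x r →
        ∫ z, ‖gradient η z‖ ^ 2 = ∫ z in ball x r, ‖gradient η z‖ ^ 2 :=
      fun η hη => (setIntegral_eq_integral_of_forall_compl_eq_zero fun z hz => by
        rw [h0 η hη z hz, norm_zero, zero_pow two_ne_zero]).symm
    rw [e ψ hs]
    simp_rw [e _ (hξs _)]
    refine tendsto_integral_of_dominated_convergence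
      (fun z => (‖gradient ψ z‖ + 1) ^ 2)
      (fun m => ((hgξ m).norm.pow 2).aestronglyMeasurable)
      (Continuous.integrableOn_ball (by fun_prop))
      (fun m => Filter.Eventually.of_forall fun z => ?_)
      (Filter.Eventually.of_forall fun z => (hlim z).norm.pow 2)
    rw [norm_pow, norm_norm]
    gcongr
    exact hbd m z
  exact le_of_tendsto_of_tendsto' (hl1.pow 2) (hl2.const_mul Δ)
    fun m => h (ξ m) (hξ m) (hξc m) (hξs m)

/-- A function `T` of class `C¹` vanishing on `[-σ, σ]` with `0 ≤ T' ≤ 1`. -/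
theorem exists_softThreshold {σ : ℝ} (hσ : 0 < σ) : ∃ T : ℝ → ℝ,
    (∀ t, HasDerivAt T (max (|t| - σ) 0 / max |t| σ) t) ∧ ∀ t, |t| ≤ σ → T t = 0 := by
  have hcont : Continuous fun t : ℝ => max (|t| - σ) 0 / max |t| σ := by
    have h1 : ∀ t : ℝ, max |t| σ ≠ 0 := fun t => (lt_max_of_lt_right hσ).ne'
    fun_prop (disch := assumption)
  refine ⟨fun t => ∫ s in (0 : ℝ)..t, max (|s| - σ) 0 / max |s| σ,
    fun t => (hcont.integral_hasStrictDerivAt 0 t).hasDerivAt, fun t ht => ?_⟩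
  refine (intervalIntegral.integral_congr (g := fun _ => (0 : ℝ)) fun s hs => ?_).trans
    intervalIntegral.integral_zero
  have h1 : |s| ≤ |t| := by
    have := Set.abs_sub_left_of_mem_uIcc hs
    simpa using this
  change max (|s| - σ) 0 / max |s| σ = 0
  rw [max_eq_right (by linarith), zero_div]

theorem contDiff_one_of_hasDerivAt {T T' : ℝ → ℝ} (h : ∀ t, HasDerivAt T (T' t) t)
    (hc : Continuous T') : ContDiff ℝ 1 T := by
  refine contDiff_one_iff_deriv.2 ⟨fun t => (h t).differentiableAt, ?_⟩
  rwa [funext fun t => (h t).deriv]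

theorem measurableSet_inter_preimage_zero {n : ℕ} {U : Set (Eu n)} {f : Eu n → ℝ} (hU : IsOpen U)
    (hf : ContinuousOn f U) : MeasurableSet (U ∩ f ⁻¹' {0}) := by
  have h1 : IsOpen (U ∩ f ⁻¹' {0}ᶜ) := hf.isOpen_inter_preimage hU isOpen_compl_singleton
  have h2 : U ∩ f ⁻¹' {0} = U \ (U ∩ f ⁻¹' {0}ᶜ) := by
    ext y
    simp only [Set.mem_inter_iff, Set.mem_sdiff, Set.mem_preimage, Set.mem_compl_iff]
    tauto
  rw [h2]
  exact hU.measurableSet.diff h1.measurableSet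

/-- The gradient of a differentiable function vanishes almost everywhere on its zero set. -/
theorem ae_gradient_eq_zero_of_eq_zero {n : ℕ} (hn : 1 ≤ n) {U : Set (Eu n)} {f : Eu n → ℝ}
    (hU : IsOpen U) (hf : ContDiffOn ℝ 1 f U) :
    ∀ᵐ y ∂volume.restrict U, f y = 0 → gradient f y = 0 := by
  have hs := measurableSet_inter_preimage_zero hU hf.continuousOn
  obtain ⟨e, he⟩ : ∃ e : Eu n, e ≠ 0 :=
    ⟨EuclideanSpace.single ⟨0, hn⟩ 1, by simp⟩
  have happ : ApproximatesLinearOn (fun y => f y • e) (0 : Eu n →L[ℝ] Eu n) (U ∩ f ⁻¹' {0}) 0 := by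
    intro y hy z hz
    have h1 : f y = 0 := hy.2
    have h2 : f z = 0 := hz.2
    simp [h1, h2]
  have hd : ∀ y ∈ U ∩ f ⁻¹' {0}, HasFDerivWithinAt (fun y => f y • e)
      ((fderiv ℝ f y).smulRight e) (U ∩ f ⁻¹' {0}) y := fun y hy =>
    (((hf.contDiffAt (hU.mem_nhds hy.1)).differentiableAt
      (by norm_num)).hasFDerivAt.smul_const e).hasFDerivWithinAt
  have h := (ae_restrict_iff' hs).1 (happ.norm_fderiv_sub_le volume hs _ hd)
  refine (ae_restrict_iff' hU.measurableSet).2 ?_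
  filter_upwards [h] with y hy hyU hy0
  have h1 := hy ⟨hyU, hy0⟩
  rw [sub_zero, nonpos_iff_eq_zero, nnnorm_eq_zero] at h1
  rw [gradient, LinearIsometryEquiv.map_eq_zero_iff]
  ext v
  have h2 := congrArg (fun A : Eu n →L[ℝ] Eu n => A v) h1
  simpa [he] using h2

theorem AlmostHarmonicOn.lintegral_softThreshold_le {n : ℕ} {w φ : Eu n → ℝ} {x : Eu n}
    {r Δ σ : ℝ} (h : AlmostHarmonicOn w x r Δ) (hw : ContDiff ℝ (⊤ : ℕ∞) w)
    (hφc : ContinuousOn φ (closedBall x r)) (hφ : ContDiffOn ℝ 2 φ (ball x r))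
    (hl : ∀ y ∈ ball x r, lap φ y = 0) (hb : ∀ y ∈ sphere x r, φ y = w y) (hσ : 0 < σ) :
    ∫⁻ y in ball x r, ENNReal.ofReal (max (|w y - φ y| - σ) 0 / max |w y - φ y| σ *
      ‖gradient (fun z => w z - φ z) y‖ ^ 2) ≤ ENNReal.ofReal Δ := by
  obtain ⟨T, hT, hT0⟩ := exists_softThreshold hσ
  obtain ⟨T', hT'⟩ : ∃ T' : ℝ → ℝ, T' = fun t => max (|t| - σ) 0 / max |t| σ := ⟨_, rfl⟩
  have hT'c : Continuous T' := by
    have h1 : ∀ t : ℝ, max |t| σ ≠ 0 := fun t => (lt_max_of_lt_right hσ).ne'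
    rw [hT']
    fun_prop (disch := assumption)
  have hT'0 : ∀ t, 0 ≤ T' t := fun t => by
    rw [hT']
    exact div_nonneg (le_max_right _ _) (lt_max_of_lt_right hσ).le
  have hT'1 : ∀ t, T' t ≤ 1 := fun t => by
    rw [hT']
    refine div_le_one_of_le₀ (max_le ?_ (lt_max_of_lt_right hσ).le) (lt_max_of_lt_right hσ).le
    exact le_max_of_le_left (by linarith)
  replace hT : ∀ t, HasDerivAt T (T' t) t := fun t => by rw [hT']; exact hT t
  have hTc := contDiff_one_of_hasDerivAt hT hT'c
  obtain ⟨ζ, hζ⟩ : ∃ ζ : Eu n → ℝ, ζ = fun z => w z - φ z := ⟨_, rfl⟩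
  have hgoal : ∫⁻ y in ball x r, ENNReal.ofReal (T' (ζ y) * ‖gradient ζ y‖ ^ 2) ≤
      ENNReal.ofReal Δ → ∫⁻ y in ball x r, ENNReal.ofReal (max (|w y - φ y| - σ) 0 /
        max |w y - φ y| σ * ‖gradient (fun z => w z - φ z) y‖ ^ 2) ≤ ENNReal.ofReal Δ := by
    rw [hζ, hT']
    exact id
  refine hgoal ?_
  have hζc : ContinuousOn ζ (closedBall x r) := hζ ▸ hw.continuous.continuousOn.sub hφc
  have hφd : ∀ y ∈ ball x r, HasGradientAt φ (gradient φ y) y := fun y hy =>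
    ((hφ.contDiffAt (isOpen_ball.mem_nhds hy)).differentiableAt (by norm_num)).hasGradientAt
  have hζd : ∀ y ∈ ball x r, HasGradientAt ζ (gradient w y - gradient φ y) y := fun y hy =>
    hζ ▸ (hw.hasGradientAt (by simp) y).sub_fun (hφd y hy)
  have hζC : ContDiffOn ℝ 1 ζ (ball x r) :=
    hζ ▸ (hw.contDiffOn.of_le (by norm_cast)).sub (hφ.of_le (by norm_num))
  obtain ⟨S, hS⟩ : ∃ S, S = closedBall x r ∩ ζ ⁻¹' {t | σ ≤ |t|} := ⟨_, rfl⟩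
  have hSclosed : IsClosed S := hS ▸ hζc.preimage_isClosed_of_isClosed isClosed_closedBall
    (isClosed_le continuous_const continuous_abs)
  have hScomp : IsCompact S :=
    (isCompact_closedBall x r).of_isClosed_subset hSclosed (hS ▸ Set.inter_subset_left)
  have hSball : S ⊆ ball x r := by
    intro y hy
    rw [hS] at hy
    by_contra hyb
    have hys : y ∈ sphere x r := by
      rw [mem_sphere]
      exact le_antisymm hy.1 (not_lt.1 hyb)
    have h1 : σ ≤ |ζ y| := hy.2
    have h2 : ζ y = 0 := by
      rw [hζ]
      exact sub_eq_zero.2 (hb y hys).symm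
    rw [h2, abs_zero] at h1
    linarith
  obtain ⟨ψ, hψ⟩ : ∃ ψ, ψ = (ball x r).indicator fun y => T (ζ y) := ⟨_, rfl⟩
  have hψS : tsupport ψ ⊆ S := by
    refine closure_minimal (fun y hy => ?_) hSclosed
    rw [hψ, Set.support_indicator] at hy
    rw [hS]
    refine ⟨ball_subset_closedBall hy.1, ?_⟩
    by_contra hlt
    exact hy.2 (hT0 _ (not_le.1 hlt).le)
  have hψc : HasCompactSupport ψ := hScomp.of_isClosed_subset (isClosed_tsupport _) hψS
  have hψev : ∀ y ∈ ball x r, ψ =ᶠ[nhds y] fun y => T (ζ y) := fun y hy => by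
    filter_upwards [isOpen_ball.mem_nhds hy] with z hz
    rw [hψ, Set.indicator_of_mem hz]
  have hψC : ContDiff ℝ 1 ψ := by
    refine contDiff_iff_contDiffAt.2 fun y => ?_
    by_cases hy : y ∈ ball x r
    · exact (hTc.contDiffAt.comp y (hζC.contDiffAt (isOpen_ball.mem_nhds hy))).congr_of_eventuallyEq
        (hψev y hy)
    · have h1 : y ∉ tsupport ψ := fun hy' => hy (hSball (hψS hy'))
      exact contDiffAt_const.congr_of_eventuallyEq (notMem_tsupport_iff_eventuallyEq.1 h1)
  have hgψ : Continuous (gradient ψ) := hψC.continuous_gradient le_rfl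
  have hgw : Continuous (gradient w) := hw.continuous_gradient (by norm_cast)
  have hψg : ∀ y ∈ ball x r, gradient ψ y = T' (ζ y) • (gradient w y - gradient φ y) :=
    fun y hy => (hψev y hy).gradient_eq.trans ((hT _).comp_hasGradientAt (hζd y hy)).gradient
  have hψg0 : ∀ y, y ∉ S → gradient ψ y = 0 := fun y hy =>
    gradient_eq_zero_of_notMem_tsupport fun hy' => hy (hψS hy')
  have hφg : ContinuousOn (gradient φ) (ball x r) := by
    have h1 := hφ.continuousOn_fderiv_of_isOpen isOpen_ball (by norm_num)
    exact (InnerProductSpace.toDual ℝ (Eu n)).symm.continuous.comp_continuousOn h1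
  have hφ0 : ∫ y, ⟪gradient φ y, gradient ψ y⟫ = 0 := by
    rw [integral_inner_gradient_eq_neg isOpen_ball hφ hψC hψc (hψS.trans hSball), neg_eq_zero]
    refine integral_eq_zero_of_ae (Filter.Eventually.of_forall fun y => ?_)
    by_cases hy : y ∈ ball x r
    · simp [hl y hy]
    · simp [hψ, Set.indicator_of_notMem hy]
  have hi1 : Integrable fun y => ⟪gradient w y, gradient ψ y⟫ := by
    refine (hgw.inner hgψ).integrable_of_hasCompactSupport ?_
    refine HasCompactSupport.intro hScomp fun y hy => ?_
    rw [hψg0 y hy, inner_zero_right]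
  have hi2 : Integrable fun y => ⟪gradient φ y, gradient ψ y⟫ := by
    refine (integrableOn_iff_integrable_of_support_subset (s := S) ?_).1 ?_
    · intro y hy
      by_contra hyS
      exact hy (by simp only [hψg0 y hyS, inner_zero_right])
    · exact ((hφg.mono hSball).inner hgψ.continuousOn).integrableOn_compact hScomp
  obtain ⟨J, hJ⟩ : ∃ J : Eu n → ℝ, J = fun y => ⟪gradient w y - gradient φ y, gradient ψ y⟫ :=
    ⟨_, rfl⟩
  have hJi : Integrable J := by
    have := hi1.sub hi2
    rw [hJ]
    refine this.congr (Filter.Eventually.of_forall fun y => ?_)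
    simp only [Pi.sub_apply, inner_sub_left]
  have hJint : ∫ y, J y = ∫ y, ⟪gradient w y, gradient ψ y⟫ := by
    rw [hJ]
    simp_rw [inner_sub_left]
    rw [integral_sub hi1 hi2, hφ0, sub_zero]
  have hJball : ∀ y ∈ ball x r, J y = T' (ζ y) * ‖gradient ζ y‖ ^ 2 := fun y hy => by
    rw [hJ, (hζd y hy).gradient]
    simp only [hψg y hy, inner_smul_right, real_inner_self_eq_norm_sq]
  have hJout : ∀ y, y ∉ ball x r → J y = 0 := fun y hy => by
    rw [hJ]
    simp only [hψg0 y fun hy' => hy (hSball hy'), inner_zero_right]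
  have hJ0 : ∀ y, 0 ≤ J y := fun y => by
    by_cases hy : y ∈ ball x r
    · rw [hJball y hy]
      exact mul_nonneg (hT'0 _) (by positivity)
    · exact (hJout y hy).ge
  have hψJ : ∫ y, ‖gradient ψ y‖ ^ 2 ≤ ∫ y, J y := by
    refine integral_mono_of_nonneg (Filter.Eventually.of_forall fun y => by positivity) hJi
      (Filter.Eventually.of_forall fun y => ?_)
    change ‖gradient ψ y‖ ^ 2 ≤ J y
    by_cases hy : y ∈ ball x r
    · rw [hJball y hy, hψg y hy, (hζd y hy).gradient, norm_smul, mul_pow, Real.norm_eq_abs, sq_abs]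
      refine mul_le_mul_of_nonneg_right ?_ (by positivity)
      exact pow_le_of_le_one (hT'0 _) (hT'1 _) two_ne_zero
    · rw [hψg0 y fun hy' => hy (hSball hy'), hJout y hy]
      simp
  have hJΔ : ENNReal.ofReal (∫ y, J y) ≤ ENNReal.ofReal Δ := by
    have h1 := h.sq_integral_inner_le hw hψC hψc (hψS.trans hSball)
    rw [← hJint] at h1
    have h2 : 0 ≤ ∫ y, J y := integral_nonneg hJ0
    have h4 : 0 ≤ ∫ y, ‖gradient ψ y‖ ^ 2 := integral_nonneg fun y => by positivity
    rcases h2.eq_or_lt with h3 | h3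
    · rw [← h3, ENNReal.ofReal_zero]
      exact zero_le
    · refine ENNReal.ofReal_le_ofReal ?_
      have hΔ : 0 ≤ Δ := by
        by_contra hneg
        have : Δ * ∫ y, ‖gradient ψ y‖ ^ 2 ≤ 0 :=
          mul_nonpos_of_nonpos_of_nonneg (not_le.1 hneg).le h4
        have : 0 < (∫ y, J y) ^ 2 := by positivity
        linarith
      refine le_of_mul_le_mul_right ?_ h3
      rw [← sq]
      exact h1.trans (mul_le_mul_of_nonneg_left hψJ hΔ)
  rw [ofReal_integral_eq_lintegral_ofReal hJi (Filter.Eventually.of_forall hJ0)] at hJΔ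
  refine le_trans ?_ hJΔ
  rw [setLIntegral_congr_fun (g := fun y => ENNReal.ofReal (J y)) measurableSet_ball fun y hy => by
    simp only [hJball y hy]]
  exact setLIntegral_le_lintegral _ _

/-- The Dirichlet distance of an almost harmonic function to its harmonic replacement. -/
theorem AlmostHarmonicOn.harmonic_replacement_le {n : ℕ} (hn : 1 ≤ n) {w φ : Eu n → ℝ} {x : Eu n}
    {r Δ : ℝ} (h : AlmostHarmonicOn w x r Δ) (hΔ : 0 ≤ Δ) (hw : ContDiff ℝ (⊤ : ℕ∞) w)
    (hφc : ContinuousOn φ (closedBall x r)) (hφ : ContDiffOn ℝ 2 φ (ball x r))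
    (hl : ∀ y ∈ ball x r, lap φ y = 0) (hb : ∀ y ∈ sphere x r, φ y = w y) :
    ∫ y in ball x r, ‖gradient (fun z => w z - φ z) y‖ ^ 2 ≤ Δ := by
  have key := fun m : ℕ => h.lintegral_softThreshold_le hw hφc hφ hl hb
    (Nat.one_div_pos_of_nat (α := ℝ) (n := m))
  obtain ⟨ζ, hζ⟩ : ∃ ζ : Eu n → ℝ, ζ = fun z => w z - φ z := ⟨_, rfl⟩
  have hζ' : ∀ y, w y - φ y = ζ y := fun y => by rw [hζ]
  rw [← hζ] at key ⊢
  simp_rw [hζ'] at key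
  have hζC : ContDiffOn ℝ 1 ζ (ball x r) :=
    hζ ▸ (hw.contDiffOn.of_le (by norm_cast)).sub (hφ.of_le (by norm_num))
  have hgc : ContinuousOn (gradient ζ) (ball x r) := by
    have h1 := hζC.continuousOn_fderiv_of_isOpen isOpen_ball (by norm_num)
    exact (InnerProductSpace.toDual ℝ (Eu n)).symm.continuous.comp_continuousOn h1
  have hgc2 : ContinuousOn (fun y => ‖gradient ζ y‖ ^ 2) (ball x r) := hgc.norm.pow 2
  rw [integral_eq_lintegral_of_nonneg_ae (Filter.Eventually.of_forall fun y => by positivity)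
    (hgc2.aestronglyMeasurable measurableSet_ball)]
  refine ENNReal.toReal_le_of_le_ofReal hΔ ?_
  obtain ⟨q, hq⟩ : ∃ q : ℕ → Eu n → ENNReal, q = fun (m : ℕ) y => ENNReal.ofReal
    (max (|ζ y| - 1 / ((m : ℝ) + 1)) 0 / max |ζ y| (1 / ((m : ℝ) + 1)) * ‖gradient ζ y‖ ^ 2) :=
    ⟨_, rfl⟩
  have hmeas : ∀ m, AEMeasurable (q m) (volume.restrict (ball x r)) := by
    intro m
    have h1 : Continuous fun t : ℝ => max (|t| - 1 / ((m : ℝ) + 1)) 0 /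
        max |t| (1 / ((m : ℝ) + 1)) := by
      have h1 : ∀ t : ℝ, max |t| (1 / ((m : ℝ) + 1)) ≠ 0 :=
        fun t => (lt_max_of_lt_right Nat.one_div_pos_of_nat).ne'
      fun_prop (disch := assumption)
    rw [hq]
    exact ((h1.comp_continuousOn hζC.continuousOn).mul hgc2).aemeasurable
      measurableSet_ball |>.ennreal_ofReal
  have hlim : ∀ᵐ y ∂volume.restrict (ball x r), ENNReal.ofReal (‖gradient ζ y‖ ^ 2) ≤
      Filter.liminf (fun m => q m y) Filter.atTop := by
    filter_upwards [ae_gradient_eq_zero_of_eq_zero hn isOpen_ball hζC] with y hy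
    by_cases hy0 : ζ y = 0
    · rw [hy hy0, norm_zero, zero_pow two_ne_zero, ENNReal.ofReal_zero]
      exact zero_le
    · refine (Filter.Tendsto.liminf_eq ?_).ge
      have hpos : 0 < |ζ y| := abs_pos.2 hy0
      have h0 := tendsto_one_div_add_atTop_nhds_zero_nat (𝕜 := ℝ)
      have h1 : Filter.Tendsto (fun m : ℕ => max (|ζ y| - 1 / ((m : ℝ) + 1)) 0 /
          max |ζ y| (1 / ((m : ℝ) + 1)) * ‖gradient ζ y‖ ^ 2) Filter.atTop
          (nhds (max (|ζ y| - 0) 0 / max |ζ y| 0 * ‖gradient ζ y‖ ^ 2)) := by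
        refine Filter.Tendsto.mul_const _ (Filter.Tendsto.div ?_ ?_ ?_)
        · exact (tendsto_const_nhds.sub h0).max tendsto_const_nhds
        · exact tendsto_const_nhds.max h0
        · exact (lt_max_of_lt_left hpos).ne'
      rw [sub_zero, max_eq_left hpos.le, div_self hpos.ne', one_mul] at h1
      rw [hq]
      exact ENNReal.tendsto_ofReal h1
  refine (lintegral_mono_ae hlim).trans ((lintegral_liminf_le' hmeas).trans ?_)
  refine Filter.liminf_le_of_le (by isBoundedDefault) fun b hb => ?_
  obtain ⟨m, hm⟩ := hb.exists
  refine hm.trans ?_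
  rw [hq]
  exact key m

/-- Comparison with the harmonic replacement: for a locally minimizing entire solution with
linear growth, ∫_{B_R(x₀)} |∇(u - v - φ)|² ≤ C R^{n - 1/2}, where φ is the harmonic
extension of u - v from ∂B_R(x₀) to B_R(x₀). -/
theorem harmonic_replacement_estimate {n : ℕ} (hn : 2 ≤ n)
    (u v : EuclideanSpace ℝ (Fin n) → ℝ)
    (hsol : IsSolution u v) (hmin : IsLocalMinimizer u v)
    (C₀ : ℝ) (hC₀ : 0 < C₀) (hgrowth : ∀ x, u x + v x ≤ C₀ * (1 + ‖x‖)) :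
    ∃ C : ℝ, 0 < C ∧ ∀ (x₀ : EuclideanSpace ℝ (Fin n)) (R : ℝ), 1 ≤ R →
      ∀ φ : EuclideanSpace ℝ (Fin n) → ℝ,
        ContinuousOn φ (closedBall x₀ R) →
        ContDiffOn ℝ 2 φ (ball x₀ R) →
        (∀ y ∈ ball x₀ R, lap φ y = 0) →
        (∀ y ∈ sphere x₀ R, φ y = u y - v y) →
        (∫ y in ball x₀ R, ‖gradient (fun z => u z - v z - φ z) y‖ ^ 2) ≤
          C * R ^ ((n : ℝ) - 1 / 2) := by
  obtain ⟨C, hC, hA⟩ := hsol.exists_almostHarmonicOn (by omega) hmin hC₀ hgrowth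
  exact ⟨C, hC, fun x₀ R hR φ hφc hφ hl hb => (hA x₀ R hR).harmonic_replacement_le (by omega)
    (by positivity) hsol.contDiff_sub hφc hφ hl hb⟩
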